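/- Let D₁ ⊆ B(H₁) and D₂ ⊆ B(H₂) be masas on separable Hilbert spaces and let B₁, …, B_n ⊆ B(H₁,H₂) be masa-bimodules of finite width. Then the weak* closure of B₁ + ⋯ + B_n possesses property S_σ. -/

import Mathlib

open scoped ComplexInnerProductSpace Pointwise
open Set MeasureTheory

noncomputable section

namespace OpSynth

/-! ### The σ-weak (weak*) topology on `B(H,K)` -/

/-- The σ-weak (weak*) topology on the space of bounded operators between Hilbert
spaces: the initial topology with respect to the functionals
`T ↦ ∑' n, ⟪η n, T (ξ n)⟫` associated to square-summable sequences `ξ`, `η`.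
This is the weak* topology arising from the identification of `B(H,K)` with the
dual of the trace class operators. -/
def sigmaWeak (H K : Type*) [NormedAddCommGroup H] [InnerProductSpace ℂ H]
    [NormedAddCommGroup K] [InnerProductSpace ℂ K] :
    TopologicalSpace (H →L[ℂ] K) :=
  ⨅ (ξ : ℕ → H) (η : ℕ → K) (_ : Summable fun n => ‖ξ n‖ ^ 2)
    (_ : Summable fun n => ‖η n‖ ^ 2),
    TopologicalSpace.induced
      (fun T : H →L[ℂ] K => ∑' n, ⟪η n, T (ξ n)⟫) inferInstance

section Basic

variable {H K H₁ H₂ H₃ K₁ K₂ T₁ T₂ : Type*}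
  [NormedAddCommGroup H] [InnerProductSpace ℂ H]
  [NormedAddCommGroup K] [InnerProductSpace ℂ K]
  [NormedAddCommGroup H₁] [InnerProductSpace ℂ H₁]
  [NormedAddCommGroup H₂] [InnerProductSpace ℂ H₂]
  [NormedAddCommGroup H₃] [InnerProductSpace ℂ H₃]
  [NormedAddCommGroup K₁] [InnerProductSpace ℂ K₁]
  [NormedAddCommGroup K₂] [InnerProductSpace ℂ K₂]
  [NormedAddCommGroup T₁] [InnerProductSpace ℂ T₁]
  [NormedAddCommGroup T₂] [InnerProductSpace ℂ T₂]

/-- A set of operators is weak* closed if it is closed in the σ-weak topology. -/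
def WkClosed (S : Set (H →L[ℂ] K)) : Prop :=
  @IsClosed _ (sigmaWeak H K) S

/-- The weak* closure of a set of operators. -/
def wkClosure (S : Set (H →L[ℂ] K)) : Set (H →L[ℂ] K) :=
  @closure _ (sigmaWeak H K) S

/-- A weak* closed (linear) subspace of `B(H,K)`. -/
def IsWkClosedSubspace (S : Set (H →L[ℂ] K)) : Prop :=
  (∃ M : Submodule ℂ (H →L[ℂ] K), (M : Set (H →L[ℂ] K)) = S) ∧ WkClosed S

/-- A map between operator spaces is weak* continuous if it is continuous with
respect to the σ-weak topologies. -/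
def WkContinuous (φ : (H₁ →L[ℂ] H₂) → (K₁ →L[ℂ] K₂)) : Prop :=
  @Continuous _ _ (sigmaWeak H₁ H₂) (sigmaWeak K₁ K₂) φ

/-- The norm of an `n × n` matrix of operators, viewed as an operator on the
column Hilbert space `ℓ²(Fin n, H)`: the supremum over the unit ball of the
ℓ²-norm of the image. -/
def blockNorm {n : ℕ} (M : Matrix (Fin n) (Fin n) (H →L[ℂ] K)) : ℝ :=
  sSup { r | ∃ v : Fin n → H, (∑ j, ‖v j‖ ^ 2) ≤ 1 ∧
    r = Real.sqrt (∑ i, ‖∑ j, M i j (v j)‖ ^ 2) }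

/-- A map `φ : B(H₁,H₂) → B(K₁,K₂)` is completely bounded if its matrix
amplifications are uniformly bounded. -/
def CompletelyBounded (φ : (H₁ →L[ℂ] H₂) → (K₁ →L[ℂ] K₂)) : Prop :=
  ∃ C : ℝ, 0 ≤ C ∧ ∀ (n : ℕ) (M : Matrix (Fin n) (Fin n) (H₁ →L[ℂ] H₂)),
    blockNorm (M.map φ) ≤ C * blockNorm M

/-- `t : H → K → T₁` realizes `T₁` as the Hilbertian tensor product `H ⊗ K`:
`t` is bilinear, multiplicative for inner products, and has total range. -/
def IsTensorEmbedding (t : H → K → T₁) : Prop :=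
  (∀ x x' y, t (x + x') y = t x y + t x' y) ∧
  (∀ x y y', t x (y + y') = t x y + t x y') ∧
  (∀ (c : ℂ) x y, t (c • x) y = c • t x y) ∧
  (∀ (c : ℂ) x y, t x (c • y) = c • t x y) ∧
  (∀ x x' y y', ⟪t x y, t x' y'⟫ = ⟪x, x'⟫ * ⟪y, y'⟫) ∧
  (Submodule.span ℂ { z | ∃ x y, z = t x y }).topologicalClosure = ⊤

/-- `W` is the elementary tensor `S ⊗ R` of the operators `S` and `R`, relative
to the tensor product realizations `t₁`, `t₂`. -/
def IsElemTensor (t₁ : H₁ → K₁ → T₁) (t₂ : H₂ → K₂ → T₂)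
    (W : T₁ →L[ℂ] T₂) (S : H₁ →L[ℂ] H₂) (R : K₁ →L[ℂ] K₂) : Prop :=
  ∀ x y, W (t₁ x y) = t₂ (S x) (R y)

/-- The weak* closed tensor product `V ⊗̄ U`: the weak* closed subspace generated
by the elementary tensors `S ⊗ R` with `S ∈ V`, `R ∈ U`. -/
def wTensor (t₁ : H₁ → K₁ → T₁) (t₂ : H₂ → K₂ → T₂)
    (V : Set (H₁ →L[ℂ] H₂)) (U : Set (K₁ →L[ℂ] K₂)) : Set (T₁ →L[ℂ] T₂) :=
  wkClosure ↑(Submodule.span ℂ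
    { W : T₁ →L[ℂ] T₂ | ∃ S ∈ V, ∃ R ∈ U, IsElemTensor t₁ t₂ W S R })

/-- The Fubini product `F(V,U) = (V ⊗̄ B(K₁,K₂)) ∩ (B(H₁,H₂) ⊗̄ U)`. -/
def Fubini (t₁ : H₁ → K₁ → T₁) (t₂ : H₂ → K₂ → T₂)
    (V : Set (H₁ →L[ℂ] H₂)) (U : Set (K₁ →L[ℂ] K₂)) : Set (T₁ →L[ℂ] T₂) :=
  wTensor t₁ t₂ V univ ∩ wTensor t₁ t₂ univ U

/-- Sum of finitely many subsets of an additive monoid. -/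
def setSum {α : Type*} [AddCommMonoid α] {n : ℕ} (S : Fin n → Set α) : Set α :=
  { x | ∃ f : Fin n → α, (∀ i, f i ∈ S i) ∧ x = ∑ i, f i }

/-- The reflexive hull `Ref W = {T : Tx ∈ closure (W x) for all x}`. -/
def RefHull (W : Set (H →L[ℂ] K)) : Set (H →L[ℂ] K) :=
  { T | ∀ x : H, T x ∈ closure ((fun S : H →L[ℂ] K => S x) '' W) }

end Basic

/-- Property `S_σ`: `F(V,U) = V ⊗̄ U` for every weak* closed subspace `U` of
`B(K₁,K₂)`, all Hilbert spaces `K₁`, `K₂`, and all realizations of the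
corresponding Hilbertian tensor products. -/
def HasSsigma {H₁ H₂ : Type*}
    [NormedAddCommGroup H₁] [InnerProductSpace ℂ H₁]
    [NormedAddCommGroup H₂] [InnerProductSpace ℂ H₂]
    (V : Set (H₁ →L[ℂ] H₂)) : Prop :=
  ∀ (K₁ K₂ T₁ T₂ : Type)
    [NormedAddCommGroup K₁] [InnerProductSpace ℂ K₁] [CompleteSpace K₁]
    [NormedAddCommGroup K₂] [InnerProductSpace ℂ K₂] [CompleteSpace K₂]
    [NormedAddCommGroup T₁] [InnerProductSpace ℂ T₁] [CompleteSpace T₁]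
    [NormedAddCommGroup T₂] [InnerProductSpace ℂ T₂] [CompleteSpace T₂]
    (t₁ : H₁ → K₁ → T₁) (t₂ : H₂ → K₂ → T₂),
    IsTensorEmbedding t₁ → IsTensorEmbedding t₂ →
    ∀ U : Set (K₁ →L[ℂ] K₂), IsWkClosedSubspace U →
      Fubini t₁ t₂ V U = wTensor t₁ t₂ V U

section Masa

variable {H H₁ H₂ H₃ : Type*}
  [NormedAddCommGroup H] [InnerProductSpace ℂ H] [CompleteSpace H]
  [NormedAddCommGroup H₁] [InnerProductSpace ℂ H₁] [CompleteSpace H₁]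
  [NormedAddCommGroup H₂] [InnerProductSpace ℂ H₂] [CompleteSpace H₂]
  [NormedAddCommGroup H₃] [InnerProductSpace ℂ H₃] [CompleteSpace H₃]

/-- A masa: a maximal abelian selfadjoint subalgebra of `B(H)`. -/
def IsMasa (D : StarSubalgebra ℂ (H →L[ℂ] H)) : Prop :=
  (∀ a ∈ D, ∀ b ∈ D, a * b = b * a) ∧
  ∀ E : StarSubalgebra ℂ (H →L[ℂ] H),
    (∀ a ∈ E, ∀ b ∈ E, a * b = b * a) → D ≤ E → E = D

/-- A (weak* closed) `D₂,D₁`-masa-bimodule. -/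
def IsMasaBimodule (D₁ : StarSubalgebra ℂ (H₁ →L[ℂ] H₁))
    (D₂ : StarSubalgebra ℂ (H₂ →L[ℂ] H₂)) (V : Set (H₁ →L[ℂ] H₂)) : Prop :=
  IsWkClosedSubspace V ∧
  ∀ X ∈ V, ∀ A ∈ D₁, ∀ B ∈ D₂, B ∘L X ∘L A ∈ V

/-- A ternary set of operators: closed under the triple product `T S* R`. -/
def IsTernary (M : Set (H₁ →L[ℂ] H₂)) : Prop :=
  ∀ T ∈ M, ∀ S ∈ M, ∀ R ∈ M, T ∘L (ContinuousLinearMap.adjoint S) ∘L R ∈ M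

/-- An orthogonal projection. -/
def IsProj (p : H →L[ℂ] H) : Prop := p ∘L p = p ∧ IsSelfAdjoint p

/-- A minimal non-zero projection of a masa. -/
def IsMinimalProjOf (D : StarSubalgebra ℂ (H →L[ℂ] H)) (p : H →L[ℂ] H) : Prop :=
  p ∈ D ∧ IsProj p ∧ p ≠ 0 ∧
    ∀ q ∈ D, IsProj q → p ∘L q = q → q = 0 ∨ q = p

/-- A projection in a masa is non-atomic if it dominates no minimal non-zero
projection of the masa. -/
def IsNonAtomicProj (D : StarSubalgebra ℂ (H →L[ℂ] H)) (E : H →L[ℂ] H) : Prop :=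
  ∀ p, IsMinimalProjOf D p → ¬ (E ∘L p = p)

/-- A `D₂,D₁`-masa-bimodule map. -/
def IsMasaBimoduleMap (D₁ : StarSubalgebra ℂ (H₁ →L[ℂ] H₁))
    (D₂ : StarSubalgebra ℂ (H₂ →L[ℂ] H₂))
    (φ : (H₁ →L[ℂ] H₂) → (H₁ →L[ℂ] H₂)) : Prop :=
  ∀ (X : H₁ →L[ℂ] H₂), ∀ A ∈ D₁, ∀ B ∈ D₂,
    φ (B ∘L X ∘L A) = B ∘L (φ X) ∘L A

/-- A Schur idempotent: a weak* continuous completely bounded idempotent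
masa-bimodule map. -/
def IsSchurIdempotent (D₁ : StarSubalgebra ℂ (H₁ →L[ℂ] H₁))
    (D₂ : StarSubalgebra ℂ (H₂ →L[ℂ] H₂))
    (φ : (H₁ →L[ℂ] H₂) → (H₁ →L[ℂ] H₂)) : Prop :=
  IsLinearMap ℂ φ ∧ WkContinuous φ ∧ CompletelyBounded φ ∧ φ ∘ φ = φ ∧
    IsMasaBimoduleMap D₁ D₂ φ

/-- A nest: a totally ordered family of closed subspaces containing the
intersection and the closed linear span of any of its subsets. -/
def IsNest (N : Set (Submodule ℂ H)) : Prop :=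
  (∀ p ∈ N, IsClosed (p : Set H)) ∧ IsChain (· ≤ ·) N ∧
  ∀ S : Set (Submodule ℂ H), S ⊆ N →
    sInf S ∈ N ∧ (sSup S).topologicalClosure ∈ N

/-- The nest algebra of a nest: all operators leaving each subspace invariant. -/
def nestAlg (N : Set (Submodule ℂ H)) : Set (H →L[ℂ] H) :=
  { T | ∀ p ∈ N, ∀ x ∈ p, T x ∈ p }

/-- A (weak* closed) nest algebra bimodule. -/
def IsNestBimodule (V : Set (H₁ →L[ℂ] H₂)) : Prop :=
  IsWkClosedSubspace V ∧
  ∃ (N₁ : Set (Submodule ℂ H₁)) (N₂ : Set (Submodule ℂ H₂)),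
    IsNest N₁ ∧ IsNest N₂ ∧
    ∀ X ∈ V, ∀ A ∈ nestAlg N₁, ∀ B ∈ nestAlg N₂, B ∘L X ∘L A ∈ V

/-- A masa-bimodule of finite width: a finite intersection of masa-bimodules
each of which is a nest algebra bimodule. -/
def HasFiniteWidth (D₁ : StarSubalgebra ℂ (H₁ →L[ℂ] H₁))
    (D₂ : StarSubalgebra ℂ (H₂ →L[ℂ] H₂)) (V : Set (H₁ →L[ℂ] H₂)) : Prop :=
  ∃ (k : ℕ) (Vs : Fin k → Set (H₁ →L[ℂ] H₂)),
    (∀ j, IsMasaBimodule D₁ D₂ (Vs j) ∧ IsNestBimodule (Vs j)) ∧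
    V = ⋂ j, Vs j

end Masa

section Algebras

variable {H H₁ H₂ H₃ K : Type*}
  [NormedAddCommGroup H] [InnerProductSpace ℂ H] [CompleteSpace H]
  [NormedAddCommGroup H₁] [InnerProductSpace ℂ H₁] [CompleteSpace H₁]
  [NormedAddCommGroup H₂] [InnerProductSpace ℂ H₂] [CompleteSpace H₂]
  [NormedAddCommGroup H₃] [InnerProductSpace ℂ H₃] [CompleteSpace H₃]

/-- A weak* closed unital operator algebra in `B(H)`. -/
def IsWkClosedUnitalAlg (A : Set (H →L[ℂ] H)) : Prop :=
  IsWkClosedSubspace A ∧ (1 : H →L[ℂ] H) ∈ A ∧ ∀ a ∈ A, ∀ b ∈ A, a ∘L b ∈ A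

/-- `[X Y]`: the weak* closed linear span of the products `x ∘ y`. -/
def mulSpan (X : Set (H₂ →L[ℂ] H₃)) (Y : Set (H₁ →L[ℂ] H₂)) :
    Set (H₁ →L[ℂ] H₃) :=
  wkClosure ↑(Submodule.span ℂ { T : H₁ →L[ℂ] H₃ | ∃ x ∈ X, ∃ y ∈ Y, T = x ∘L y })

/-- The data witnessing a spatial embedding of `A` into `B`. -/
def SpatialPair (A : Set (H₁ →L[ℂ] H₁)) (B : Set (H₂ →L[ℂ] H₂))
    (X : Set (H₁ →L[ℂ] H₂)) (Y : Set (H₂ →L[ℂ] H₁)) : Prop :=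
  IsWkClosedSubspace X ∧ IsWkClosedSubspace Y ∧
  (∀ x ∈ X, ∀ b ∈ B, ∀ a ∈ A, b ∘L x ∘L a ∈ X) ∧
  (∀ y ∈ Y, ∀ a ∈ A, ∀ b ∈ B, a ∘L y ∘L b ∈ Y) ∧
  mulSpan X Y ⊆ B ∧ mulSpan Y X = A

/-- `A` is spatially embedded in `B`. -/
def SpatiallyEmbedded (A : Set (H₁ →L[ℂ] H₁)) (B : Set (H₂ →L[ℂ] H₂)) : Prop :=
  ∃ X Y, SpatialPair A B X Y

/-- `A` and `B` are spatially Morita equivalent. -/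
def SpatiallyMorita (A : Set (H₁ →L[ℂ] H₁)) (B : Set (H₂ →L[ℂ] H₂)) : Prop :=
  ∃ X Y, SpatialPair A B X Y ∧ mulSpan X Y = B

/-- The strong operator topology on `B(H,K)`. -/
def sot (H K : Type*) [NormedAddCommGroup H] [InnerProductSpace ℂ H]
    [NormedAddCommGroup K] [InnerProductSpace ℂ K] :
    TopologicalSpace (H →L[ℂ] K) :=
  TopologicalSpace.induced (fun T : H →L[ℂ] K => (T : H → K)) Pi.topologicalSpace

/-- A commutative subspace lattice (CSL): a strongly closed lattice of mutually
commuting orthogonal projections containing `0` and `1`. -/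
def IsCSL (L : Set (H →L[ℂ] H)) : Prop :=
  (∀ P ∈ L, IsProj P) ∧
  (∀ P ∈ L, ∀ Q ∈ L, P ∘L Q = Q ∘L P) ∧
  (0 : H →L[ℂ] H) ∈ L ∧ (1 : H →L[ℂ] H) ∈ L ∧
  (∀ P ∈ L, ∀ Q ∈ L, P ∘L Q ∈ L ∧ P + Q - P ∘L Q ∈ L) ∧
  @IsClosed _ (sot H H) L

/-- The CSL algebra `Alg L = {T : (1 - P) T P = 0 for all P ∈ L}`. -/
def cslAlg (L : Set (H →L[ℂ] H)) : Set (H →L[ℂ] H) :=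
  { T | ∀ P ∈ L, (1 - P) ∘L T ∘L P = 0 }

/-- A lattice homomorphism between CSLs (preserving meets and joins). -/
def IsLatticeHom (L₁ : Set (H₁ →L[ℂ] H₁)) (L₂ : Set (H₂ →L[ℂ] H₂))
    (φ : (H₁ →L[ℂ] H₁) → (H₂ →L[ℂ] H₂)) : Prop :=
  MapsTo φ L₁ L₂ ∧
  (∀ P ∈ L₁, ∀ Q ∈ L₁, φ (P ∘L Q) = φ P ∘L φ Q) ∧
  (∀ P ∈ L₁, ∀ Q ∈ L₁, φ (P + Q - P ∘L Q) = φ P + φ Q - φ P ∘L φ Q)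

end Algebras

section MeasurePart

variable {X X₁ X₂ : Type*} [MeasurableSpace X] [MeasurableSpace X₁] [MeasurableSpace X₂]

/-- A subset of a product of measure spaces is marginally null if it is
contained in `(M₁ × X₂) ∪ (X₁ × M₂)` with `μ₁ M₁ = μ₂ M₂ = 0`. -/
def MargNull (μ₁ : Measure X₁) (μ₂ : Measure X₂) (E : Set (X₁ × X₂)) : Prop :=
  ∃ (M₁ : Set X₁) (M₂ : Set X₂), MeasurableSet M₁ ∧ MeasurableSet M₂ ∧
    μ₁ M₁ = 0 ∧ μ₂ M₂ = 0 ∧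
    E ⊆ (M₁ ×ˢ (univ : Set X₂)) ∪ ((univ : Set X₁) ×ˢ M₂)

/-- Marginal equivalence: the symmetric difference is marginally null. -/
def MargEquiv (μ₁ : Measure X₁) (μ₂ : Measure X₂) (E F : Set (X₁ × X₂)) : Prop :=
  MargNull μ₁ μ₂ ((E \ F) ∪ (F \ E))

/-- ω-open sets: marginally equivalent to a countable union of measurable
rectangles. -/
def OmegaOpen (μ₁ : Measure X₁) (μ₂ : Measure X₂) (E : Set (X₁ × X₂)) : Prop :=
  ∃ (α : ℕ → Set X₁) (β : ℕ → Set X₂),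
    (∀ n, MeasurableSet (α n)) ∧ (∀ n, MeasurableSet (β n)) ∧
    MargEquiv μ₁ μ₂ E (⋃ n, (α n) ×ˢ (β n))

/-- ω-closed sets: complements of ω-open sets. -/
def OmegaClosed (μ₁ : Measure X₁) (μ₂ : Measure X₂) (E : Set (X₁ × X₂)) : Prop :=
  OmegaOpen μ₁ μ₂ Eᶜ

/-- `A` is a multiplication operator on `L²(X,μ)`: `A f = φ · f` for some
essentially bounded function `φ`.  The collection `{A | IsMultOp μ A}` is the
multiplication masa of `L^∞(X,μ)`. -/
def IsMultOp (μ : Measure X) (A : Lp ℂ 2 μ →L[ℂ] Lp ℂ 2 μ) : Prop :=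
  ∃ φ : X → ℂ, AEStronglyMeasurable φ μ ∧ (∃ C, ∀ᵐ x ∂μ, ‖φ x‖ ≤ C) ∧
    ∀ f : Lp ℂ 2 μ, ⇑(A f) =ᵐ[μ] fun x => φ x * f x

/-- A (weak* closed) masa-bimodule over the multiplication masas. -/
def IsMultBimodule (μ₁ : Measure X₁) (μ₂ : Measure X₂)
    (V : Set (Lp ℂ 2 μ₁ →L[ℂ] Lp ℂ 2 μ₂)) : Prop :=
  IsWkClosedSubspace V ∧
  ∀ X ∈ V, ∀ (A : Lp ℂ 2 μ₁ →L[ℂ] Lp ℂ 2 μ₁) (B : Lp ℂ 2 μ₂ →L[ℂ] Lp ℂ 2 μ₂),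
    IsMultOp μ₁ A → IsMultOp μ₂ B → B ∘L X ∘L A ∈ V

/-- `T` is supported on `κ`: `M_{χ_β} T M_{χ_α} = 0` (equivalently,
`⟪T f, g⟫ = 0` whenever `f` vanishes off `α` and `g` vanishes off `β`)
whenever the rectangle `α × β` intersects `κ` marginally nullly. -/
def SupportedOn (μ₁ : Measure X₁) (μ₂ : Measure X₂) (κ : Set (X₁ × X₂))
    (T : Lp ℂ 2 μ₁ →L[ℂ] Lp ℂ 2 μ₂) : Prop :=
  ∀ (α : Set X₁) (β : Set X₂), MeasurableSet α → MeasurableSet β →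
    MargNull μ₁ μ₂ ((α ×ˢ β) ∩ κ) →
    ∀ (f : Lp ℂ 2 μ₁) (g : Lp ℂ 2 μ₂),
      (∀ᵐ x ∂μ₁, x ∉ α → f x = 0) → (∀ᵐ y ∂μ₂, y ∉ β → g y = 0) →
      ⟪T f, g⟫ = (0 : ℂ)

/-- `M_max κ`: the space of all operators supported on `κ` — the largest
masa-bimodule with support `κ`. -/
def Mmax (μ₁ : Measure X₁) (μ₂ : Measure X₂) (κ : Set (X₁ × X₂)) :
    Set (Lp ℂ 2 μ₁ →L[ℂ] Lp ℂ 2 μ₂) :=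
  { T | SupportedOn μ₁ μ₂ κ T }

/-- `U` has support `κ`: `κ` is ω-closed and `Ref U = M_max κ`. -/
def HasSupport (μ₁ : Measure X₁) (μ₂ : Measure X₂)
    (U : Set (Lp ℂ 2 μ₁ →L[ℂ] Lp ℂ 2 μ₂)) (κ : Set (X₁ × X₂)) : Prop :=
  OmegaClosed μ₁ μ₂ κ ∧ RefHull U = Mmax μ₁ μ₂ κ

/-- `M_min κ`: the smallest weak* closed masa-bimodule with support `κ`,
realized as the intersection of all weak* closed masa-bimodules with support `κ`. -/
def Mmin (μ₁ : Measure X₁) (μ₂ : Measure X₂) (κ : Set (X₁ × X₂)) :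
    Set (Lp ℂ 2 μ₁ →L[ℂ] Lp ℂ 2 μ₂) :=
  ⋂₀ { U | IsMultBimodule μ₁ μ₂ U ∧ HasSupport μ₁ μ₂ U κ }

/-- `κ` is operator synthetic if it is ω-closed and `M_min κ = M_max κ`. -/
def OperatorSynthetic (μ₁ : Measure X₁) (μ₂ : Measure X₂)
    (κ : Set (X₁ × X₂)) : Prop :=
  OmegaClosed μ₁ μ₂ κ ∧ Mmin μ₁ μ₂ κ = Mmax μ₁ μ₂ κ

/-- A masa-bimodule of finite width over the multiplication masas. -/
def MultFiniteWidth (μ₁ : Measure X₁) (μ₂ : Measure X₂)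
    (V : Set (Lp ℂ 2 μ₁ →L[ℂ] Lp ℂ 2 μ₂)) : Prop :=
  ∃ (k : ℕ) (Vs : Fin k → Set (Lp ℂ 2 μ₁ →L[ℂ] Lp ℂ 2 μ₂)),
    (∀ j, IsMultBimodule μ₁ μ₂ (Vs j) ∧ IsNestBimodule (Vs j)) ∧
    V = ⋂ j, Vs j

/-- A set of finite width: the support of a masa-bimodule of finite width. -/
def FiniteWidthSet (μ₁ : Measure X₁) (μ₂ : Measure X₂)
    (κ : Set (X₁ × X₂)) : Prop :=
  ∃ V, MultFiniteWidth μ₁ μ₂ V ∧ HasSupport μ₁ μ₂ V κ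

end MeasurePart

/-- The flip `ρ : (X₁ × X₂) × (Y₁ × Y₂) → (X₁ × Y₁) × (X₂ × Y₂)`. -/
def flipProd {X₁ X₂ Y₁ Y₂ : Type*} :
    (X₁ × X₂) × (Y₁ × Y₂) → (X₁ × Y₁) × (X₂ × Y₂) :=
  fun q => ((q.1.1, q.2.1), (q.1.2, q.2.2))

end OpSynth



open scoped ComplexInnerProductSpace Pointwise
open Set OpSynth

namespace OpSynth
set_option linter.all false
section Sig
open Filter Topology
variable {H K H' K' : Type*} [NormedAddCommGroup H] [InnerProductSpace ℂ H]
  [NormedAddCommGroup K] [InnerProductSpace ℂ K]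
  [NormedAddCommGroup H'] [InnerProductSpace ℂ H']
  [NormedAddCommGroup K'] [InnerProductSpace ℂ K']

def fnl (ξ : ℕ → H) (η : ℕ → K) (T : H →L[ℂ] K) : ℂ := ∑' n, ⟪η n, T (ξ n)⟫

def SqS (ξ : ℕ → H) : Prop := Summable fun n => ‖ξ n‖ ^ 2

lemma SqS.map {ξ : ℕ → H} (h : SqS ξ) (A : H →L[ℂ] K) : SqS (fun n => A (ξ n)) := by
  unfold SqS at *
  refine Summable.of_nonneg_of_le (fun n => by positivity) (fun n => ?_) (h.mul_left (‖A‖ ^ 2))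
  rw [← mul_pow]
  gcongr
  exact A.le_opNorm _

lemma SqS.prod {ξ : ℕ → H} {η : ℕ → K} (h : SqS ξ) (h' : SqS η) :
    Summable fun n => ‖η n‖ * ‖ξ n‖ := by
  unfold SqS at *
  refine Summable.of_nonneg_of_le (fun n => by positivity) (fun n => ?_) (h.add h')
  nlinarith [sq_nonneg (‖ξ n‖ - ‖η n‖), sq_nonneg (‖ξ n‖), sq_nonneg (‖η n‖)]

lemma fnl_term_le (x : H) (y : K) (T : H →L[ℂ] K) {C : ℝ} (hC : ‖T‖ ≤ C) :
    ‖⟪y, T x⟫‖ ≤ C * (‖y‖ * ‖x‖) := by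
  calc ‖⟪y, T x⟫‖ ≤ ‖y‖ * ‖T x‖ := norm_inner_le_norm _ _
    _ ≤ ‖y‖ * (C * ‖x‖) := by gcongr; exact T.le_of_opNorm_le hC x
    _ = _ := by ring

lemma fnl_summable {ξ : ℕ → H} {η : ℕ → K} (h : SqS ξ) (h' : SqS η) (T : H →L[ℂ] K) :
    Summable fun n => ⟪η n, T (ξ n)⟫ :=
  Summable.of_norm_bounded ((h.prod h').mul_left ‖T‖) fun n => fnl_term_le _ _ T le_rfl

lemma fnl_norm_le {ξ : ℕ → H} {η : ℕ → K} (h : SqS ξ) (h' : SqS η) (T : H →L[ℂ] K) :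
    ‖fnl ξ η T‖ ≤ ‖T‖ * ∑' n, ‖η n‖ * ‖ξ n‖ := by
  rw [← tsum_mul_left]
  exact tsum_of_norm_bounded ((h.prod h').mul_left ‖T‖).hasSum fun n => fnl_term_le _ _ T le_rfl

lemma fnl_add {ξ : ℕ → H} {η : ℕ → K} (h : SqS ξ) (h' : SqS η) (T S : H →L[ℂ] K) :
    fnl ξ η (T + S) = fnl ξ η T + fnl ξ η S := by
  unfold fnl
  rw [← (fnl_summable h h' T).tsum_add (fnl_summable h h' S)]
  simp [inner_add_right]

lemma fnl_smul {ξ : ℕ → H} {η : ℕ → K} (c : ℂ) (T : H →L[ℂ] K) :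
    fnl ξ η (c • T) = c * fnl ξ η T := by
  unfold fnl
  rw [← tsum_mul_left]
  simp [inner_smul_right]

lemma fnl_sub {ξ : ℕ → H} {η : ℕ → K} (h : SqS ξ) (h' : SqS η) (T S : H →L[ℂ] K) :
    fnl ξ η (T - S) = fnl ξ η T - fnl ξ η S := by
  unfold fnl
  rw [← (fnl_summable h h' T).tsum_sub (fnl_summable h h' S)]
  simp [inner_sub_right]

lemma SqS_single (x : H) : SqS (fun n : ℕ => if n = 0 then x else 0) := by
  apply summable_of_ne_finset_zero (s := {0})
  intro b hb
  simp at hb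
  simp [hb]

lemma fnl_single (x : H) (y : K) (T : H →L[ℂ] K) :
    fnl (fun n : ℕ => if n = 0 then x else 0) (fun n : ℕ => if n = 0 then y else 0) T
      = ⟪y, T x⟫ := by
  unfold fnl
  rw [tsum_eq_single 0]
  · simp
  · intro b hb; simp [hb]

lemma tendsto_sw {ι : Type*} {l : Filter ι} {f : ι → H →L[ℂ] K} {T : H →L[ℂ] K} :
    Tendsto f l (@nhds _ (sigmaWeak H K) T) ↔
      ∀ (ξ : ℕ → H) (η : ℕ → K), SqS ξ → SqS η →
        Tendsto (fun i => fnl ξ η (f i)) l (𝓝 (fnl ξ η T)) := by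
  unfold sigmaWeak
  simp only [nhds_iInf, nhds_induced, tendsto_iInf, tendsto_comap_iff]
  rfl

lemma tendsto_sw_inner {ι : Type*} {l : Filter ι} {f : ι → H →L[ℂ] K} {T : H →L[ℂ] K}
    (h : Tendsto f l (@nhds _ (sigmaWeak H K) T)) (x : H) (y : K) :
    Tendsto (fun i => ⟪y, f i x⟫) l (𝓝 ⟪y, T x⟫) := by
  have := tendsto_sw.1 h _ _ (SqS_single x) (SqS_single y)
  simpa only [fnl_single] using this

lemma wkc_of {φ : (H →L[ℂ] K) → (H' →L[ℂ] K')}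
    (h : ∀ (ξ : ℕ → H') (η : ℕ → K'), SqS ξ → SqS η → ∃ ξ' : ℕ → H, ∃ η' : ℕ → K, 
      SqS ξ' ∧ SqS η' ∧ ∀ X, fnl ξ η (φ X) = fnl ξ' η' X) : WkContinuous φ := by
  unfold WkContinuous
  letI := sigmaWeak H K
  letI := sigmaWeak H' K'
  rw [continuous_iff_continuousAt]
  intro T
  unfold ContinuousAt
  rw [tendsto_sw]
  intro ξ η h1 h2
  obtain ⟨ξ', η', h1', h2', he⟩ := h ξ η h1 h2
  simp only [he]
  exact tendsto_sw.1 tendsto_id ξ' η' h1' h2'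

lemma wkc_add (Y : H →L[ℂ] K) : WkContinuous (fun X : H →L[ℂ] K => X + Y) := by
  unfold WkContinuous
  letI := sigmaWeak H K
  rw [continuous_iff_continuousAt]
  intro T
  unfold ContinuousAt
  rw [tendsto_sw]
  intro ξ η h1 h2
  simp only [fnl_add h1 h2]
  exact (tendsto_sw.1 tendsto_id ξ η h1 h2).add_const _

lemma wkc_smul (c : ℂ) : WkContinuous (fun X : H →L[ℂ] K => c • X) := by
  unfold WkContinuous
  letI := sigmaWeak H K
  rw [continuous_iff_continuousAt]
  intro T
  unfold ContinuousAt
  rw [tendsto_sw]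
  intro ξ η h1 h2
  simp only [fnl_smul]
  exact (tendsto_sw.1 tendsto_id ξ η h1 h2).const_mul _

lemma wkc_comp [CompleteSpace K] [CompleteSpace K'] (A : H' →L[ℂ] H) (B : K →L[ℂ] K') :
    WkContinuous (fun X : H →L[ℂ] K => B ∘L X ∘L A) := by
  apply wkc_of
  intro ξ η h1 h2
  refine ⟨fun n => A (ξ n), fun n => ContinuousLinearMap.adjoint B (η n), h1.map A, 
    h2.map _, fun X => ?_⟩
  unfold fnl
  simp [ContinuousLinearMap.adjoint_inner_left]

lemma subset_wkClosure (S : Set (H →L[ℂ] K)) : S ⊆ wkClosure S :=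
  @subset_closure _ (sigmaWeak H K) S

lemma wkClosed_wkClosure (S : Set (H →L[ℂ] K)) : WkClosed (wkClosure S) :=
  @isClosed_closure _ (sigmaWeak H K) S

lemma wkClosure_min {S C : Set (H →L[ℂ] K)} (h : S ⊆ C) (hC : WkClosed C) : wkClosure S ⊆ C :=
  @closure_minimal _ (sigmaWeak H K) _ _ h hC

lemma wkClosure_mono {S C : Set (H →L[ℂ] K)} (h : S ⊆ C) : wkClosure S ⊆ wkClosure C :=
  wkClosure_min (h.trans (subset_wkClosure _)) (wkClosed_wkClosure _)

lemma WkClosed.wkClosure_eq {C : Set (H →L[ℂ] K)} (hC : WkClosed C) : wkClosure C = C :=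
  @IsClosed.closure_eq _ (sigmaWeak H K) _ hC

lemma WkClosed.mem_of_tendsto {ι : Type*} {l : Filter ι} [NeBot l] {f : ι → H →L[ℂ] K}
    {T : H →L[ℂ] K} {C : Set (H →L[ℂ] K)} (hC : WkClosed C) 
    (h : Tendsto f l (@nhds _ (sigmaWeak H K) T)) (hf : ∀ᶠ i in l, f i ∈ C) : T ∈ C :=
  by
  let _ := sigmaWeak H K
  exact IsClosed.mem_of_tendsto (show IsClosed C from hC) h hf

lemma wkClosure_map {φ : (H →L[ℂ] K) → (H' →L[ℂ] K')} (hφ : WkContinuous φ)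
    {S : Set (H →L[ℂ] K)} {C : Set (H' →L[ℂ] K')} (hC : WkClosed C)
    (h : ∀ X ∈ S, φ X ∈ C) : ∀ X ∈ wkClosure S, φ X ∈ C := by
  have : WkClosed (φ ⁻¹' C) := 
    @IsClosed.preimage _ _ (sigmaWeak H K) (sigmaWeak H' K') _ hφ _ hC
  exact wkClosure_min h this

lemma WkClosed.inter {S C : Set (H →L[ℂ] K)} (hS : WkClosed S) (hC : WkClosed C) :
   WkClosed (S ∩ C) := @IsClosed.inter _ _ _ (sigmaWeak H K) hS hC

lemma WkClosed.iInter {ι : Sort*} {S : ι → Set (H →L[ℂ] K)} (hS : ∀ i, WkClosed (S i)) :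
   WkClosed (⋂ i, S i) := @isClosed_iInter _ _ (sigmaWeak H K) _ hS

/-- weak* closure of a submodule, as a submodule -/
def wkSub (M : Submodule ℂ (H →L[ℂ] K)) : Submodule ℂ (H →L[ℂ] K) where
  carrier := wkClosure M
  zero_mem' := subset_wkClosure _ M.zero_mem
  add_mem' := by
    intro a b ha hb
    have h1 : ∀ X ∈ wkClosure (M : Set (H →L[ℂ] K)), ∀ Y ∈ M, X + Y ∈ wkClosure (M : Set (H →L[ℂ] K)) :=
      fun X hX Y hY => wkClosure_map (wkc_add Y) (wkClosed_wkClosure _)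
        (fun X hX => subset_wkClosure _ (M.add_mem hX hY)) X hX
    have h2 := wkClosure_map (wkc_add a) (wkClosed_wkClosure (M : Set (H →L[ℂ] K)))
      (fun Y hY => by rw [add_comm]; exact h1 a ha Y hY) b hb
    rwa [add_comm] at h2
  smul_mem' := by
    intro c x hx
    exact wkClosure_map (wkc_smul c) (wkClosed_wkClosure (M : Set (H →L[ℂ] K)))
      (fun Y hY => subset_wkClosure _ (M.smul_mem c hY)) x hx

@[simp] lemma coe_wkSub (M : Submodule ℂ (H →L[ℂ] K)) : (wkSub M : Set (H →L[ℂ] K)) = wkClosure M := rfl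

lemma norm_tendsto_sw {ι : Type*} {l : Filter ι} {f : ι → H →L[ℂ] K} {T : H →L[ℂ] K}
    (h : Tendsto f l (𝓝 T)) : Tendsto f l (@nhds _ (sigmaWeak H K) T) := by
  rw [tendsto_sw]
  intro ξ η h1 h2
  rw [tendsto_iff_norm_sub_tendsto_zero] at h ⊢
  have := h.mul_const (∑' n, ‖η n‖ * ‖ξ n‖)
  rw [zero_mul] at this
  refine squeeze_zero (fun _ => norm_nonneg _) (fun i => ?_) this
  rw [← fnl_sub h1 h2]
  exact fnl_norm_le h1 h2 _

lemma WkClosed.isClosed {C : Set (H →L[ℂ] K)} (hC : WkClosed C) : IsClosed C := by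
  rw [← closure_subset_iff_isClosed]
  intro x hx
  rw [mem_closure_iff_clusterPt, ← mem_closure_iff_clusterPt] at hx
  obtain ⟨u, hu, hl⟩ := mem_closure_iff_seq_limit.1 hx
  exact hC.mem_of_tendsto (norm_tendsto_sw hl) (Eventually.of_forall hu)

/-- bounded pointwise-weak convergence on total sets implies σ-weak convergence. -/
lemma tendsto_sw_of_bdd {ι : Type*} {l : Filter ι} {f : ι → H →L[ℂ] K} {T : H →L[ℂ] K} {C : ℝ}
    (hb : ∀ i, ‖f i‖ ≤ C) 
    {s : Set H} {s' : Set K} (hs : (Submodule.span ℂ s).topologicalClosure = ⊤)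
    (hs' : (Submodule.span ℂ s').topologicalClosure = ⊤)
    (h : ∀ x ∈ s, ∀ y ∈ s', Tendsto (fun i => ⟪y, f i x⟫) l (𝓝 ⟪y, T x⟫)) : 
    Tendsto f l (@nhds _ (sigmaWeak H K) T) := by
  rcases isEmpty_or_nonempty ι with he | ⟨⟨i0⟩⟩
  · rw [filter_eq_bot_of_isEmpty l]; exact tendsto_bot
  have hC : 0 ≤ C := (norm_nonneg _).trans (hb i0)
  -- step: subtract
  have key : ∀ x y, Tendsto (fun i => ⟪y, (f i - T) x⟫) l (𝓝 0) := by
    have hb' : ∀ i, ‖f i - T‖ ≤ C + ‖T‖ := fun i => (norm_sub_le _ _).trans (by gcongr; exact hb i)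
    set D := C + ‖T‖ with hD
    have hD0 : 0 ≤ D := by positivity
    -- generic x in the closed submodule
    have h1 : ∀ y ∈ s', ∀ x, Tendsto (fun i => ⟪y, (f i - T) x⟫) l (𝓝 0) := by
      intro y hy
      have hsp : ∀ x ∈ Submodule.span ℂ s, Tendsto (fun i => ⟪y, (f i - T) x⟫) l (𝓝 0) := by
        intro x hx
        induction hx using Submodule.span_induction with
        | mem x hx => 
          have := (h x hx y hy).sub_const ⟪y, T x⟫
          simpa [inner_sub_right] using this
        | zero => simpa only [map_zero, inner_zero_right, inner_zero_left] using tendsto_const_nhds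
        | add x x' _ _ h1 h2 => simpa only [map_add, inner_add_right, add_zero] using h1.add h2
        | smul c x _ h1 => simpa only [map_smul, inner_smul_right, mul_zero] using h1.const_mul c
      intro x
      have hx : x ∈ (Submodule.span ℂ s).topologicalClosure := by rw [hs]; trivial
      rw [← SetLike.mem_coe, Submodule.topologicalClosure_coe, Metric.mem_closure_iff] at hx
      rw [Metric.tendsto_nhds]
      intro ε hε
      obtain ⟨x', hx', hd⟩ := hx (ε / 2 / (D * ‖y‖ + 1)) (by positivity)
      filter_upwards [(Metric.tendsto_nhds.1 (hsp x' hx')) (ε / 2) (by positivity)] with i hi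
      rw [dist_zero_right] at hi ⊢
      have e : ⟪y, (f i - T) x⟫ = ⟪y, (f i - T) x'⟫ + ⟪y, (f i - T) (x - x')⟫ := by
        rw [← inner_add_right, ← map_add, add_sub_cancel]
      have h3 := fnl_term_le (x - x') y (f i - T) (hb' i)
      rw [dist_eq_norm] at hd
      have h4 : D * (‖y‖ * ‖x - x'‖) ≤ ε / 2 := by
        rw [lt_div_iff₀ (by positivity)] at hd
        nlinarith [norm_nonneg (x - x')]
      rw [e]
      linarith [norm_add_le ⟪y, (f i - T) x'⟫ ⟪y, (f i - T) (x - x')⟫]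
    intro x
    have hsp : ∀ y ∈ Submodule.span ℂ s', Tendsto (fun i => ⟪y, (f i - T) x⟫) l (𝓝 0) := by
        intro y hy
        induction hy using Submodule.span_induction with
        | mem y hy => exact h1 y hy x
        | zero => simpa only [map_zero, inner_zero_right, inner_zero_left] using tendsto_const_nhds
        | add x x' _ _ h1 h2 => simpa only [map_add, inner_add_left, add_zero] using h1.add h2
        | smul c x _ h1 => simpa only [inner_smul_left, mul_zero] using h1.const_mul (starRingEnd ℂ c)
    intro y
    have hx : y ∈ (Submodule.span ℂ s').topologicalClosure := by rw [hs']; trivial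
    rw [← SetLike.mem_coe, Submodule.topologicalClosure_coe, Metric.mem_closure_iff] at hx
    rw [Metric.tendsto_nhds]
    intro ε hε
    obtain ⟨y', hy', hd⟩ := hx (ε / 2 / (D * ‖x‖ + 1)) (by positivity)
    filter_upwards [(Metric.tendsto_nhds.1 (hsp y' hy')) (ε / 2) (by positivity)] with i hi
    rw [dist_zero_right] at hi ⊢
    have e : ⟪y, (f i - T) x⟫ = ⟪y', (f i - T) x⟫ + ⟪y - y', (f i - T) x⟫ := by
      rw [← inner_add_left, add_sub_cancel]
    have h3 := fnl_term_le x (y - y') (f i - T) (hb' i)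
    rw [dist_eq_norm] at hd
    have h4 : D * (‖y - y'‖ * ‖x‖) ≤ ε / 2 := by
      rw [lt_div_iff₀ (by positivity)] at hd
      nlinarith [norm_nonneg (y - y')]
    rw [e]
    linarith [norm_add_le ⟪y', (f i - T) x⟫ ⟪y - y', (f i - T) x⟫]
  rw [tendsto_sw]
  intro ξ η h1 h2
  unfold fnl
  refine tendsto_tsum_of_dominated_convergence ((h1.prod h2).mul_left C) (fun k => ?_) 
    (Eventually.of_forall fun i k => fnl_term_le _ _ _ (hb i))
  have := (key (ξ k) (η k)).add_const ⟪η k, T (ξ k)⟫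
  simpa [inner_sub_right] using this

lemma tendsto_sw_of_bdd' {ι : Type*} {l : Filter ι} {f : ι → H →L[ℂ] K} {T : H →L[ℂ] K} {C : ℝ}
    (hb : ∀ i, ‖f i‖ ≤ C) 
    (h : ∀ x y, Tendsto (fun i => ⟪y, f i x⟫) l (𝓝 ⟪y, T x⟫)) : 
    Tendsto f l (@nhds _ (sigmaWeak H K) T) := by
  apply tendsto_sw_of_bdd hb (s := univ) (s' := univ)
  · rw [Submodule.span_univ]; exact top_le_iff.1 (Submodule.le_topologicalClosure _)
  · rw [Submodule.span_univ]; exact top_le_iff.1 (Submodule.le_topologicalClosure _)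
  · intro x _ y _; exact h x y

lemma exists_op_of_form [CompleteSpace K] (z : H → K → ℂ) {C : ℝ} (hC : 0 ≤ C) 
    (h1 : ∀ x x' y, z (x + x') y = z x y + z x' y) 
    (h2 : ∀ (c : ℂ) x y, z (c • x) y = starRingEnd ℂ c * z x y) 
    (h3 : ∀ x y y', z x (y + y') = z x y + z x y') 
    (h4 : ∀ (c : ℂ) x y, z x (c • y) = c * z x y) 
    (bd : ∀ x y, ‖z x y‖ ≤ C * ‖x‖ * ‖y‖) : ∃ T : H →L[ℂ] K, ‖T‖ ≤ C ∧ ∀ x y, ⟪T x, y⟫ = z x y := by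
  let B : H →L⋆[ℂ] K →L[ℂ] ℂ := LinearMap.mkContinuous₂ 
    (LinearMap.mk₂'ₛₗ (starRingEnd ℂ) (RingHom.id ℂ) z h1 h2 h3 h4) C bd
  let T : H →L[ℂ] K := 
    (InnerProductSpace.toDual ℂ K).symm.toContinuousLinearEquiv.toContinuousLinearMap.comp B
  have hT : ∀ x y, ⟪T x, y⟫ = z x y := by
    intro x y
    simp [T, B]
    rfl
  refine ⟨T, ?_, hT⟩
  refine T.opNorm_le_bound hC fun x => ?_
  have h := bd x (T x)
  rw [← hT, inner_self_eq_norm_sq_to_K] at h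
  rcases eq_or_ne (T x) 0 with h0 | h0
  · rw [h0, norm_zero]; positivity
  · have h5 : 0 < ‖T x‖ := norm_pos_iff.2 h0
    have h6 : ‖T x‖ * ‖T x‖ ≤ C * ‖x‖ * ‖T x‖ := by simpa [sq] using h
    exact le_of_mul_le_mul_right h6 h5

lemma exists_ultra_limit [CompleteSpace K] {ι : Type*} (l : Ultrafilter ι) {f : ι → H →L[ℂ] K} {C : ℝ}
    (hC : 0 ≤ C) (hb : ∀ i, ‖f i‖ ≤ C) : 
    ∃ T : H →L[ℂ] K, ‖T‖ ≤ C ∧ Tendsto f l (@nhds _ (sigmaWeak H K) T) := by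
  have lim : ∀ (y : K) (x : H), ∃ z : ℂ, Tendsto (fun i => ⟪f i x, y⟫) l (𝓝 z) := by
    intro y x
    have hc := isCompact_closedBall (0 : ℂ) (C * (‖y‖ * ‖x‖))
    obtain ⟨z, _, hz⟩ := hc.ultrafilter_le_nhds (l.map (fun i => ⟪f i x, y⟫)) (by
      simp only [Ultrafilter.coe_map, le_principal_iff, mem_map]
      apply univ_mem'
      intro i
      simp only [mem_preimage, Metric.mem_closedBall, dist_zero_right]
      rw [norm_inner_symm]
      exact fnl_term_le _ _ _ (hb i))
    exact ⟨z, hz⟩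
  choose z hz using lim
  have bd : ∀ x y, ‖z y x‖ ≤ C * ‖x‖ * ‖y‖ := by
    intro x y
    refine le_of_tendsto (hz y x).norm (Eventually.of_forall fun i => ?_)
    rw [norm_inner_symm]
    have := fnl_term_le x y _ (hb i)
    linarith
  obtain ⟨T, hT, hT'⟩ := exists_op_of_form (fun x y => z y x) hC
    (fun x x' y => tendsto_nhds_unique (hz y (x + x')) (by simpa [inner_add_left] using (hz y x).add (hz y x')))
    (fun c x y => tendsto_nhds_unique (hz y (c • x)) (by simpa only [map_smul, inner_smul_left] using (hz y x).const_mul (starRingEnd ℂ c)))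
    (fun x y y' => tendsto_nhds_unique (hz (y + y') x) (by simpa [inner_add_right] using (hz y x).add (hz y' x)))
    (fun c x y => tendsto_nhds_unique (hz (c • y) x) (by simpa only [map_smul, inner_smul_right] using (hz y x).const_mul c))
    bd
  refine ⟨T, hT, tendsto_sw_of_bdd' hb fun x y => ?_⟩
  have := (Complex.continuous_conj.tendsto _).comp (hz y x)
  rw [← hT'] at this
  simpa [Function.comp_def] using this
end Sig
end OpSynth

namespace OpSynth
set_option linter.all false
section Ten
open Filter Topology

section
variable {H K T H' K' T' : Type*} [NormedAddCommGroup H] [InnerProductSpace ℂ H]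
  [NormedAddCommGroup K] [InnerProductSpace ℂ K]
  [NormedAddCommGroup T] [InnerProductSpace ℂ T]
  [NormedAddCommGroup H'] [InnerProductSpace ℂ H']
  [NormedAddCommGroup K'] [InnerProductSpace ℂ K']
  [NormedAddCommGroup T'] [InnerProductSpace ℂ T']

open scoped ComplexOrder in
lemma gram_ineq {n : ℕ} (x : Fin n → H) (y : Fin n → K) (S : H →L[ℂ] H') {C : ℝ} (hC : ‖S‖ ≤ C) :
    (∑ k, ∑ l, ⟪S (x k), S (x l)⟫ * ⟪y k, y l⟫).re ≤ C ^ 2 * (∑ k, ∑ l, ⟪x k, x l⟫ * ⟪y k, y l⟫).re := by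
  have h1 : ((C ^ 2 : ℂ) • Matrix.gram ℂ x - Matrix.gram ℂ (fun k => S (x k))).PosSemidef := by
    refine .of_dotProduct_mulVec_nonneg ?_ ?_
    · have h1 := Matrix.isHermitian_gram ℂ x
      have h2 := Matrix.isHermitian_gram ℂ (fun k => S (x k))
      refine Matrix.IsHermitian.sub ?_ h2
      refine h1.smul ?_
      rw [isSelfAdjoint_iff]
      simp
    · intro v
      rw [Matrix.sub_mulVec, Matrix.smul_mulVec, dotProduct_sub, dotProduct_smul,
        Matrix.star_dotProduct_gram_mulVec, Matrix.star_dotProduct_gram_mulVec]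
      have : ∑ i, v i • S (x i) = S (∑ i, v i • x i) := by simp
      rw [this, inner_self_eq_norm_sq_to_K, inner_self_eq_norm_sq_to_K]
      have h3 := S.le_of_opNorm_le hC (∑ i, v i • x i)
      have h4 : ‖S (∑ i, v i • x i)‖ ^ 2 ≤ C ^ 2 * ‖∑ i, v i • x i‖ ^ 2 := by
        rw [← mul_pow]; gcongr
      rw [sub_nonneg, smul_eq_mul]
      have h5 := Complex.real_le_real.2 h4
      push_cast at h5
      exact h5
  have h2 := h1.hadamard (Matrix.posSemidef_gram ℂ y)
  have h3 := h2.dotProduct_mulVec_nonneg (fun _ => 1)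
  have h4 := (Complex.le_def.1 h3).1
  simp only [dotProduct, Matrix.mulVec, Matrix.hadamard_apply, Matrix.sub_apply, Matrix.smul_apply,
    Matrix.gram_apply, Pi.star_apply, star_one, one_mul, mul_one, smul_eq_mul, sub_mul,
    Finset.sum_sub_distrib, Complex.sub_re, mul_assoc, ← Finset.mul_sum] at h4
  have h5 : ((C : ℂ) ^ 2 * ∑ k, ∑ l, ⟪x k, x l⟫ * ⟪y k, y l⟫).re = 
     C ^ 2 * (∑ k, ∑ l, ⟪x k, x l⟫ * ⟪y k, y l⟫).re := by
    rw [← Complex.ofReal_pow, Complex.re_ofReal_mul]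
  rw [h5] at h4
  simp only [Complex.zero_re] at h4
  linarith

variable {t : H → K → T} {t' : H' → K' → T'}

lemma IsTensorEmbedding.inner (ht : IsTensorEmbedding t) (x x' : H) (y y' : K) :
  ⟪t x y, t x' y'⟫ = ⟪x, x'⟫ * ⟪y, y'⟫ := ht.2.2.2.2.1 x x' y y'

lemma IsTensorEmbedding.norm (ht : IsTensorEmbedding t) (x : H) (y : K) :
    ‖t x y‖ = ‖x‖ * ‖y‖ := by
  have h : ‖t x y‖ ^ 2 = (‖x‖ * ‖y‖) ^ 2 := by
    have := ht.inner x x y y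
    rw [inner_self_eq_norm_sq_to_K, inner_self_eq_norm_sq_to_K, inner_self_eq_norm_sq_to_K] at this
    rw [mul_pow]
    exact_mod_cast this
  exact (pow_left_inj₀ (norm_nonneg _) (by positivity) two_ne_zero).1 h

lemma IsTensorEmbedding.norm_sum (ht : IsTensorEmbedding t) {n : ℕ} (x : Fin n → H) (y : Fin n → K) :
    ‖∑ k, t (x k) (y k)‖ ^ 2 = (∑ k, ∑ l, ⟪x k, x l⟫ * ⟪y k, y l⟫).re := by
  have h := inner_self_eq_norm_sq_to_K (𝕜 := ℂ) (∑ k, t (x k) (y k))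
  rw [sum_inner] at h
  simp only [inner_sum, ht.inner] at h
  rw [h]
  norm_cast

def IsTensorEmbedding.lin (ht : IsTensorEmbedding t) : TensorProduct ℂ H K →ₗ[ℂ] T :=
  TensorProduct.lift (LinearMap.mk₂ ℂ t ht.1 ht.2.2.1 ht.2.1 ht.2.2.2.1)

lemma IsTensorEmbedding.dense (ht : IsTensorEmbedding t) : DenseRange ht.lin := by
  have h := ht.2.2.2.2.2
  have h2 : Submodule.span ℂ { z | ∃ x y, z = t x y } ≤ LinearMap.range ht.lin := by
    rw [Submodule.span_le]
    rintro _ ⟨x, y, rfl⟩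
    exact ⟨TensorProduct.tmul ℂ x y, by simp [IsTensorEmbedding.lin]⟩
  intro z
  have hz : z ∈ (Submodule.span ℂ { z | ∃ x y, z = t x y }).topologicalClosure := by rw [h]; trivial
  have := Submodule.topologicalClosure_mono h2 hz
  rw [← SetLike.mem_coe, Submodule.topologicalClosure_coe] at this
  have h3 : ((LinearMap.range ht.lin : Submodule ℂ T) : Set T) = Set.range ht.lin := by ext; simp
  rwa [h3] at this

lemma tensor_ext (ht : IsTensorEmbedding t) {A B : T →L[ℂ] T'} 
    (h : ∀ x y, A (t x y) = B (t x y)) : A = B := by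
  apply ContinuousLinearMap.ext_on (s := { z | ∃ x y, z = t x y })
  · have := ht.2.2.2.2.2
    rw [Submodule.dense_iff_topologicalClosure_eq_top]
    exact this
  · rintro _ ⟨x, y, rfl⟩; exact h x y

lemma exists_ten [CompleteSpace T'] (ht : IsTensorEmbedding t) (ht' : IsTensorEmbedding t') 
    (S : H →L[ℂ] H') (R : K →L[ℂ] K') : 
    ∃ W : T →L[ℂ] T', ‖W‖ ≤ ‖S‖ * ‖R‖ ∧ IsElemTensor t t' W S R := by
  let f : TensorProduct ℂ H K →ₗ[ℂ] T' := ht'.lin ∘ₗ TensorProduct.map S.toLinearMap R.toLinearMap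
  have hf : ∀ z, ‖f z‖ ≤ (‖S‖ * ‖R‖) * ‖ht.lin z‖ := by
    intro z
    obtain ⟨n, x, y, rfl⟩ := TensorProduct.exists_sum_tmul_eq z
    have e1 : f (∑ j, TensorProduct.tmul ℂ (x j) (y j)) = ∑ j, t' (S (x j)) (R (y j)) := by
      simp [f, IsTensorEmbedding.lin]
    have e2 : ht.lin (∑ j, TensorProduct.tmul ℂ (x j) (y j)) = ∑ j, t (x j) (y j) := by
      simp [IsTensorEmbedding.lin]
    rw [e1, e2]
    apply le_of_sq_le_sq _ (by positivity)
    rw [mul_pow, ht'.norm_sum, ht.norm_sum]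
    have g1 := gram_ineq x (fun j => R (y j)) S le_rfl
    have g2 := gram_ineq y x R le_rfl
    simp only [mul_comm _ ⟪x _, x _⟫] at g2
    calc _ ≤ _ := g1
      _ ≤ ‖S‖ ^ 2 * (‖R‖ ^ 2 * _) := by gcongr
      _ = _ := by ring
  refine ⟨f.extendOfNorm ht.lin, LinearMap.opNorm_extendOfNorm_le ht.dense (by positivity) hf, ?_⟩
  intro x y
  have := LinearMap.extendOfNorm_eq ht.dense ⟨_, hf⟩ (TensorProduct.tmul ℂ x y)
  simpa [f, IsTensorEmbedding.lin] using this

def ten [CompleteSpace T'] (ht : IsTensorEmbedding t) (ht' : IsTensorEmbedding t') 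
    (S : H →L[ℂ] H') (R : K →L[ℂ] K') : T →L[ℂ] T' := (exists_ten ht ht' S R).choose

lemma ten_norm [CompleteSpace T'] (ht : IsTensorEmbedding t) (ht' : IsTensorEmbedding t') 
    (S : H →L[ℂ] H') (R : K →L[ℂ] K') : ‖ten ht ht' S R‖ ≤ ‖S‖ * ‖R‖ := 
  (exists_ten ht ht' S R).choose_spec.1

@[simp] lemma ten_apply [CompleteSpace T'] (ht : IsTensorEmbedding t) (ht' : IsTensorEmbedding t') 
    (S : H →L[ℂ] H') (R : K →L[ℂ] K') (x : H) (y : K) : ten ht ht' S R (t x y) = t' (S x) (R y) := 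
  (exists_ten ht ht' S R).choose_spec.2 x y

lemma ten_elem [CompleteSpace T'] (ht : IsTensorEmbedding t) (ht' : IsTensorEmbedding t') 
    (S : H →L[ℂ] H') (R : K →L[ℂ] K') : IsElemTensor t t' (ten ht ht' S R) S R := 
  (exists_ten ht ht' S R).choose_spec.2

/-- amplification -/
def amp [CompleteSpace T] (ht : IsTensorEmbedding t) (A : H →L[ℂ] H) : T →L[ℂ] T := ten ht ht A 1

@[simp] lemma amp_apply [CompleteSpace T] (ht : IsTensorEmbedding t) (A : H →L[ℂ] H) (x : H) (y : K) :
   amp ht A (t x y) = t (A x) y := by simp [amp]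

lemma amp_norm [CompleteSpace T] (ht : IsTensorEmbedding t) (A : H →L[ℂ] H) :
   ‖amp ht A‖ ≤ ‖A‖ := by
  refine (ten_norm ht ht A 1).trans ?_
  have : ‖(1 : K →L[ℂ] K)‖ ≤ 1 := ContinuousLinearMap.norm_id_le
  nlinarith [norm_nonneg A]

lemma amp_add [CompleteSpace T] (ht : IsTensorEmbedding t) (A B : H →L[ℂ] H) :
   amp ht (A + B) = amp ht A + amp ht B := tensor_ext ht fun x y => by simp [ht.1]

lemma amp_smul [CompleteSpace T] (ht : IsTensorEmbedding t) (c : ℂ) (A : H →L[ℂ] H) :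
   amp ht (c • A) = c • amp ht A := tensor_ext ht fun x y => by simp [ht.2.2.1]

lemma amp_one [CompleteSpace T] (ht : IsTensorEmbedding t) :
   amp ht (1 : H →L[ℂ] H) = 1 := tensor_ext ht fun x y => by simp

lemma amp_sub [CompleteSpace T] (ht : IsTensorEmbedding t) (A B : H →L[ℂ] H) :
   amp ht (A - B) = amp ht A - amp ht B := by
  have h := amp_add ht (A - B) B
  rw [sub_add_cancel] at h
  rw [h, add_sub_cancel_right]

lemma amp_zero [CompleteSpace T] (ht : IsTensorEmbedding t) : amp ht (0 : H →L[ℂ] H) = 0 := by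
  simpa using amp_sub ht (0 : H →L[ℂ] H) 0

lemma amp_mul [CompleteSpace T] (ht : IsTensorEmbedding t) (A B : H →L[ℂ] H) :
   amp ht (A * B) = amp ht A * amp ht B := tensor_ext ht fun x y => by simp

lemma amp_adjoint [CompleteSpace T] [CompleteSpace H] (ht : IsTensorEmbedding t) (A : H →L[ℂ] H) :
   ContinuousLinearMap.adjoint (amp ht A) = amp ht (ContinuousLinearMap.adjoint A) := by
  symm
  rw [ContinuousLinearMap.eq_adjoint_iff]
  have h1 : ∀ x y, ∀ w : T, ⟪amp ht (ContinuousLinearMap.adjoint A) (t x y), w⟫ = ⟪t x y, amp ht A w⟫ := by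
    intro x y
    have : innerSL ℂ (amp ht (ContinuousLinearMap.adjoint A) (t x y)) = innerSL ℂ (t x y) ∘L amp ht A := by
      apply tensor_ext ht
      intro x' y'
      simp [ht.inner, ContinuousLinearMap.adjoint_inner_left]
    intro w
    simpa using congrArg (fun f => f w) this
  intro z w
  have : innerSL ℂ w ∘L amp ht (ContinuousLinearMap.adjoint A) = innerSL ℂ (amp ht A w) := by
    apply tensor_ext ht
    intro x y
    have := congrArg (starRingEnd ℂ) (h1 x y w)
    simpa using this
  have := congrArg (starRingEnd ℂ) (congrArg (fun f => f z) this)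
  simpa using this

/-- `y ↦ t x y` -/
def tR (ht : IsTensorEmbedding t) (x : H) : K →L[ℂ] T :=
  LinearMap.mkContinuous ⟨⟨t x, ht.2.1 x⟩, fun c y => ht.2.2.2.1 c x y⟩ ‖x‖ 
    (fun y => (ht.norm x y).le)

@[simp] lemma tR_apply (ht : IsTensorEmbedding t) (x : H) (y : K) : tR ht x y = t x y := rfl

lemma tR_add (ht : IsTensorEmbedding t) (x x' : H) : tR ht (x + x') = tR ht x + tR ht x' := by
  ext y; simp [ht.1]
lemma tR_smul (ht : IsTensorEmbedding t) (c : ℂ) (x : H) : tR ht (c • x) = c • tR ht x := by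
  ext y; simp [ht.2.2.1]
lemma tR_norm (ht : IsTensorEmbedding t) (x : H) : ‖tR ht x‖ ≤ ‖x‖ := 
  LinearMap.mkContinuous_norm_le _ (norm_nonneg _) _

end

section
variable {H₁ H₂ K₁ K₂ T₁ T₂ : Type*}
  [NormedAddCommGroup H₁] [InnerProductSpace ℂ H₁] [CompleteSpace H₁]
  [NormedAddCommGroup H₂] [InnerProductSpace ℂ H₂] [CompleteSpace H₂]
  [NormedAddCommGroup K₁] [InnerProductSpace ℂ K₁] [CompleteSpace K₁]
  [NormedAddCommGroup K₂] [InnerProductSpace ℂ K₂] [CompleteSpace K₂]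
  [NormedAddCommGroup T₁] [InnerProductSpace ℂ T₁] [CompleteSpace T₁]
  [NormedAddCommGroup T₂] [InnerProductSpace ℂ T₂] [CompleteSpace T₂]
  {t₁ : H₁ → K₁ → T₁} {t₂ : H₂ → K₂ → T₂}

def slice (ht₁ : IsTensorEmbedding t₁) (ht₂ : IsTensorEmbedding t₂) (h : H₁) (h' : H₂) 
    (T : T₁ →L[ℂ] T₂) : K₁ →L[ℂ] K₂ :=
  ContinuousLinearMap.adjoint (tR ht₂ h') ∘L T ∘L tR ht₁ h

lemma slice_inner (ht₁ : IsTensorEmbedding t₁) (ht₂ : IsTensorEmbedding t₂) (h : H₁) (h' : H₂) 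
    (T : T₁ →L[ℂ] T₂) (x : K₁) (y : K₂) : 
    ⟪y, slice ht₁ ht₂ h h' T x⟫ = ⟪t₂ h' y, T (t₁ h x)⟫ := by
  simp [slice, ContinuousLinearMap.adjoint_inner_right]

/-- wTensor as a submodule -/
def wTS (t₁ : H₁ → K₁ → T₁) (t₂ : H₂ → K₂ → T₂)
    (V : Set (H₁ →L[ℂ] H₂)) (U : Set (K₁ →L[ℂ] K₂)) : Submodule ℂ (T₁ →L[ℂ] T₂) :=
  wkSub (Submodule.span ℂ
    { W : T₁ →L[ℂ] T₂ | ∃ S ∈ V, ∃ R ∈ U, IsElemTensor t₁ t₂ W S R })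

lemma mem_wTS {V : Set (H₁ →L[ℂ] H₂)} {U : Set (K₁ →L[ℂ] K₂)} {X : T₁ →L[ℂ] T₂} :
  X ∈ wTS t₁ t₂ V U ↔ X ∈ wTensor t₁ t₂ V U := Iff.rfl

lemma wTensor_closed (V : Set (H₁ →L[ℂ] H₂)) (U : Set (K₁ →L[ℂ] K₂)) : 
    WkClosed (wTensor t₁ t₂ V U) := wkClosed_wkClosure _

lemma wTensor_mono {V V' : Set (H₁ →L[ℂ] H₂)} {U U' : Set (K₁ →L[ℂ] K₂)} (h : V ⊆ V') (h' : U ⊆ U') : 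
    wTensor t₁ t₂ V U ⊆ wTensor t₁ t₂ V' U' := by
  apply wkClosure_mono
  apply Submodule.span_mono
  rintro W ⟨S, hS, R, hR, hW⟩
  exact ⟨S, h hS, R, h' hR, hW⟩

lemma ten_mem (ht₁ : IsTensorEmbedding t₁) (ht₂ : IsTensorEmbedding t₂) 
    {V : Set (H₁ →L[ℂ] H₂)} {U : Set (K₁ →L[ℂ] K₂)} {S : H₁ →L[ℂ] H₂} {R : K₁ →L[ℂ] K₂} 
    (hS : S ∈ V) (hR : R ∈ U) : ten ht₁ ht₂ S R ∈ wTensor t₁ t₂ V U :=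
  subset_wkClosure _ (Submodule.subset_span ⟨S, hS, R, hR, ten_elem ht₁ ht₂ S R⟩)

/-- to show a wk-continuous linear map sends the tensor product into a closed submodule -/
lemma wTensor_induct {E F : Type*} [NormedAddCommGroup E] [InnerProductSpace ℂ E]
    [NormedAddCommGroup F] [InnerProductSpace ℂ F]
    {V : Set (H₁ →L[ℂ] H₂)} {U : Set (K₁ →L[ℂ] K₂)}
    (φ : (T₁ →L[ℂ] T₂) →ₗ[ℂ] (E →L[ℂ] F)) (hφ : WkContinuous φ) (M : Submodule ℂ (E →L[ℂ] F)) 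
    (hM : WkClosed (M : Set (E →L[ℂ] F)))
    (h : ∀ S ∈ V, ∀ R ∈ U, ∀ W, IsElemTensor t₁ t₂ W S R → φ W ∈ M) :
    ∀ X ∈ wTensor t₁ t₂ V U, φ X ∈ M := by
  apply wkClosure_map hφ hM
  intro X hX
  have : Submodule.span ℂ
    { W : T₁ →L[ℂ] T₂ | ∃ S ∈ V, ∃ R ∈ U, IsElemTensor t₁ t₂ W S R } ≤ M.comap φ := by
    rw [Submodule.span_le]
    rintro W ⟨S, hS, R, hR, hW⟩
    exact h S hS R hR W hW
  exact this hX

def sandwich {H₁ H₂ H₁' H₂' : Type*} [NormedAddCommGroup H₁] [InnerProductSpace ℂ H₁]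
    [NormedAddCommGroup H₂] [InnerProductSpace ℂ H₂] [NormedAddCommGroup H₁'] [InnerProductSpace ℂ H₁']
    [NormedAddCommGroup H₂'] [InnerProductSpace ℂ H₂'] (A : H₁' →L[ℂ] H₁) (B : H₂ →L[ℂ] H₂') : 
    (H₁ →L[ℂ] H₂) →ₗ[ℂ] (H₁' →L[ℂ] H₂') where
  toFun X := B ∘L X ∘L A
  map_add' := by intros; ext; simp
  map_smul' := by intros; ext; simp

lemma slice_mem (ht₁ : IsTensorEmbedding t₁) (ht₂ : IsTensorEmbedding t₂) (h : H₁) (h' : H₂) 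
    {V : Set (H₁ →L[ℂ] H₂)} {U : Set (K₁ →L[ℂ] K₂)} (hU : IsWkClosedSubspace U) 
    {X : T₁ →L[ℂ] T₂} (hX : X ∈ wTensor t₁ t₂ V U) : slice ht₁ ht₂ h h' X ∈ U := by
  obtain ⟨⟨M, rfl⟩, hM⟩ := hU
  refine wTensor_induct (sandwich (tR ht₁ h) (ContinuousLinearMap.adjoint (tR ht₂ h'))) 
    (wkc_comp _ _) M hM ?_ X hX
  intro S hS R hR W hW
  have : sandwich (tR ht₁ h) (ContinuousLinearMap.adjoint (tR ht₂ h')) W = ⟪h', S h⟫ • R := by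
    ext x
    apply ext_inner_left ℂ
    intro y
    have e := hW h x
    simp [sandwich, ContinuousLinearMap.adjoint_inner_right, e, ht₂.inner, inner_smul_right]
  rw [this]
  exact M.smul_mem _ hR

lemma wTensor_sandwich (ht₁ : IsTensorEmbedding t₁) (ht₂ : IsTensorEmbedding t₂) 
    {V V' : Set (H₁ →L[ℂ] H₂)} {U : Set (K₁ →L[ℂ] K₂)} {A : H₁ →L[ℂ] H₁} {B : H₂ →L[ℂ] H₂}
    (h : ∀ S ∈ V, B ∘L S ∘L A ∈ V')
    {X : T₁ →L[ℂ] T₂} (hX : X ∈ wTensor t₁ t₂ V U) : 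
    amp ht₂ B ∘L X ∘L amp ht₁ A ∈ wTensor t₁ t₂ V' U := by
  refine wTensor_induct (sandwich (amp ht₁ A) (amp ht₂ B)) 
    (wkc_comp _ _) (wTS t₁ t₂ V' U) (wTensor_closed _ _) ?_ X hX
  intro S hS R hR W hW
  apply subset_wkClosure
  apply Submodule.subset_span
  refine ⟨_, h S hS, R, hR, ?_⟩
  intro x y
  have e := hW (A x) y
  simp [sandwich, e]

end
end Ten
end OpSynth

namespace OpSynth
set_option linter.all false
section Cyc
open Filter Topology ContinuousLinearMap

variable {H : Type*} [NormedAddCommGroup H] [InnerProductSpace ℂ H] [CompleteSpace H]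

lemma IsProj.inner_eq {p : H →L[ℂ] H} (hp : IsProj p) (x y : H) : ⟪p x, y⟫ = ⟪x, p y⟫ := by
  have := hp.2.adjoint_eq
  conv_rhs => rw [← this]
  rw [adjoint_inner_right]

lemma IsProj.idem {p : H →L[ℂ] H} (hp : IsProj p) (x : H) : p (p x) = p x := by
  have := congrArg (fun f => f x) hp.1
  simpa using this

lemma IsProj.norm_le {p : H →L[ℂ] H} (hp : IsProj p) : ‖p‖ ≤ 1 := by
  refine p.opNorm_le_bound zero_le_one fun x => ?_
  have h : ‖p x‖ ^ 2 = ‖⟪x, p x⟫‖ := by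
    have := inner_self_eq_norm_sq_to_K (𝕜 := ℂ) (p x)
    rw [hp.inner_eq, hp.idem] at this
    rw [this]; simp
  have h2 := norm_inner_le_norm (𝕜 := ℂ) x (p x)
  rw [← h] at h2
  rcases eq_or_ne (p x) 0 with h0 | h0
  · rw [h0]; simp
  · have := norm_pos_iff.2 h0
    nlinarith

lemma starProj_isProj (L : Submodule ℂ H) [L.HasOrthogonalProjection] : IsProj L.starProjection :=
  ⟨L.isIdempotentElem_starProjection, isSelfAdjoint_starProjection L⟩

lemma starProj_commute (L : Submodule ℂ H) [L.HasOrthogonalProjection] {a : H →L[ℂ] H} 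
    (h : ∀ x ∈ L, a x ∈ L) (h' : ∀ x ∈ L, adjoint a x ∈ L) : 
    L.starProjection * a = a * L.starProjection := by
  ext v
  simp only [mul_apply_eq_comp]
  refine Submodule.eq_starProjection_of_mem_orthogonal (h _ (L.starProjection_apply_mem v)) ?_
  rw [← map_sub, Submodule.mem_orthogonal]
  intro u hu
  rw [← adjoint_inner_left]
  exact (Submodule.mem_orthogonal _ _).1 (L.sub_starProjection_mem_orthogonal v) _ (h' u hu)

/-- cyclic subspace -/
def cyc (𝒜 : Subalgebra ℂ (H →L[ℂ] H)) (ξ : H) : Submodule ℂ H :=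
  (𝒜.toSubmodule.map (ContinuousLinearMap.apply ℂ H ξ).toLinearMap).topologicalClosure

instance (𝒜 : Subalgebra ℂ (H →L[ℂ] H)) (ξ : H) : CompleteSpace (cyc 𝒜 ξ) :=
  (Submodule.isClosed_topologicalClosure _).completeSpace_coe

lemma mem_cyc {𝒜 : Subalgebra ℂ (H →L[ℂ] H)} {a : H →L[ℂ] H} (ha : a ∈ 𝒜) (ξ : H) : a ξ ∈ cyc 𝒜 ξ :=
  Submodule.le_topologicalClosure _ ⟨a, ha, rfl⟩

lemma self_mem_cyc (𝒜 : Subalgebra ℂ (H →L[ℂ] H)) (ξ : H) : ξ ∈ cyc 𝒜 ξ := by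
  simpa using mem_cyc 𝒜.one_mem ξ

lemma cyc_le {𝒜 : Subalgebra ℂ (H →L[ℂ] H)} {ξ : H} {L : Submodule ℂ H} (hL : IsClosed (L : Set H))
    (h : ∀ a ∈ 𝒜, a ξ ∈ L) : cyc 𝒜 ξ ≤ L := by
  apply Submodule.topologicalClosure_minimal _ _ hL
  rintro _ ⟨a, ha, rfl⟩
  exact h a ha

lemma cyc_inv {𝒜 : Subalgebra ℂ (H →L[ℂ] H)} {ξ : H} {a : H →L[ℂ] H} (ha : a ∈ 𝒜) {x : H} 
    (hx : x ∈ cyc 𝒜 ξ) : a x ∈ cyc 𝒜 ξ := by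
  have : cyc 𝒜 ξ ≤ (cyc 𝒜 ξ).comap a.toLinearMap := by
    apply cyc_le
    · exact (Submodule.isClosed_topologicalClosure _).preimage a.continuous
    · intro b hb
      exact mem_cyc (𝒜.mul_mem ha hb) ξ
  exact this hx

def cycP (𝒜 : Subalgebra ℂ (H →L[ℂ] H)) (ξ : H) : H →L[ℂ] H := (cyc 𝒜 ξ).starProjection

lemma cycP_comm {𝒜 : Subalgebra ℂ (H →L[ℂ] H)} (hs : ∀ a ∈ 𝒜, adjoint a ∈ 𝒜) (ξ : H) {a : H →L[ℂ] H}
    (ha : a ∈ 𝒜) : cycP 𝒜 ξ * a = a * cycP 𝒜 ξ :=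
  starProj_commute _ (fun x hx => cyc_inv ha hx) (fun x hx => cyc_inv (hs a ha) hx)

def exhP (𝒜 : Subalgebra ℂ (H →L[ℂ] H)) (x : ℕ → H) : ℕ → H →L[ℂ] H
  | 0 => 0
  | n + 1 => exhP 𝒜 x n + cycP 𝒜 (x n - exhP 𝒜 x n (x n))

lemma cyc_exhaust [TopologicalSpace.SeparableSpace H] (𝒜 : Subalgebra ℂ (H →L[ℂ] H)) 
    (hs : ∀ a ∈ 𝒜, adjoint a ∈ 𝒜) :
    ∃ P : ℕ → H →L[ℂ] H, (∀ n, P n ∈ Submodule.span ℂ (range (cycP 𝒜))) ∧ (∀ n, ‖P n‖ ≤ 1) ∧ 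
      ∀ v, Tendsto (fun n => P n v) atTop (𝓝 v) := by
  have : Nonempty H := ⟨0⟩
  set x := TopologicalSpace.denseSeq H
  have hx : DenseRange x := TopologicalSpace.denseRange_denseSeq H
  set P := exhP 𝒜 x
  have hP1 : ∀ n, P (n + 1) = P n + cycP 𝒜 (x n - P n (x n)) := fun n => rfl
  have key : ∀ n, IsProj (P n) → (∀ a ∈ 𝒜, P n * a = a * P n) → ∀ v, P n (cycP 𝒜 (x n - P n (x n)) v) = 0 := by
    intro n ih1 ih2 v
    set ξ := x n - P n (x n) with hξ
    have : cyc 𝒜 ξ ≤ LinearMap.ker (P n).toLinearMap := by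
      apply cyc_le
      · exact (P n).isClosed_ker
      · intro a ha
        have e := congrArg (fun f => f ξ) (ih2 a ha)
        simp only [mul_apply_eq_comp] at e
        rw [LinearMap.mem_ker]
        change P n (a ξ) = 0
        rw [e, hξ, map_sub, ih1.idem, sub_self, map_zero]
    exact this (Submodule.starProjection_apply_mem _ v)
  have key' : ∀ n, IsProj (P n) → (∀ a ∈ 𝒜, P n * a = a * P n) → ∀ v, cycP 𝒜 (x n - P n (x n)) (P n v) = 0 := by
    intro n ih1 ih2 v
    apply ext_inner_left ℂ
    intro w
    have e := (starProj_isProj (cyc 𝒜 (x n - P n (x n)))).inner_eq w (P n v)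
    change ⟪w, (cyc 𝒜 (x n - P n (x n))).starProjection (P n v)⟫ = _
    rw [← e, ← ih1.inner_eq]
    have := key n ih1 ih2 w
    simp only [cycP] at this
    rw [this]; simp
  have h1 : ∀ n, IsProj (P n) ∧ ∀ a ∈ 𝒜, P n * a = a * P n := by
    intro n
    induction n with
    | zero => exact ⟨⟨by simp [P, exhP], by simp [P, exhP]⟩, by simp [P, exhP]⟩
    | succ n ih =>
      obtain ⟨ih1, ih2⟩ := ih
      set ξ := x n - P n (x n)
      have k1 := key n ih1 ih2
      have k2 := key' n ih1 ih2
      have hp := starProj_isProj (cyc 𝒜 ξ)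
      refine ⟨⟨?_, ?_⟩, ?_⟩
      · ext v
        have e1 := ih1.idem v
        have e2 := hp.idem v
        rw [hP1]
        simp only [comp_apply, add_apply, map_add]
        rw [k1, k2, e1]
        simp only [cycP] at e2 ⊢
        rw [e2]; simp
        rfl
      · rw [hP1]
        exact ih1.2.add hp.2
      · intro a ha
        rw [hP1, add_mul, mul_add, ih2 a ha, cycP_comm hs _ ha]
  have h2 : ∀ n, P (n + 1) (x n) = x n := by
    intro n
    have k2 := key' n (h1 n).1 (h1 n).2 (x n)
    rw [hP1, add_apply]
    have : cycP 𝒜 (x n - P n (x n)) (x n - P n (x n)) = x n - P n (x n) := 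
      Submodule.starProjection_eq_self_iff.2 (self_mem_cyc _ _)
    rw [map_sub, k2, sub_zero] at this
    rw [this]; simp
  have h3 : ∀ n k v, P n v = v → P (n + k) v = v := by
    intro n k v hv
    induction k with
    | zero => exact hv
    | succ k ih =>
      rw [← add_assoc, hP1, add_apply, ih]
      have k2 := key' (n+k) (h1 _).1 (h1 _).2 v
      rw [ih] at k2
      rw [k2, add_zero]
  refine ⟨P, ?_, fun n => (h1 n).1.norm_le, ?_⟩
  · intro n
    induction n with
    | zero => exact Submodule.zero_mem _
    | succ n ih => exact Submodule.add_mem _ ih (Submodule.subset_span ⟨_, rfl⟩)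
  · intro v
    rw [Metric.tendsto_atTop]
    intro ε hε
    obtain ⟨n, hn⟩ := hx.exists_dist_lt v (half_pos hε)
    refine ⟨n + 1, fun m hm => ?_⟩
    obtain ⟨k, rfl⟩ := Nat.exists_eq_add_of_le hm
    have e := h3 (n+1) k (x n) (h2 n)
    have hb := (P (n+1+k)).le_of_opNorm_le (h1 (n+1+k)).1.norm_le (v - x n)
    rw [dist_eq_norm] at hn ⊢
    have : P (n+1+k) v - v = P (n+1+k) (v - x n) - (v - x n) := by
      rw [map_sub, e]; abel
    rw [this]
    calc _ ≤ _ := norm_sub_le _ _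
      _ < ε := by linarith
end Cyc
end OpSynth

namespace OpSynth
set_option linter.all false
section Part
open Filter Topology ContinuousLinearMap

/-- orthogonal sums -/
lemma norm_sq_sum_orth {E ι : Type*} [Fintype ι] [NormedAddCommGroup E] [InnerProductSpace ℂ E]
    (v : ι → E) (h : ∀ i j, i ≠ j → ⟪v i, v j⟫ = 0) : ‖∑ i, v i‖ ^ 2 = ∑ i, ‖v i‖ ^ 2 := by
  classical
  have : (‖∑ i, v i‖ ^ 2 : ℂ) = ((∑ i, ‖v i‖ ^ 2 : ℝ) : ℂ) := by
    have e := inner_self_eq_norm_sq_to_K (𝕜 := ℂ) (∑ i, v i)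
    rw [sum_inner] at e
    simp only [inner_sum] at e
    have e2 : ∀ i, ∑ j, ⟪v i, v j⟫ = (‖v i‖ ^ 2 : ℂ) := by
      intro i
      rw [Finset.sum_eq_single i (fun j _ hj => h i j hj.symm) (by simp)]
      exact inner_self_eq_norm_sq_to_K (𝕜 := ℂ) (v i)
    simp only [e2] at e
    rw [Complex.ofReal_sum]
    push_cast
    exact e.symm
  exact_mod_cast this

/-- block diagonal operators -/
lemma block_norm {E F ι : Type*} [Fintype ι] [NormedAddCommGroup E] [InnerProductSpace ℂ E] [CompleteSpace E]
    [NormedAddCommGroup F] [InnerProductSpace ℂ F] [CompleteSpace F] {C : ℝ} (hC : 0 ≤ C)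
    (p : ι → E →L[ℂ] E) (q : ι → F →L[ℂ] F) (W : ι → E →L[ℂ] F) 
    (hp : ∀ i, IsProj (p i)) (hq : ∀ i, IsProj (q i)) 
    (hp' : ∀ i j, i ≠ j → p i * p j = 0) (hq' : ∀ i j, i ≠ j → q i * q j = 0) 
    (hp1 : ∑ i, p i = 1) (hW : ∀ i, ‖W i‖ ≤ C) : ‖∑ i, q i ∘L W i ∘L p i‖ ≤ C := by
  refine ContinuousLinearMap.opNorm_le_bound _ hC fun z => ?_
  apply le_of_sq_le_sq _ (by positivity)
  have e1 : (∑ i, q i ∘L W i ∘L p i) z = ∑ i, q i (W i (p i z)) := by simp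
  have e2 : z = ∑ i, p i z := by
    have := congrArg (fun f => f z) hp1
    simpa using this.symm
  rw [e1, norm_sq_sum_orth, mul_pow]
  · conv_rhs => rw [e2]
    rw [norm_sq_sum_orth, Finset.mul_sum]
    · apply Finset.sum_le_sum
      intro i _
      rw [← mul_pow]
      gcongr
      have h1 := (q i).le_of_opNorm_le (hq i).norm_le (W i (p i z))
      have h2 := (W i).le_of_opNorm_le (hW i) (p i z)
      linarith
    · intro i j hij
      rw [(hp i).inner_eq]
      have := congrArg (fun f => f z) (hp' i j hij)
      simp only [mul_apply_eq_comp, zero_apply] at this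
      rw [this, inner_zero_right]
  · intro i j hij
    rw [(hq i).inner_eq]
    have := congrArg (fun f => f (W j (p j z))) (hq' i j hij)
    simp only [mul_apply_eq_comp, zero_apply] at this
    rw [this, inner_zero_right]

variable {R : Type*} [Ring R] [Algebra ℂ R] [StarRing R] [StarModule ℂ R]

/-- A finite partition of unity by projections diagonalizing the elements of `F`. -/
structure Ptn (𝒩 : Subalgebra ℂ R) (F : Set R) where
  ι : Type
  fin : Fintype ι
  r : ι → R
  mem : ∀ i, r i ∈ 𝒩
  idem : ∀ i, r i * r i = r i
  sa : ∀ i, star (r i) = r i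
  orth : ∀ i j, i ≠ j → r i * r j = 0
  sum : ∑ i, r i = 1
  diag : ∀ c ∈ F, ∀ i, ∃ a : ℂ, c * r i = a • r i

attribute [instance] Ptn.fin

lemma adjoin_comm {C : Set R} (hc : ∀ c ∈ C, ∀ c' ∈ C, c * c' = c' * c) :
    ∀ a ∈ Algebra.adjoin ℂ C, ∀ b ∈ Algebra.adjoin ℂ C, a * b = b * a := by
  have h1 : Algebra.adjoin ℂ C ≤ Subalgebra.centralizer ℂ C := by
    apply Algebra.adjoin_le
    intro c hcC
    rw [SetLike.mem_coe, Subalgebra.mem_centralizer_iff]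
    intro g hg; exact hc g hg c hcC
  have h2 : Algebra.adjoin ℂ C ≤ Subalgebra.centralizer ℂ (Algebra.adjoin ℂ C : Set R) := by
    apply Algebra.adjoin_le
    intro c hcC
    rw [SetLike.mem_coe, Subalgebra.mem_centralizer_iff]
    intro g hg
    exact ((Subalgebra.mem_centralizer_iff ℂ).1 (h1 hg) c hcC).symm
  intro a ha b hb
  exact ((Subalgebra.mem_centralizer_iff ℂ).1 (h2 hb) a ha)

lemma adjoin_star {C : Set R} (hc : ∀ c ∈ C, star c = c) : 
    ∀ a ∈ Algebra.adjoin ℂ C, star a ∈ Algebra.adjoin ℂ C := by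
  intro a ha
  induction ha using Algebra.adjoin_induction with
  | mem x hx => rw [hc x hx]; exact Algebra.subset_adjoin hx
  | algebraMap r => rw [Algebra.algebraMap_eq_smul_one, star_smul, star_one]; exact Subalgebra.smul_mem _ (Subalgebra.one_mem _) _
  | add x y _ _ h1 h2 => rw [star_add]; exact Subalgebra.add_mem _ h1 h2
  | mul x y _ _ h1 h2 => rw [star_mul]; exact Subalgebra.mul_mem _ h2 h1

lemma exists_ptn {C : Set R} (hc : ∀ c ∈ C, ∀ c' ∈ C, c * c' = c' * c) (hs : ∀ c ∈ C, star c = c) 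
    (hi : ∀ c ∈ C, c * c = c) (F : Finset R) (hF : (F : Set R) ⊆ C) : 
    Nonempty (Ptn (Algebra.adjoin ℂ C) (F : Set R)) := by
  classical
  induction F using Finset.induction_on with
  | empty => exact ⟨⟨Unit, inferInstance, fun _ => 1, fun _ => Subalgebra.one_mem _, by simp, by simp, 
      fun i j h => absurd rfl h, by simp, by simp⟩⟩
  | insert c F hcF ih =>
    obtain ⟨P⟩ := ih (fun x hx => hF (by simp [Finset.mem_coe.1 hx]))
    have hcC : c ∈ C := hF (by simp)
    have hcm : c ∈ Algebra.adjoin ℂ C := Algebra.subset_adjoin hcC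
    have hcom : ∀ i, c * P.r i = P.r i * c := fun i => adjoin_comm hc c hcm _ (P.mem i)
    let e : Bool → R := fun b => if b then c else 1 - c
    have he : ∀ b, e b ∈ Algebra.adjoin ℂ C := by
      intro b; cases b <;> simp [e, hcm, Subalgebra.sub_mem, Subalgebra.one_mem]
    have hec : ∀ b i, e b * P.r i = P.r i * e b := fun b i => adjoin_comm hc _ (he b) _ (P.mem i)
    have hee : ∀ b, e b * e b = e b := by
      intro b; cases b <;> simp [e, hi c hcC, mul_sub, sub_mul]
    have hes : ∀ b, star (e b) = e b := by
      intro b; cases b <;> simp [e, hs c hcC]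
    have hmul : ∀ b i b' i', (e b * P.r i) * (e b' * P.r i') = (e b * e b') * (P.r i * P.r i') := by
      intro b i b' i'
      rw [mul_assoc, ← mul_assoc (P.r i), ← hec b' i, mul_assoc, mul_assoc]
    refine ⟨⟨Bool × P.ι, inferInstance, fun x => e x.1 * P.r x.2, fun x => Subalgebra.mul_mem _ (he _) (P.mem _), ?_, ?_, ?_, ?_, ?_⟩⟩
    · intro x; rw [hmul, hee, P.idem]
    · intro x; rw [star_mul, hes, P.sa, hec]
    · rintro ⟨b, i⟩ ⟨b', i'⟩ h
      rw [hmul]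
      by_cases hii : i = i'
      · have : b ≠ b' := by rintro rfl; exact h (by rw [hii])
        have : e b * e b' = 0 := by
          cases b <;> cases b' <;> simp_all [e, hi c hcC, mul_sub, sub_mul]
        simp [this]
      · simp only [P.orth i i' hii, mul_zero]
    · rw [Fintype.sum_prod_type]
      simp only [← Finset.mul_sum, P.sum]
      simp [e]
    · intro c' hc' x
      rcases Finset.mem_insert.1 (Finset.mem_coe.1 hc') with rfl | h
      · rcases x with ⟨b, i⟩
        cases b
        · exact ⟨0, by simp [e, ← mul_assoc, mul_sub, hi c' hcC]⟩
        · exact ⟨1, by simp [e, ← mul_assoc, hi c' hcC]⟩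
      · obtain ⟨a, ha⟩ := P.diag c' h x.2
        refine ⟨a, ?_⟩
        have hcm' : c' ∈ Algebra.adjoin ℂ C := Algebra.subset_adjoin (hF hc')
        rw [← mul_assoc, adjoin_comm hc c' hcm' _ (he x.1), mul_assoc, ha, mul_smul_comm]

lemma adjoin_diag {C : Set R} {n : R} (hn : n ∈ Algebra.adjoin ℂ C) : 
    ∃ F₀ : Finset R, (F₀ : Set R) ⊆ C ∧ 
      ∀ r : R, (∀ c ∈ F₀, ∃ a : ℂ, c * r = a • r) → ∃ a : ℂ, n * r = a • r := by
  classical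
  induction hn using Algebra.adjoin_induction with
  | mem x hx => exact ⟨{x}, by simpa using hx, fun r h => h x (by simp)⟩
  | algebraMap a => exact ⟨∅, by simp, fun r _ => ⟨a, by rw [Algebra.smul_def]⟩⟩
  | add x y _ _ h1 h2 =>
    obtain ⟨F1, h1, h1'⟩ := h1
    obtain ⟨F2, h2, h2'⟩ := h2
    refine ⟨F1 ∪ F2, by simp [h1, h2], fun r h => ?_⟩
    obtain ⟨a, ha⟩ := h1' r (fun c hc => h c (by simp [hc]))
    obtain ⟨b, hb⟩ := h2' r (fun c hc => h c (by simp [hc]))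
    exact ⟨a + b, by rw [add_mul, ha, hb, add_smul]⟩
  | mul x y _ _ h1 h2 =>
    obtain ⟨F1, h1, h1'⟩ := h1
    obtain ⟨F2, h2, h2'⟩ := h2
    refine ⟨F1 ∪ F2, by simp [h1, h2], fun r h => ?_⟩
    obtain ⟨a, ha⟩ := h1' r (fun c hc => h c (by simp [hc]))
    obtain ⟨b, hb⟩ := h2' r (fun c hc => h c (by simp [hc]))
    exact ⟨b * a, by rw [mul_assoc, hb, mul_smul_comm, ha, smul_smul]⟩

end Part
end OpSynth

namespace OpSynth
set_option linter.all false
section DSum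
open Filter Topology ContinuousLinearMap
variable {H₁ H₂ : Type*}
  [NormedAddCommGroup H₁] [InnerProductSpace ℂ H₁] [CompleteSpace H₁]
  [NormedAddCommGroup H₂] [InnerProductSpace ℂ H₂] [CompleteSpace H₂]

abbrev DS (H₁ H₂ : Type*) := WithLp 2 (H₁ × H₂)

def dsi₁ : H₁ →L[ℂ] DS H₁ H₂ := 
  (WithLp.prodContinuousLinearEquiv 2 ℂ H₁ H₂).symm.toContinuousLinearMap ∘L ContinuousLinearMap.inl ℂ H₁ H₂
def dsi₂ : H₂ →L[ℂ] DS H₁ H₂ := 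
  (WithLp.prodContinuousLinearEquiv 2 ℂ H₁ H₂).symm.toContinuousLinearMap ∘L ContinuousLinearMap.inr ℂ H₁ H₂
def dsp₁ : DS H₁ H₂ →L[ℂ] H₁ := 
  ContinuousLinearMap.fst ℂ H₁ H₂ ∘L (WithLp.prodContinuousLinearEquiv 2 ℂ H₁ H₂).toContinuousLinearMap
def dsp₂ : DS H₁ H₂ →L[ℂ] H₂ := 
  ContinuousLinearMap.snd ℂ H₁ H₂ ∘L (WithLp.prodContinuousLinearEquiv 2 ℂ H₁ H₂).toContinuousLinearMap

@[simp] lemma dsp₁_i₁ (v : H₁) : dsp₁ (dsi₁ v : DS H₁ H₂) = v := rfl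
@[simp] lemma dsp₂_i₁ (v : H₁) : dsp₂ (dsi₁ v : DS H₁ H₂) = 0 := rfl
@[simp] lemma dsp₁_i₂ (v : H₂) : dsp₁ (dsi₂ v : DS H₁ H₂) = 0 := rfl
@[simp] lemma dsp₂_i₂ (v : H₂) : dsp₂ (dsi₂ v : DS H₁ H₂) = v := rfl
lemma ds_eq (z : DS H₁ H₂) : z = dsi₁ (dsp₁ z) + dsi₂ (dsp₂ z) := by
  apply (WithLp.prodContinuousLinearEquiv 2 ℂ H₁ H₂).injective
  ext <;> simp [dsi₁, dsi₂, dsp₁, dsp₂]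
lemma ds_inner (z w : DS H₁ H₂) : ⟪z, w⟫ = ⟪dsp₁ z, dsp₁ w⟫ + ⟪dsp₂ z, dsp₂ w⟫ := 
  WithLp.prod_inner_apply z w
lemma ds_ext {z w : DS H₁ H₂} (h1 : dsp₁ z = dsp₁ w) (h2 : dsp₂ z = dsp₂ w) : z = w := by
  rw [ds_eq z, ds_eq w, h1, h2]
lemma ds_inner_i₂ (w : H₂) (z : DS H₁ H₂) : ⟪dsi₂ w, z⟫ = ⟪w, dsp₂ z⟫ := by rw [ds_inner]; simp
lemma ds_inner_i₁ (w : H₁) (z : DS H₁ H₂) : ⟪dsi₁ w, z⟫ = ⟪w, dsp₁ z⟫ := by rw [ds_inner]; simp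
lemma ds_norm₁ (z : DS H₁ H₂) : ‖dsp₁ z‖ ≤ ‖z‖ := WithLp.norm_fst_le _ z
lemma ds_norm₂ (z : DS H₁ H₂) : ‖dsp₂ z‖ ≤ ‖z‖ := WithLp.norm_snd_le _ z
lemma ds_normi₁ (z : H₁) : ‖(dsi₁ z : DS H₁ H₂)‖ = ‖z‖ := by
  have := ds_inner (dsi₁ z : DS H₁ H₂) (dsi₁ z)
  simp [inner_self_eq_norm_sq_to_K] at this
  have h : ‖(dsi₁ z : DS H₁ H₂)‖ ^ 2 = ‖z‖ ^ 2 := by exact_mod_cast this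
  exact (pow_left_inj₀ (norm_nonneg _) (by positivity) two_ne_zero).1 h
lemma ds_normi₂ (z : H₂) : ‖(dsi₂ z : DS H₁ H₂)‖ = ‖z‖ := by
  have := ds_inner (dsi₂ z : DS H₁ H₂) (dsi₂ z)
  simp [inner_self_eq_norm_sq_to_K] at this
  have h : ‖(dsi₂ z : DS H₁ H₂)‖ ^ 2 = ‖z‖ ^ 2 := by exact_mod_cast this
  exact (pow_left_inj₀ (norm_nonneg _) (by positivity) two_ne_zero).1 h

/-- diagonal operators -/
def dg : ((H₁ →L[ℂ] H₁) × (H₂ →L[ℂ] H₂)) →ₐ[ℂ] (DS H₁ H₂ →L[ℂ] DS H₁ H₂) where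
  toFun r := dsi₁ ∘L r.1 ∘L dsp₁ + dsi₂ ∘L r.2 ∘L dsp₂
  map_one' := by ext1 z; apply ds_ext <;> simp
  map_mul' a b := by ext1 z; apply ds_ext <;> simp
  map_zero' := by ext1 z; apply ds_ext <;> simp
  map_add' a b := by ext1 z; apply ds_ext <;> simp
  commutes' a := by ext1 z; apply ds_ext <;> simp [Algebra.algebraMap_eq_smul_one]

@[simp] lemma dsp₁_dg (r : (H₁ →L[ℂ] H₁) × (H₂ →L[ℂ] H₂)) (z : DS H₁ H₂) : dsp₁ (dg r z) = r.1 (dsp₁ z) := by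
  change dsp₁ (dsi₁ (r.1 (dsp₁ z)) + dsi₂ (r.2 (dsp₂ z))) = _
  simp
@[simp] lemma dsp₂_dg (r : (H₁ →L[ℂ] H₁) × (H₂ →L[ℂ] H₂)) (z : DS H₁ H₂) : dsp₂ (dg r z) = r.2 (dsp₂ z) := by
  change dsp₂ (dsi₁ (r.1 (dsp₁ z)) + dsi₂ (r.2 (dsp₂ z))) = _
  simp

lemma dg_adjoint (r : (H₁ →L[ℂ] H₁) × (H₂ →L[ℂ] H₂)) : adjoint (dg r) = dg (star r) := by
  symm
  rw [ContinuousLinearMap.eq_adjoint_iff]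
  intro x y
  rw [ds_inner, ds_inner]; simp [star_eq_adjoint, adjoint_inner_left]

end DSum
end OpSynth

namespace OpSynth
set_option linter.all false
section KeyD
open Filter Topology ContinuousLinearMap
variable {H₁ H₂ K₁ K₂ T₁ T₂ : Type*}
  [NormedAddCommGroup H₁] [InnerProductSpace ℂ H₁] [CompleteSpace H₁]
  [NormedAddCommGroup H₂] [InnerProductSpace ℂ H₂] [CompleteSpace H₂]
  [NormedAddCommGroup K₁] [InnerProductSpace ℂ K₁] [CompleteSpace K₁]
  [NormedAddCommGroup K₂] [InnerProductSpace ℂ K₂] [CompleteSpace K₂]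
  [NormedAddCommGroup T₁] [InnerProductSpace ℂ T₁] [CompleteSpace T₁]
  [NormedAddCommGroup T₂] [InnerProductSpace ℂ T₂] [CompleteSpace T₂]
  {t₁ : H₁ → K₁ → T₁} {t₂ : H₂ → K₂ → T₂}

def tL {t₁ : H₁ → K₁ → T₁} (ht : IsTensorEmbedding t₁) (y : K₁) : H₁ →L[ℂ] T₁ :=
  LinearMap.mkContinuous ⟨⟨fun x => t₁ x y, fun x x' => ht.1 x x' y⟩, fun c x => ht.2.2.1 c x y⟩ ‖y‖ 
    (fun x => by rw [mul_comm]; exact (ht.norm x y).le)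

@[simp] lemma tL_apply (ht : IsTensorEmbedding t₁) (x : H₁) (y : K₁) : tL ht y x = t₁ x y := rfl

/-- commutant-like intertwiners -/
abbrev Dint (C : Set ((H₁ →L[ℂ] H₁) × (H₂ →L[ℂ] H₂))) : Set (H₁ →L[ℂ] H₂) := 
  {X | ∀ c ∈ C, c.2 ∘L X = X ∘L c.1}

lemma intertwine_adjoin (ht₁ : IsTensorEmbedding t₁) (ht₂ : IsTensorEmbedding t₂)
    {C : Set ((H₁ →L[ℂ] H₁) × (H₂ →L[ℂ] H₂))} {T : T₁ →L[ℂ] T₂} 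
    (hT : ∀ c ∈ C, amp ht₂ c.2 ∘L T = T ∘L amp ht₁ c.1) : 
    ∀ r ∈ Algebra.adjoin ℂ C, amp ht₂ r.2 ∘L T = T ∘L amp ht₁ r.1 := by
  intro r hr
  induction hr using Algebra.adjoin_induction with
  | mem x hx => exact hT x hx
  | algebraMap r => 
    simp only [Algebra.algebraMap_eq_smul_one, Prod.smul_snd, Prod.smul_fst, Prod.snd_one, Prod.fst_one, amp_smul, amp_one]
    ext z; simp
  | add x y _ _ h1 h2 => 
    simp only [Prod.snd_add, Prod.fst_add, amp_add, add_comp, comp_add, h1, h2]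
  | mul x y _ _ h1 h2 => 
    simp only [Prod.snd_mul, Prod.fst_mul, amp_mul]
    rw [show (amp ht₂ x.2 * amp ht₂ y.2) ∘L T = amp ht₂ x.2 ∘L (amp ht₂ y.2 ∘L T) from rfl, h2]
    rw [show amp ht₂ x.2 ∘L (T ∘L amp ht₁ y.1) = (amp ht₂ x.2 ∘L T) ∘L amp ht₁ y.1 from rfl, h1]
    rfl

lemma slice_norm (ht₁ : IsTensorEmbedding t₁) (ht₂ : IsTensorEmbedding t₂) (h : H₁) (h' : H₂) 
    (T : T₁ →L[ℂ] T₂) : ‖slice ht₁ ht₂ h h' T‖ ≤ ‖T‖ * (‖h'‖ * ‖h‖) := by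
  unfold slice
  calc _ ≤ ‖adjoint (tR ht₂ h')‖ * (‖T‖ * ‖tR ht₁ h‖) := 
        (opNorm_comp_le _ _).trans (mul_le_mul_of_nonneg_left (opNorm_comp_le _ _) (norm_nonneg _))
    _ ≤ ‖h'‖ * (‖T‖ * ‖h‖) := by
        rw [LinearIsometryEquiv.norm_map]
        gcongr
        · exact tR_norm _ _
        · exact tR_norm _ _
    _ = _ := by ring

section
variable (ht₁ : IsTensorEmbedding t₁) (ht₂ : IsTensorEmbedding t₂)
    {C : Set ((H₁ →L[ℂ] H₁) × (H₂ →L[ℂ] H₂))} 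

/-- normalized slices -/
def nsl (T : T₁ →L[ℂ] T₂) (ζ : DS H₁ H₂) (r : (H₁ →L[ℂ] H₁) × (H₂ →L[ℂ] H₂)) : K₁ →L[ℂ] K₂ :=
  ((‖dg r ζ‖ ^ 2 : ℝ) : ℂ)⁻¹ • slice ht₁ ht₂ (r.1 (dsp₁ ζ)) (r.2 (dsp₂ ζ)) T

lemma nsl_norm (T : T₁ →L[ℂ] T₂) (ζ : DS H₁ H₂) (r : (H₁ →L[ℂ] H₁) × (H₂ →L[ℂ] H₂)) : 
    ‖nsl ht₁ ht₂ T ζ r‖ ≤ ‖T‖ := by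
  unfold nsl
  rw [norm_smul, norm_inv, Complex.norm_real, Real.norm_of_nonneg (by positivity)]
  by_cases h : ‖dg r ζ‖ = 0
  · simp [h]
  · have hp : 0 < ‖dg r ζ‖ := lt_of_le_of_ne (norm_nonneg _) (Ne.symm h)
    rw [inv_mul_le_iff₀ (by positivity)]
    refine (slice_norm _ _ _ _ _).trans ?_
    have e1 := ds_norm₁ (dg r ζ)
    have e2 := ds_norm₂ (dg r ζ)
    rw [dsp₁_dg] at e1
    rw [dsp₂_dg] at e2
    rw [mul_comm, pow_two]
    gcongr

lemma nsl_inner (T : T₁ →L[ℂ] T₂) (ζ : DS H₁ H₂) (r : (H₁ →L[ℂ] H₁) × (H₂ →L[ℂ] H₂)) (x : K₁) (y : K₂) : 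
    ⟪y, nsl ht₁ ht₂ T ζ r x⟫ * ((‖dg r ζ‖ ^ 2 : ℝ) : ℂ) = 
      ⟪t₂ (r.2 (dsp₂ ζ)) y, T (t₁ (r.1 (dsp₁ ζ)) x)⟫ := by
  have e : ⟪y, nsl ht₁ ht₂ T ζ r x⟫ = ((‖dg r ζ‖ ^ 2 : ℝ) : ℂ)⁻¹ * ⟪t₂ (r.2 (dsp₂ ζ)) y, T (t₁ (r.1 (dsp₁ ζ)) x)⟫ := by
    rw [← slice_inner ht₁ ht₂]
    simp only [nsl, coe_smul', Pi.smul_apply, inner_smul_right]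
  rw [e]
  by_cases h : ‖dg r ζ‖ = 0
  · have e1 := ds_norm₁ (dg r ζ)
    rw [dsp₁_dg, h] at e1
    have : r.1 (dsp₁ ζ) = 0 := norm_le_zero_iff.1 e1
    have h0 : t₁ 0 x = 0 := by
      have := ht₁.2.2.1 0 0 x
      simpa using this
    rw [this, h0]
    simp
  · have : ((‖dg r ζ‖ ^ 2 : ℝ) : ℂ) ≠ 0 := by exact_mod_cast pow_ne_zero 2 h
    field_simp

/-- the limit form -/
def limO (T : T₁ →L[ℂ] T₂) (x : K₁) (y : K₂) : DS H₁ H₂ →L[ℂ] DS H₁ H₂ :=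
  dsi₂ ∘L adjoint (tL ht₂ y) ∘L T ∘L tL ht₁ x ∘L dsp₁

lemma limO_inner (T : T₁ →L[ℂ] T₂) (x : K₁) (y : K₂) (z w : DS H₁ H₂) : 
   ⟪w, limO ht₁ ht₂ T x y z⟫ = ⟪t₂ (dsp₂ w) y, T (t₁ (dsp₁ z) x)⟫ := by
  rw [← inner_conj_symm]
  simp only [limO, coe_comp', Function.comp_apply]
  rw [ds_inner_i₂, inner_conj_symm, adjoint_inner_right]
  simp

end

end KeyD
end OpSynth

namespace OpSynth
set_option linter.all false
section KeyE
open Filter Topology ContinuousLinearMap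
variable {H₁ H₂ K₁ K₂ T₁ T₂ : Type*}
  [NormedAddCommGroup H₁] [InnerProductSpace ℂ H₁] [CompleteSpace H₁]
  [NormedAddCommGroup H₂] [InnerProductSpace ℂ H₂] [CompleteSpace H₂]
  [NormedAddCommGroup K₁] [InnerProductSpace ℂ K₁] [CompleteSpace K₁]
  [NormedAddCommGroup K₂] [InnerProductSpace ℂ K₂] [CompleteSpace K₂]
  [NormedAddCommGroup T₁] [InnerProductSpace ℂ T₁] [CompleteSpace T₁]
  [NormedAddCommGroup T₂] [InnerProductSpace ℂ T₂] [CompleteSpace T₂]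
  {t₁ : H₁ → K₁ → T₁} {t₂ : H₂ → K₂ → T₂}
  (ht₁ : IsTensorEmbedding t₁) (ht₂ : IsTensorEmbedding t₂)
    {C : Set ((H₁ →L[ℂ] H₁) × (H₂ →L[ℂ] H₂))} 

lemma dg_mul_apply (a b : (H₁ →L[ℂ] H₁) × (H₂ →L[ℂ] H₂)) (z : DS H₁ H₂) : dg (a * b) z = dg a (dg b z) := by
  apply ds_ext <;> simp
lemma dg_smul_apply (c : ℂ) (b : (H₁ →L[ℂ] H₁) × (H₂ →L[ℂ] H₂)) (z : DS H₁ H₂) : dg (c • b) z = c • (dg b z) := by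
  apply ds_ext
  · rw [dsp₁_dg, map_smul, dsp₁_dg]; rfl
  · rw [dsp₂_dg, map_smul, dsp₂_dg]; rfl

lemma dg_proj {r : (H₁ →L[ℂ] H₁) × (H₂ →L[ℂ] H₂)} (h1 : r * r = r) (h2 : star r = r) : IsProj (dg r) := by
  refine ⟨?_, ?_⟩
  · change dg r * dg r = dg r
    rw [← map_mul, h1]
  · rw [isSelfAdjoint_iff', dg_adjoint, h2]

lemma fst_proj {r : (H₁ →L[ℂ] H₁) × (H₂ →L[ℂ] H₂)} (h1 : r * r = r) (h2 : star r = r) : IsProj r.1 :=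
  ⟨congrArg Prod.fst h1, congrArg Prod.fst h2⟩
lemma snd_proj {r : (H₁ →L[ℂ] H₁) × (H₂ →L[ℂ] H₂)} (h1 : r * r = r) (h2 : star r = r) : IsProj r.2 :=
  ⟨congrArg Prod.snd h1, congrArg Prod.snd h2⟩

lemma amp_proj {p : H₁ →L[ℂ] H₁} (h : IsProj p) : IsProj (amp ht₁ p) := by
  refine ⟨?_, ?_⟩
  · change amp ht₁ p * amp ht₁ p = _
    rw [← amp_mul]; congr 1; exact h.1
  · rw [isSelfAdjoint_iff', amp_adjoint]; congr 1; exact h.2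

def appO (T : T₁ →L[ℂ] T₂) (ζ : DS H₁ H₂) {F : Set ((H₁ →L[ℂ] H₁) × (H₂ →L[ℂ] H₂))} 
    (P : Ptn (Algebra.adjoin ℂ C) F) (x : K₁) (y : K₂) : DS H₁ H₂ →L[ℂ] DS H₁ H₂ :=
  ∑ i, ⟪y, nsl ht₁ ht₂ T ζ (P.r i) x⟫ • dg (P.r i)

lemma appO_norm (T : T₁ →L[ℂ] T₂) (ζ : DS H₁ H₂) {F : Set ((H₁ →L[ℂ] H₁) × (H₂ →L[ℂ] H₂))} 
    (P : Ptn (Algebra.adjoin ℂ C) F) (x : K₁) (y : K₂) : 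
    ‖appO ht₁ ht₂ T ζ P x y‖ ≤ ‖y‖ * (‖T‖ * ‖x‖) := by
  have e : appO ht₁ ht₂ T ζ P x y = ∑ i, dg (P.r i) ∘L (⟪y, nsl ht₁ ht₂ T ζ (P.r i) x⟫ • (1 : DS H₁ H₂ →L[ℂ] DS H₁ H₂)) ∘L dg (P.r i) := by
    unfold appO
    refine Finset.sum_congr rfl fun i _ => ?_
    have := (dg_proj (P.idem i) (P.sa i)).1
    conv_lhs => rw [← this]
    ext1 z
    simp
  rw [e]
  refine block_norm (by positivity) _ _ _ (fun i => dg_proj (P.idem i) (P.sa i)) (fun i => dg_proj (P.idem i) (P.sa i)) ?_ ?_ ?_ ?_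
  · intro i j hij; rw [← map_mul, P.orth i j hij, map_zero]
  · intro i j hij; rw [← map_mul, P.orth i j hij, map_zero]
  · rw [← map_sum, P.sum, map_one]
  · intro i
    rw [norm_smul]
    have h1 : ‖(1 : DS H₁ H₂ →L[ℂ] DS H₁ H₂)‖ ≤ 1 := norm_id_le
    refine (mul_le_of_le_one_right (norm_nonneg _) h1).trans ?_
    refine (norm_inner_le_norm _ _).trans ?_
    gcongr
    exact le_of_opNorm_le _ (nsl_norm ht₁ ht₂ T ζ (P.r i)) x

lemma appO_key (hc : ∀ c ∈ C, ∀ c' ∈ C, c * c' = c' * c) {T : T₁ →L[ℂ] T₂} 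
    (hT : ∀ c ∈ C, amp ht₂ c.2 ∘L T = T ∘L amp ht₁ c.1) (ζ : DS H₁ H₂) 
    {F : Set ((H₁ →L[ℂ] H₁) × (H₂ →L[ℂ] H₂))} 
    (P : Ptn (Algebra.adjoin ℂ C) F) (x : K₁) (y : K₂) {n m : (H₁ →L[ℂ] H₁) × (H₂ →L[ℂ] H₂)} 
    (hn : n ∈ Algebra.adjoin ℂ C) (hm : m ∈ Algebra.adjoin ℂ C) 
    (hn' : ∀ i, ∃ a : ℂ, n * P.r i = a • P.r i) (hm' : ∀ i, ∃ a : ℂ, m * P.r i = a • P.r i) : 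
    ⟪dg m ζ, appO ht₁ ht₂ T ζ P x y (dg n ζ)⟫ = ⟪dg m ζ, limO ht₁ ht₂ T x y (dg n ζ)⟫ := by
  choose α hα using hn'
  choose β hβ using hm'
  have hα' : ∀ i, P.r i * n = α i • P.r i := fun i => by rw [← hα, adjoin_comm hc _ (P.mem i) _ hn]
  have hβ' : ∀ i, P.r i * m = β i • P.r i := fun i => by rw [← hβ, adjoin_comm hc _ (P.mem i) _ hm]
  have hpr := fun i => dg_proj (P.idem i) (P.sa i)
  have hr : ∀ i z, dg (P.r i) (dg n z) = α i • dg (P.r i) z := by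
    intro i z
    have := congrArg (fun a => dg a z) (hα' i)
    simp only [dg_mul_apply, dg_smul_apply] at this
    exact this
  have hr' : ∀ i z, dg (P.r i) (dg m z) = β i • dg (P.r i) z := by
    intro i z
    have := congrArg (fun a => dg a z) (hβ' i)
    simp only [dg_mul_apply, dg_smul_apply] at this
    exact this
  have e1 : ⟪dg m ζ, appO ht₁ ht₂ T ζ P x y (dg n ζ)⟫ = 
      ∑ i, (starRingEnd ℂ (β i)) * α i * ⟪t₂ ((P.r i).2 (dsp₂ ζ)) y, T (t₁ ((P.r i).1 (dsp₁ ζ)) x)⟫ := by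
    simp only [appO, sum_apply, inner_sum, coe_smul', Pi.smul_apply, inner_smul_right]
    refine Finset.sum_congr rfl fun i _ => ?_
    rw [← nsl_inner ht₁ ht₂]
    rw [← (hpr i).idem (dg n ζ), ← (hpr i).inner_eq, hr, hr', inner_smul_left, inner_smul_right, inner_self_eq_norm_sq_to_K]
    push_cast
    simp only [Complex.coe_algebraMap]
    ring
  rw [e1, limO_inner]
  have e2 : dg n ζ = ∑ i, α i • dg (P.r i) ζ := by
    simp only [← hr]
    have := congrArg (fun a => dg a (dg n ζ)) P.sum
    simp only [map_sum, map_one, sum_apply, one_apply] at this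
    exact this.symm
  rw [e2]
  have hlin : ∀ (f : P.ι → DS H₁ H₂), T (t₁ (dsp₁ (∑ i, α i • f i)) x) = ∑ i, α i • T (t₁ (dsp₁ (f i)) x) := by
    intro f
    have := map_sum (T ∘L tL ht₁ x ∘L dsp₁) (fun i => α i • f i) Finset.univ
    refine this.trans (Finset.sum_congr rfl fun i _ => ?_)
    exact map_smul (T ∘L tL ht₁ x ∘L dsp₁) (α i) (f i)
  rw [hlin, inner_sum]
  refine Finset.sum_congr rfl fun i _ => ?_
  rw [inner_smul_right]
  have h3 : ⟪t₂ (dsp₂ (dg m ζ)) y, T (t₁ (dsp₁ (dg (P.r i) ζ)) x)⟫ = 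
     ⟪t₂ (dsp₂ (dg (P.r i) (dg m ζ))) y, T (t₁ (dsp₁ (dg (P.r i) ζ)) x)⟫ := by
    have h4 := congrArg (fun f => f (t₁ (dsp₁ (dg (P.r i) ζ)) x)) (intertwine_adjoin ht₁ ht₂ hT _ (P.mem i))
    simp only [comp_apply, amp_apply] at h4
    rw [← dsp₁_dg, (hpr i).idem] at h4
    rw [← h4, ← (amp_proj ht₂ (snd_proj (P.idem i) (P.sa i))).inner_eq, amp_apply, ← dsp₂_dg, h4]
  rw [h3, hr', map_smul, ht₂.2.2.1, inner_smul_left, dsp₁_dg, dsp₂_dg]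
  ring

/-- approximants -/
def appG (T : T₁ →L[ℂ] T₂) (ζ : DS H₁ H₂) (d : H₁ →L[ℂ] H₂) {F : Set ((H₁ →L[ℂ] H₁) × (H₂ →L[ℂ] H₂))} 
    (P : Ptn (Algebra.adjoin ℂ C) F) : T₁ →L[ℂ] T₂ :=
  ∑ i, ten ht₁ ht₂ ((P.r i).2 ∘L d) (nsl ht₁ ht₂ T ζ (P.r i))

lemma appG_norm (T : T₁ →L[ℂ] T₂) (ζ : DS H₁ H₂) (d : H₁ →L[ℂ] H₂) 
    (hd : ∀ r ∈ Algebra.adjoin ℂ C, r.2 ∘L d = d ∘L r.1)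
    {F : Set ((H₁ →L[ℂ] H₁) × (H₂ →L[ℂ] H₂))} 
    (P : Ptn (Algebra.adjoin ℂ C) F) : ‖appG ht₁ ht₂ T ζ d P‖ ≤ ‖d‖ * ‖T‖ := by
  have e : appG ht₁ ht₂ T ζ d P = ∑ i, amp ht₂ (P.r i).2 ∘L ten ht₁ ht₂ d (nsl ht₁ ht₂ T ζ (P.r i)) ∘L amp ht₁ (P.r i).1 := by
    refine Finset.sum_congr rfl fun i _ => ?_
    apply tensor_ext ht₁
    intro x y
    simp only [comp_apply, ten_apply, amp_apply]
    have := congrArg (fun f => f ((P.r i).1 x)) (hd _ (P.mem i))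
    simp only [comp_apply] at this
    have h2 := congrArg (fun f => f x) (hd _ (P.mem i))
    simp only [comp_apply] at h2
    rw [this, (fst_proj (P.idem i) (P.sa i)).idem, h2]
  rw [e]
  refine block_norm (by positivity) _ _ _ (fun i => amp_proj ht₁ (fst_proj (P.idem i) (P.sa i))) (fun i => amp_proj ht₂ (snd_proj (P.idem i) (P.sa i))) ?_ ?_ ?_ ?_
  · intro i j hij; rw [← amp_mul, ← Prod.fst_mul, P.orth i j hij, Prod.fst_zero, amp_zero]
  · intro i j hij; rw [← amp_mul, ← Prod.snd_mul, P.orth i j hij, Prod.snd_zero, amp_zero]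
  · have := congrArg Prod.fst P.sum
    rw [Prod.fst_sum, Prod.fst_one] at this
    have h2 : ∑ i, amp ht₁ (P.r i).1 = amp ht₁ (∑ i, (P.r i).1) := 
      (map_sum (AddMonoidHom.mk' (amp ht₁) (amp_add ht₁)) _ _).symm
    rw [h2, this, amp_one]
  · intro i
    refine (ten_norm _ _ _ _).trans ?_
    gcongr
    exact nsl_norm _ _ _ _ _

lemma appG_mem (hc : ∀ c ∈ C, ∀ c' ∈ C, c * c' = c' * c) 
    (T : T₁ →L[ℂ] T₂) (ζ : DS H₁ H₂) (d : H₁ →L[ℂ] H₂) 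
    (hd : ∀ r ∈ Algebra.adjoin ℂ C, r.2 ∘L d = d ∘L r.1)
    (U : Submodule ℂ (K₁ →L[ℂ] K₂)) (hslice : ∀ h h', slice ht₁ ht₂ h h' T ∈ U)
    {F : Set ((H₁ →L[ℂ] H₁) × (H₂ →L[ℂ] H₂))} 
    (P : Ptn (Algebra.adjoin ℂ C) F) : appG ht₁ ht₂ T ζ d P ∈ wTensor t₁ t₂ (Dint C) (U : Set (K₁ →L[ℂ] K₂)) := by
  rw [← mem_wTS]
  refine Submodule.sum_mem _ fun i _ => ?_
  refine ten_mem ht₁ ht₂ ?_ (U.smul_mem _ (hslice _ _))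
  intro c hcC
  have hcm : c ∈ Algebra.adjoin ℂ C := Algebra.subset_adjoin hcC
  have h1 := congrArg Prod.snd (adjoin_comm hc _ hcm _ (P.mem i))
  have h2 := hd c hcm
  ext v
  have h1 := congrArg (fun f => f (d v)) h1
  have h2 := congrArg (fun f => f v) h2
  simp only [comp_apply, Prod.snd_mul, mul_apply_eq_comp] at h1 h2 ⊢
  rw [h1, h2]

end KeyE
end OpSynth

namespace OpSynth
set_option linter.all false
section KeyF
open Filter Topology ContinuousLinearMap
variable {H₁ H₂ K₁ K₂ T₁ T₂ : Type*}
  [NormedAddCommGroup H₁] [InnerProductSpace ℂ H₁] [CompleteSpace H₁]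
  [NormedAddCommGroup H₂] [InnerProductSpace ℂ H₂] [CompleteSpace H₂]
  [NormedAddCommGroup K₁] [InnerProductSpace ℂ K₁] [CompleteSpace K₁]
  [NormedAddCommGroup K₂] [InnerProductSpace ℂ K₂] [CompleteSpace K₂]
  [NormedAddCommGroup T₁] [InnerProductSpace ℂ T₁] [CompleteSpace T₁]
  [NormedAddCommGroup T₂] [InnerProductSpace ℂ T₂] [CompleteSpace T₂]
  {t₁ : H₁ → K₁ → T₁} {t₂ : H₂ → K₂ → T₂}
  (ht₁ : IsTensorEmbedding t₁) (ht₂ : IsTensorEmbedding t₂)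
    {C : Set ((H₁ →L[ℂ] H₁) × (H₂ →L[ℂ] H₂))} 

lemma adjoin_map_star {E : Type*} [NormedAddCommGroup E] [InnerProductSpace ℂ E] [CompleteSpace E] 
    (hs : ∀ c ∈ C, star c = c) (f : ((H₁ →L[ℂ] H₁) × (H₂ →L[ℂ] H₂)) →ₐ[ℂ] (E →L[ℂ] E)) 
    (hf : ∀ r, adjoint (f r) = f (star r)) : 
    ∀ a ∈ (Algebra.adjoin ℂ C).map f, adjoint a ∈ (Algebra.adjoin ℂ C).map f := by
  rintro _ ⟨r, hr, rfl⟩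
  exact ⟨star r, adjoin_star hs r hr, (hf r).symm⟩

lemma dg_mem {r : (H₁ →L[ℂ] H₁) × (H₂ →L[ℂ] H₂)} 
    (hr : r ∈ Algebra.adjoin ℂ C) : dg r ∈ (Algebra.adjoin ℂ C).map dg := Subalgebra.mem_map.2 ⟨r, hr, rfl⟩

abbrev EL (C : Set ((H₁ →L[ℂ] H₁) × (H₂ →L[ℂ] H₂))) (ζ : DS H₁ H₂) : DS H₁ H₂ →L[ℂ] DS H₁ H₂ := 
  cycP ((Algebra.adjoin ℂ C).map dg) ζ

lemma EL_comm (hs : ∀ c ∈ C, star c = c) (ζ : DS H₁ H₂) {r : (H₁ →L[ℂ] H₁) × (H₂ →L[ℂ] H₂)} 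
    (hr : r ∈ Algebra.adjoin ℂ C) (z : DS H₁ H₂) : EL C ζ (dg r z) = dg r (EL C ζ z) := by
  have hst := adjoin_map_star hs dg dg_adjoint
  have := cycP_comm hst ζ (a := dg r) (dg_mem hr)
  have := congrArg (fun f => f z) this
  simpa only [mul_apply_eq_comp] using this

lemma EL_proj (ζ : DS H₁ H₂) : IsProj (EL C ζ) := starProj_isProj _

def opA (C : Set ((H₁ →L[ℂ] H₁) × (H₂ →L[ℂ] H₂))) (ζ : DS H₁ H₂) : H₁ →L[ℂ] H₁ := dsp₁ ∘L EL C ζ ∘L dsi₁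
def opB (C : Set ((H₁ →L[ℂ] H₁) × (H₂ →L[ℂ] H₂))) (ζ : DS H₁ H₂) : H₂ →L[ℂ] H₂ := dsp₂ ∘L EL C ζ ∘L dsi₂
def opd (C : Set ((H₁ →L[ℂ] H₁) × (H₂ →L[ℂ] H₂))) (ζ : DS H₁ H₂) : H₁ →L[ℂ] H₂ := dsp₂ ∘L EL C ζ ∘L dsi₁

lemma dg_i₁ (r : (H₁ →L[ℂ] H₁) × (H₂ →L[ℂ] H₂)) (v : H₁) : dg r (dsi₁ v) = dsi₁ (r.1 v) := by
  apply ds_ext <;> simp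
lemma dg_i₂ (r : (H₁ →L[ℂ] H₁) × (H₂ →L[ℂ] H₂)) (v : H₂) : dg r (dsi₂ v) = dsi₂ (r.2 v) := by
  apply ds_ext <;> simp

lemma opd_int (hs : ∀ c ∈ C, star c = c) (ζ : DS H₁ H₂) : 
    ∀ r ∈ Algebra.adjoin ℂ C, r.2 ∘L opd C ζ = opd C ζ ∘L r.1 := by
  intro r hr
  ext v
  simp only [opd, comp_apply]
  rw [← dg_i₁, EL_comm hs ζ hr, dsp₂_dg]

lemma opA_comm (hs : ∀ c ∈ C, star c = c) (ζ : DS H₁ H₂) : 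
    ∀ r ∈ Algebra.adjoin ℂ C, r.1 * opA C ζ = opA C ζ * r.1 := by
  intro r hr
  ext v
  simp only [opA, comp_apply, mul_apply_eq_comp]
  rw [← dg_i₁, EL_comm hs ζ hr, dsp₁_dg]

lemma opB_comm (hs : ∀ c ∈ C, star c = c) (ζ : DS H₁ H₂) : 
    ∀ r ∈ Algebra.adjoin ℂ C, r.2 * opB C ζ = opB C ζ * r.2 := by
  intro r hr
  ext v
  simp only [opB, comp_apply, mul_apply_eq_comp]
  rw [← dg_i₂, EL_comm hs ζ hr, dsp₂_dg]

lemma EL_tendsto (hc : ∀ c ∈ C, ∀ c' ∈ C, c * c' = c' * c) (hs : ∀ c ∈ C, star c = c) 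
    {T : T₁ →L[ℂ] T₂} 
    (hT : ∀ c ∈ C, amp ht₂ c.2 ∘L T = T ∘L amp ht₁ c.1) (ζ : DS H₁ H₂) 
    (P : ∀ F : Finset C, Ptn (Algebra.adjoin ℂ C) ((F.map (Function.Embedding.subtype _) : Finset _) : Set ((H₁ →L[ℂ] H₁) × (H₂ →L[ℂ] H₂)))) 
    (x : K₁) (y : K₂) (z w : DS H₁ H₂) : 
    Tendsto (fun F => ⟪w, EL C ζ (appO ht₁ ht₂ T ζ (P F) x y (EL C ζ z))⟫) atTop 
      (𝓝 ⟪w, EL C ζ (limO ht₁ ht₂ T x y (EL C ζ z))⟫) := by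
  classical
  set L := cyc ((Algebra.adjoin ℂ C).map dg) ζ with hL
  set s : Set (DS H₁ H₂) := {z | ∃ n ∈ Algebra.adjoin ℂ C, z = dg n ζ} ∪ (Lᗮ : Set (DS H₁ H₂)) with hsdef
  have hzero : ∀ v ∈ Lᗮ, EL C ζ v = 0 := by
    intro v hv
    exact (Submodule.starProjection_apply_eq_zero_iff _).2 hv
  have hfix : ∀ n ∈ Algebra.adjoin ℂ C, EL C ζ (dg n ζ) = dg n ζ := by
    intro n hn
    exact (Submodule.starProjection_eq_self_iff).2 (mem_cyc (dg_mem hn) ζ)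
  have htot : (Submodule.span ℂ s).topologicalClosure = ⊤ := by
    rw [eq_top_iff]
    have h1 : L ≤ (Submodule.span ℂ s).topologicalClosure := by
      apply cyc_le (Submodule.isClosed_topologicalClosure _)
      rintro _ ⟨n, hn, rfl⟩
      exact Submodule.le_topologicalClosure _ (Submodule.subset_span (Or.inl ⟨n, hn, rfl⟩))
    have h2 : Lᗮ ≤ (Submodule.span ℂ s).topologicalClosure := by
      intro v hv
      exact Submodule.le_topologicalClosure _ (Submodule.subset_span (Or.inr hv))
    have h3 : L ⊔ Lᗮ = ⊤ := Submodule.sup_orthogonal_of_hasOrthogonalProjection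
    rw [← h3]
    exact sup_le h1 h2
  have key := tendsto_sw_of_bdd (l := (atTop : Filter (Finset C))) 
    (f := fun F => EL C ζ ∘L appO ht₁ ht₂ T ζ (P F) x y ∘L EL C ζ) 
    (T := EL C ζ ∘L limO ht₁ ht₂ T x y ∘L EL C ζ) (C := 1 * ((‖y‖ * (‖T‖ * ‖x‖)) * 1)) 
    (s := s) (s' := s) ?_ htot htot ?_
  · have := tendsto_sw_inner key z w
    simpa using this
  · intro F
    refine (opNorm_comp_le _ _).trans ?_
    gcongr
    · exact (EL_proj ζ).norm_le
    refine (opNorm_comp_le _ _).trans ?_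
    gcongr
    · exact appO_norm _ _ _ _ _ _ _
    · exact (EL_proj ζ).norm_le
  · rintro z hz w hw
    simp only [comp_apply]
    simp only [← (EL_proj ζ).inner_eq]
    rcases hz with ⟨n, hn, rfl⟩ | hz
    swap
    · rw [hzero z hz]; simp
    rcases hw with ⟨m, hm, rfl⟩ | hw
    swap
    · rw [hzero w hw]; simp
    rw [hfix n hn, hfix m hm]
    obtain ⟨F1, hF1, hF1'⟩ := adjoin_diag hn
    obtain ⟨F2, hF2, hF2'⟩ := adjoin_diag hm
    refine tendsto_const_nhds.congr' ?_
    filter_upwards [eventually_ge_atTop ((F1 ∪ F2).preimage (Subtype.val : C → _) Subtype.val_injective.injOn)] with F hF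
    have hmem : ∀ c ∈ F1 ∪ F2, c ∈ (F.map (Function.Embedding.subtype _) : Finset _) := by
      intro c hc
      have hcC : c ∈ C := by
        rcases Finset.mem_union.1 hc with h | h
        · exact hF1 h
        · exact hF2 h
      rw [Finset.mem_map]
      exact ⟨⟨c, hcC⟩, hF (by rw [Finset.mem_preimage]; exact hc), rfl⟩
    symm
    apply appO_key ht₁ ht₂ hc hT ζ (P F) x y hn hm
    · intro i
      exact hF1' _ (fun c hc => (P F).diag c (hmem c (Finset.mem_union_left _ hc)) i)
    · intro i
      exact hF2' _ (fun c hc => (P F).diag c (hmem c (Finset.mem_union_right _ hc)) i)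

lemma key_AB (hc : ∀ c ∈ C, ∀ c' ∈ C, c * c' = c' * c) (hs : ∀ c ∈ C, star c = c) (hi : ∀ c ∈ C, c * c = c)
    {T : T₁ →L[ℂ] T₂} 
    (hT : ∀ c ∈ C, amp ht₂ c.2 ∘L T = T ∘L amp ht₁ c.1) (ζ : DS H₁ H₂) 
    (U : Submodule ℂ (K₁ →L[ℂ] K₂)) (hslice : ∀ h h', slice ht₁ ht₂ h h' T ∈ U) : 
    amp ht₂ (opB C ζ) ∘L T ∘L amp ht₁ (opA C ζ) ∈ wTensor t₁ t₂ (Dint C) (U : Set (K₁ →L[ℂ] K₂)) := by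
  have hP : ∀ F : Finset C, Nonempty (Ptn (Algebra.adjoin ℂ C) ((F.map (Function.Embedding.subtype _) : Finset _) : Set ((H₁ →L[ℂ] H₁) × (H₂ →L[ℂ] H₂)))) := by
    intro F
    apply exists_ptn hc hs hi
    intro c h
    simp at h
    exact h.1
  have P := fun F => (hP F).some
  refine (wTensor_closed _ _).mem_of_tendsto (l := (atTop : Filter (Finset C))) (f := fun F => appG ht₁ ht₂ T ζ (opd C ζ) (P F)) ?_ 
    (Eventually.of_forall fun F => appG_mem ht₁ ht₂ hc T ζ _ (opd_int hs ζ) U hslice (P F))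
  refine tendsto_sw_of_bdd (s := { z | ∃ x y, z = t₁ x y }) (s' := { z | ∃ x y, z = t₂ x y }) 
    (fun F => appG_norm ht₁ ht₂ T ζ _ (opd_int hs ζ) (P F)) ht₁.2.2.2.2.2 ht₂.2.2.2.2.2 ?_
  rintro _ ⟨v, x, rfl⟩ _ ⟨w, y, rfl⟩
  have h := EL_tendsto ht₁ ht₂ hc hs hT ζ P x y (dsi₁ v) (dsi₂ w)
  have e1 : ⟪dsi₂ w, EL C ζ (limO ht₁ ht₂ T x y (EL C ζ (dsi₁ v)))⟫ = 
     ⟪t₂ w y, (amp ht₂ (opB C ζ) ∘L T ∘L amp ht₁ (opA C ζ)) (t₁ v x)⟫ := by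
    rw [← (EL_proj ζ).inner_eq, limO_inner]
    simp only [comp_apply, amp_apply]
    rw [← adjoint_inner_left (amp ht₂ (opB C ζ)), amp_adjoint, amp_apply]
    have : adjoint (opB C ζ) = opB C ζ := by
      symm
      rw [eq_adjoint_iff]
      intro a b
      simp only [opB, comp_apply]
      rw [← ds_inner_i₂, ← (EL_proj ζ).inner_eq, ← inner_conj_symm, ← ds_inner_i₂, inner_conj_symm]
    rw [this]
    rfl
  rw [e1] at h
  refine h.congr fun F => ?_
  simp only [appO, appG, sum_apply, inner_sum, map_sum, coe_smul', Pi.smul_apply, map_smul, inner_smul_right, ten_apply, ht₂.inner]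
  refine Finset.sum_congr rfl fun i _ => ?_
  rw [EL_comm hs ζ ((P F).mem i), (EL_proj ζ).idem, ds_inner_i₂, dsp₂_dg]
  simp only [opd, comp_apply]
  ring

end KeyF
end OpSynth

namespace OpSynth
set_option linter.all false
section KeyG
open Filter Topology ContinuousLinearMap
variable {H H₁ H₂ K₁ K₂ T₁ T₂ : Type*}
  [NormedAddCommGroup H] [InnerProductSpace ℂ H] [CompleteSpace H]
  [NormedAddCommGroup H₁] [InnerProductSpace ℂ H₁] [CompleteSpace H₁]
  [NormedAddCommGroup H₂] [InnerProductSpace ℂ H₂] [CompleteSpace H₂]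
  [NormedAddCommGroup K₁] [InnerProductSpace ℂ K₁] [CompleteSpace K₁]
  [NormedAddCommGroup K₂] [InnerProductSpace ℂ K₂] [CompleteSpace K₂]
  [NormedAddCommGroup T₁] [InnerProductSpace ℂ T₁] [CompleteSpace T₁]
  [NormedAddCommGroup T₂] [InnerProductSpace ℂ T₂] [CompleteSpace T₂]
  {t₁ : H₁ → K₁ → T₁} {t₂ : H₂ → K₂ → T₂}

lemma adjoin_single_comm {A B : H →L[ℂ] H} (h : B * A = A * B) : ∀ X ∈ Algebra.adjoin ℂ {A}, B * X = X * B := by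
  intro X hX
  have : Algebra.adjoin ℂ {A} ≤ Subalgebra.centralizer ℂ {B} := by
    apply Algebra.adjoin_le
    rintro _ rfl
    rw [SetLike.mem_coe, Subalgebra.mem_centralizer_iff]
    rintro _ rfl; exact h
  exact (Subalgebra.mem_centralizer_iff ℂ).1 (this hX) B rfl

lemma avg (A : H →L[ℂ] H) (hA : ‖1 - A‖ ≤ 1) (L : Submodule ℂ H) [L.HasOrthogonalProjection] 
    (hL : ∀ v, A v = 0 ↔ v ∈ Lᗮ) : 
    ∃ Cn : ℕ → H →L[ℂ] H, (∀ n, Cn n ∈ Algebra.adjoin ℂ {A}) ∧ (∀ n, ‖Cn n * A‖ ≤ 2) ∧ 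
      ∀ v, Tendsto (fun n => (Cn n * A) v) atTop (𝓝 (L.starProjection v)) := by
  set f := 1 - A with hf
  set Cn : ℕ → H →L[ℂ] H := fun n => ((n + 1 : ℕ) : ℂ)⁻¹ • ∑ k ∈ Finset.range (n + 1), ∑ i ∈ Finset.range k, f ^ i with hCn
  have hfm : f ∈ Algebra.adjoin ℂ {A} := Subalgebra.sub_mem _ (Subalgebra.one_mem _) (Algebra.subset_adjoin rfl)
  have hprod : ∀ n, Cn n * A = 1 - ((n + 1 : ℕ) : ℂ)⁻¹ • ∑ k ∈ Finset.range (n + 1), f ^ k := by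
    intro n
    have h1 : ∀ k, (∑ i ∈ Finset.range k, f ^ i) * A = 1 - f ^ k := by
      intro k
      have := geom_sum_mul_neg f k
      rwa [hf, sub_sub_cancel] at this
    have hne : ((n + 1 : ℕ) : ℂ) ≠ 0 := by exact_mod_cast Nat.succ_ne_zero n
    simp only [hCn, smul_mul_assoc, Finset.sum_mul, h1, Finset.sum_sub_distrib, smul_sub]
    congr 1
    rw [Finset.sum_const, Finset.card_range, ← Nat.cast_smul_eq_nsmul ℂ, smul_smul, inv_mul_cancel₀ hne, one_smul]
  refine ⟨Cn, ?_, ?_, ?_⟩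
  · intro n
    refine Subalgebra.smul_mem _ (Subalgebra.sum_mem _ fun k _ => Subalgebra.sum_mem _ fun i _ => Subalgebra.pow_mem _ hfm i) _
  · intro n
    rw [hprod]
    have h1 : ‖(1 : H →L[ℂ] H)‖ ≤ 1 := norm_id_le
    have hpow : ∀ k, ‖f ^ k‖ ≤ 1 := by
      intro k
      induction k with
      | zero => simpa using h1
      | succ k ih => 
        rw [pow_succ]
        refine (norm_mul_le _ _).trans ?_
        nlinarith [norm_nonneg (f ^ k), norm_nonneg f]
    have h2 : ‖((n + 1 : ℕ) : ℂ)⁻¹ • ∑ k ∈ Finset.range (n + 1), f ^ k‖ ≤ 1 := by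
      rw [norm_smul, norm_inv, Complex.norm_natCast]
      rw [inv_mul_le_iff₀ (by positivity), mul_one]
      refine (norm_sum_le _ _).trans ?_
      refine (Finset.sum_le_sum fun k _ => hpow k).trans ?_
      simp
    linarith [norm_sub_le (1 : H →L[ℂ] H) (((n + 1 : ℕ) : ℂ)⁻¹ • ∑ k ∈ Finset.range (n + 1), f ^ k)]
  · intro v
    have h := (f.tendsto_birkhoffAverage_orthogonalProjection hA v).comp (tendsto_add_atTop_nat 1)
    have hlim : (((f.eqLocus (1 : H →L[ℂ] H)).orthogonalProjectionOnto v : (f.eqLocus (1 : H →L[ℂ] H))) : H) = v - L.starProjection v := by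
      change (f.eqLocus (1 : H →L[ℂ] H)).starProjection v = _
      have hmem : ∀ w, w ∈ f.eqLocus (1 : H →L[ℂ] H) ↔ w ∈ Lᗮ := by
        intro w
        rw [← hL, LinearMap.mem_eqLocus]
        simp [hf]
      apply Submodule.eq_starProjection_of_mem_orthogonal
      · rw [hmem]; exact Submodule.sub_starProjection_mem_orthogonal v
      · rw [sub_sub_cancel, Submodule.mem_orthogonal]
        intro u hu
        rw [hmem] at hu
        exact Submodule.inner_left_of_mem_orthogonal (L.starProjection_apply_mem v) hu
    rw [hlim] at h
    have h2 := tendsto_const_nhds (x := v) (f := atTop (α := ℕ)) |>.sub h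
    rw [sub_sub_cancel] at h2
    refine h2.congr fun n => ?_
    rw [hprod]
    simp only [sub_apply, one_apply, Function.comp_apply, birkhoffAverage, birkhoffSum, coe_smul', Pi.smul_apply, sum_apply]
    simp

lemma amp_tendsto (ht₁ : IsTensorEmbedding t₁) {X : ℕ → H₁ →L[ℂ] H₁} {Y : H₁ →L[ℂ] H₁} {c : ℝ} (hb : ∀ n, ‖X n‖ ≤ c)
    (h : ∀ v, Tendsto (fun n => X n v) atTop (𝓝 (Y v))) : 
    Tendsto (fun n => amp ht₁ (X n)) atTop (@nhds _ (sigmaWeak T₁ T₁) (amp ht₁ Y)) := by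
  refine tendsto_sw_of_bdd (s := { z | ∃ x y, z = t₁ x y }) (s' := { z | ∃ x y, z = t₁ x y }) 
    (fun n => (amp_norm ht₁ _).trans (hb n)) ht₁.2.2.2.2.2 ht₁.2.2.2.2.2 ?_
  rintro _ ⟨v, x, rfl⟩ _ ⟨w, y, rfl⟩
  simp only [amp_apply, ht₁.inner]
  exact ((tendsto_const_nhds).inner (h v)).mul_const _

lemma amp_lim_right (ht₁ : IsTensorEmbedding t₁) {X : ℕ → H₁ →L[ℂ] H₁} {Y : H₁ →L[ℂ] H₁} {c : ℝ} (hb : ∀ n, ‖X n‖ ≤ c)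
    (h : ∀ v, Tendsto (fun n => X n v) atTop (𝓝 (Y v))) {M : Set (T₁ →L[ℂ] T₂)} (hM : WkClosed M) 
    (S : T₁ →L[ℂ] T₂) (hS : ∀ n, S ∘L amp ht₁ (X n) ∈ M) : S ∘L amp ht₁ Y ∈ M := by
  refine hM.mem_of_tendsto (l := atTop) (f := fun n => S ∘L amp ht₁ (X n)) ?_ (Eventually.of_forall hS)
  have h1 := wkc_comp (1 : T₁ →L[ℂ] T₁) S
  have h2 := @Continuous.tendsto _ _ (sigmaWeak T₁ T₁) (sigmaWeak T₁ T₂) _ h1 (amp ht₁ Y)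
  exact h2.comp (amp_tendsto ht₁ hb h)

lemma amp_lim_left (ht₂ : IsTensorEmbedding t₂) {X : ℕ → H₂ →L[ℂ] H₂} {Y : H₂ →L[ℂ] H₂} {c : ℝ} (hb : ∀ n, ‖X n‖ ≤ c)
    (h : ∀ v, Tendsto (fun n => X n v) atTop (𝓝 (Y v))) {M : Set (T₁ →L[ℂ] T₂)} (hM : WkClosed M) 
    (S : T₁ →L[ℂ] T₂) (hS : ∀ n, amp ht₂ (X n) ∘L S ∈ M) : amp ht₂ Y ∘L S ∈ M := by
  refine hM.mem_of_tendsto (l := atTop) (f := fun n => amp ht₂ (X n) ∘L S) ?_ (Eventually.of_forall hS)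
  have h1 := wkc_comp S (1 : T₂ →L[ℂ] T₂)
  have h2 := @Continuous.tendsto _ _ (sigmaWeak T₂ T₂) (sigmaWeak T₁ T₂) _ h1 (amp ht₂ Y)
  exact h2.comp (amp_tendsto ht₂ hb h)

variable {C : Set ((H₁ →L[ℂ] H₁) × (H₂ →L[ℂ] H₂))} 

abbrev alg₁ (C : Set ((H₁ →L[ℂ] H₁) × (H₂ →L[ℂ] H₂))) := (Algebra.adjoin ℂ C).map (AlgHom.fst ℂ (H₁ →L[ℂ] H₁) (H₂ →L[ℂ] H₂))
abbrev alg₂ (C : Set ((H₁ →L[ℂ] H₁) × (H₂ →L[ℂ] H₂))) := (Algebra.adjoin ℂ C).map (AlgHom.snd ℂ (H₁ →L[ℂ] H₁) (H₂ →L[ℂ] H₂))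

lemma mem_orth_cyc {𝒜 : Subalgebra ℂ (H →L[ℂ] H)} {ξ v : H} : v ∈ (cyc 𝒜 ξ)ᗮ ↔ ∀ a ∈ 𝒜, ⟪a ξ, v⟫ = 0 := by
  constructor
  · intro h a ha
    exact (Submodule.mem_orthogonal _ _).1 h _ (mem_cyc ha ξ)
  · intro h
    have : cyc 𝒜 ξ ≤ (ℂ ∙ v)ᗮ := by
      apply cyc_le (Submodule.isClosed_orthogonal _)
      intro a ha
      rw [Submodule.mem_orthogonal_singleton_iff_inner_left]
      exact h a ha
    rw [Submodule.mem_orthogonal]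
    intro u hu
    exact (Submodule.mem_orthogonal_singleton_iff_inner_left).1 (this hu)

lemma EL_ker {ζ z : DS H₁ H₂} : EL C ζ z = 0 ↔ ∀ r ∈ Algebra.adjoin ℂ C, ⟪dg r ζ, z⟫ = 0 := by
  have h1 : EL C ζ z = 0 ↔ z ∈ (cyc ((Algebra.adjoin ℂ C).map dg) ζ)ᗮ := Submodule.starProjection_apply_eq_zero_iff _
  rw [h1, mem_orth_cyc]
  constructor
  · intro h r hr; exact h _ (dg_mem hr)
  · rintro h _ ⟨r, hr, rfl⟩; exact h r hr

lemma proj_zero_of {p : H →L[ℂ] H} (hp : IsProj p) {z : H} (h : ⟪z, p z⟫ = 0) : p z = 0 := by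
  rw [← hp.idem, ← hp.inner_eq] at h
  exact inner_self_eq_zero.1 h

lemma one_sub_proj {p : H →L[ℂ] H} (hp : IsProj p) : IsProj (1 - p) := by
  refine ⟨?_, ?_⟩
  · change (1 - p) * (1 - p) = 1 - p
    have : p * p = p := hp.1
    simp [mul_sub, sub_mul, this]
  · exact (IsSelfAdjoint.one _).sub hp.2

lemma opA_ker (ξ : H₁) (η : H₂) (v : H₁) : opA C (dsi₁ ξ + dsi₂ η) v = 0 ↔ v ∈ (cyc (alg₁ C) ξ)ᗮ := by
  set ζ : DS H₁ H₂ := dsi₁ ξ + dsi₂ η with hζ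
  have h1 : opA C ζ v = 0 ↔ EL C ζ (dsi₁ v) = 0 := by
    constructor
    · intro h
      apply proj_zero_of (EL_proj ζ)
      rw [ds_inner_i₁]
      change ⟪v, opA C ζ v⟫ = 0
      rw [h, inner_zero_right]
    · intro h
      change dsp₁ (EL C ζ (dsi₁ v)) = 0
      rw [h, map_zero]
  have e : ∀ r : (H₁ →L[ℂ] H₁) × (H₂ →L[ℂ] H₂), ⟪dg r ζ, dsi₁ v⟫ = ⟪r.1 ξ, v⟫ := by
    intro r
    rw [← inner_conj_symm, ds_inner_i₁, inner_conj_symm, dsp₁_dg]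
    simp [hζ]
  rw [h1, EL_ker, mem_orth_cyc]
  simp only [e]
  constructor
  · rintro h _ ⟨r, hr, rfl⟩; exact h r hr
  · intro h r hr; exact h _ (Subalgebra.mem_map.2 ⟨r, hr, rfl⟩)

lemma opB_ker (ξ : H₁) (η : H₂) (v : H₂) : opB C (dsi₁ ξ + dsi₂ η) v = 0 ↔ v ∈ (cyc (alg₂ C) η)ᗮ := by
  set ζ : DS H₁ H₂ := dsi₁ ξ + dsi₂ η with hζ
  have h1 : opB C ζ v = 0 ↔ EL C ζ (dsi₂ v) = 0 := by
    constructor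
    · intro h
      apply proj_zero_of (EL_proj ζ)
      rw [ds_inner_i₂]
      change ⟪v, opB C ζ v⟫ = 0
      rw [h, inner_zero_right]
    · intro h
      change dsp₂ (EL C ζ (dsi₂ v)) = 0
      rw [h, map_zero]
  have e : ∀ r : (H₁ →L[ℂ] H₁) × (H₂ →L[ℂ] H₂), ⟪dg r ζ, dsi₂ v⟫ = ⟪r.2 η, v⟫ := by
    intro r
    rw [← inner_conj_symm, ds_inner_i₂, inner_conj_symm, dsp₂_dg]
    simp [hζ]
  rw [h1, EL_ker, mem_orth_cyc]
  simp only [e]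
  constructor
  · rintro h _ ⟨r, hr, rfl⟩; exact h r hr
  · intro h r hr; exact h _ (Subalgebra.mem_map.2 ⟨r, hr, rfl⟩)

lemma opA_norm (ζ : DS H₁ H₂) : ‖1 - opA C ζ‖ ≤ 1 := by
  refine opNorm_le_bound _ zero_le_one fun v => ?_
  have e : (1 - opA C ζ) v = dsp₁ ((1 - EL C ζ) (dsi₁ v)) := by simp [opA]
  rw [e]
  refine (ds_norm₁ _).trans ?_
  have := le_of_opNorm_le _ (one_sub_proj (EL_proj (C := C) ζ)).norm_le (dsi₁ v)
  rwa [ds_normi₁] at this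

lemma opB_norm (ζ : DS H₁ H₂) : ‖1 - opB C ζ‖ ≤ 1 := by
  refine opNorm_le_bound _ zero_le_one fun v => ?_
  have e : (1 - opB C ζ) v = dsp₂ ((1 - EL C ζ) (dsi₂ v)) := by simp [opB]
  rw [e]
  refine (ds_norm₂ _).trans ?_
  have := le_of_opNorm_le _ (one_sub_proj (EL_proj (C := C) ζ)).norm_le (dsi₂ v)
  rwa [ds_normi₂] at this

variable (ht₁ : IsTensorEmbedding t₁) (ht₂ : IsTensorEmbedding t₂)

lemma key_cyc (hc : ∀ c ∈ C, ∀ c' ∈ C, c * c' = c' * c) (hs : ∀ c ∈ C, star c = c) (hi : ∀ c ∈ C, c * c = c)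
    {T : T₁ →L[ℂ] T₂} 
    (hT : ∀ c ∈ C, amp ht₂ c.2 ∘L T = T ∘L amp ht₁ c.1) (ξ : H₁) (η : H₂)
    (U : Submodule ℂ (K₁ →L[ℂ] K₂)) (hslice : ∀ h h', slice ht₁ ht₂ h h' T ∈ U) : 
    amp ht₂ (cycP (alg₂ C) η) ∘L T ∘L amp ht₁ (cycP (alg₁ C) ξ) ∈ wTensor t₁ t₂ (Dint C) (U : Set (K₁ →L[ℂ] K₂)) := by
  set ζ : DS H₁ H₂ := dsi₁ ξ + dsi₂ η with hζ
  obtain ⟨A, hA1, hA2, hA3⟩ := avg (opA C ζ) (opA_norm ζ) (cyc (alg₁ C) ξ) (opA_ker ξ η)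
  obtain ⟨B, hB1, hB2, hB3⟩ := avg (opB C ζ) (opB_norm ζ) (cyc (alg₂ C) η) (opB_ker ξ η)
  refine amp_lim_left ht₂ hB2 hB3 (wTensor_closed _ _) _ fun m => ?_
  rw [← comp_assoc]
  refine amp_lim_right ht₁ hA2 hA3 (wTensor_closed _ _) _ fun n => ?_
  have hAc : ∀ c ∈ C, c.1 * A n = A n * c.1 := fun c hcC => 
    adjoin_single_comm (opA_comm hs ζ c (Algebra.subset_adjoin hcC)) _ (hA1 n)
  have hBc : ∀ c ∈ C, c.2 * B m = B m * c.2 := fun c hcC => 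
    adjoin_single_comm (opB_comm hs ζ c (Algebra.subset_adjoin hcC)) _ (hB1 m)
  have hBB : opB C ζ * B m = B m * opB C ζ := adjoin_single_comm rfl _ (hB1 m)
  have hfin := key_AB ht₁ ht₂ hc hs hi (T := amp ht₂ (B m) ∘L T ∘L amp ht₁ (A n)) ?_ ζ U ?_
  · rw [← hBB, amp_mul, amp_mul]
    exact hfin
  · intro c hcC
    have e1 := congrArg (amp ht₁) (hAc c hcC)
    have e2 := congrArg (amp ht₂) (hBc c hcC)
    rw [amp_mul, amp_mul] at e1 e2
    calc _ = (amp ht₂ c.2 * amp ht₂ (B m)) ∘L T ∘L amp ht₁ (A n) := rfl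
      _ = amp ht₂ (B m) ∘L (amp ht₂ c.2 ∘L T) ∘L amp ht₁ (A n) := by rw [e2]; rfl
      _ = amp ht₂ (B m) ∘L T ∘L (amp ht₁ c.1 * amp ht₁ (A n)) := by rw [hT c hcC]; rfl
      _ = _ := by rw [e1]; rfl
  · intro h h'
    have : slice ht₁ ht₂ h h' (amp ht₂ (B m) ∘L T ∘L amp ht₁ (A n)) = slice ht₁ ht₂ (A n h) (adjoint (B m) h') T := by
      ext x
      apply ext_inner_left ℂ
      intro y
      rw [slice_inner, slice_inner]
      simp only [comp_apply, amp_apply]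
      rw [← adjoint_inner_left, amp_adjoint, amp_apply]
    rw [this]
    exact hslice _ _

theorem D_final [TopologicalSpace.SeparableSpace H₁] [TopologicalSpace.SeparableSpace H₂]
    (hc : ∀ c ∈ C, ∀ c' ∈ C, c * c' = c' * c) (hp : ∀ c ∈ C, IsProj c.1 ∧ IsProj c.2)
    {T : T₁ →L[ℂ] T₂} 
    (hT : ∀ c ∈ C, amp ht₂ c.2 ∘L T = T ∘L amp ht₁ c.1)
    (U : Submodule ℂ (K₁ →L[ℂ] K₂)) (hslice : ∀ h h', slice ht₁ ht₂ h h' T ∈ U) : 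
    T ∈ wTensor t₁ t₂ (Dint C) (U : Set (K₁ →L[ℂ] K₂)) := by
  have hs : ∀ c ∈ C, star c = c := fun c h => Prod.ext (hp c h).1.2 (hp c h).2.2
  have hi : ∀ c ∈ C, c * c = c := fun c h => Prod.ext (hp c h).1.1 (hp c h).2.1
  obtain ⟨P, hP1, hP2, hP3⟩ := cyc_exhaust (alg₁ C) (adjoin_map_star hs _ (fun r => rfl))
  obtain ⟨Q, hQ1, hQ2, hQ3⟩ := cyc_exhaust (alg₂ C) (adjoin_map_star hs _ (fun r => rfl))
  have key : ∀ q ∈ Submodule.span ℂ (range (cycP (alg₂ C))), ∀ p ∈ Submodule.span ℂ (range (cycP (alg₁ C))), 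
      amp ht₂ q ∘L T ∘L amp ht₁ p ∈ wTS t₁ t₂ (Dint C) (U : Set (K₁ →L[ℂ] K₂)) := by
    intro q hq p hp'
    induction hq using Submodule.span_induction with
    | mem q hq => 
      obtain ⟨η, rfl⟩ := hq
      induction hp' using Submodule.span_induction with
      | mem p hp' => 
        obtain ⟨ξ, rfl⟩ := hp'
        exact key_cyc ht₁ ht₂ hc hs hi hT ξ η U hslice
      | zero => rw [amp_zero, comp_zero, comp_zero]; exact Submodule.zero_mem _
      | add x y _ _ h1 h2 => rw [amp_add, comp_add, comp_add]; exact Submodule.add_mem _ h1 h2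
      | smul a x _ h1 => rw [amp_smul, comp_smul, comp_smul]; exact Submodule.smul_mem _ _ h1
    | zero => rw [amp_zero, zero_comp]; exact Submodule.zero_mem _
    | add x y _ _ h1 h2 => rw [amp_add, add_comp]; exact Submodule.add_mem _ h1 h2
    | smul a x _ h1 => rw [amp_smul, smul_comp]; exact Submodule.smul_mem _ _ h1
  have h1 : T = amp ht₂ 1 ∘L T ∘L amp ht₁ 1 := by rw [amp_one, amp_one]; rfl
  rw [h1]
  refine amp_lim_left ht₂ hQ2 (by simpa using hQ3) (wTensor_closed _ _) _ fun m => ?_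
  rw [← comp_assoc]
  refine amp_lim_right ht₁ hP2 (by simpa using hP3) (wTensor_closed _ _) _ fun n => ?_
  exact key _ (hQ1 m) _ (hP1 n)

end KeyG
end OpSynth

namespace OpSynth
set_option linter.all false
section MainStep
open Filter Topology ContinuousLinearMap
variable {H₁ H₂ K₁ K₂ T₁ T₂ : Type*}
  [NormedAddCommGroup H₁] [InnerProductSpace ℂ H₁] [CompleteSpace H₁]
  [NormedAddCommGroup H₂] [InnerProductSpace ℂ H₂] [CompleteSpace H₂]
  [NormedAddCommGroup K₁] [InnerProductSpace ℂ K₁] [CompleteSpace K₁]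
  [NormedAddCommGroup K₂] [InnerProductSpace ℂ K₂] [CompleteSpace K₂]
  [NormedAddCommGroup T₁] [InnerProductSpace ℂ T₁] [CompleteSpace T₁]
  [NormedAddCommGroup T₂] [InnerProductSpace ℂ T₂] [CompleteSpace T₂]
  {t₁ : H₁ → K₁ → T₁} {t₂ : H₂ → K₂ → T₂}

def delt (p : T₁ →L[ℂ] T₁) (q : T₂ →L[ℂ] T₂) (X : T₁ →L[ℂ] T₂) : T₁ →L[ℂ] T₂ :=
  q ∘L X ∘L p + (1 - q) ∘L X ∘L (1 - p)

lemma delt_norm {p : T₁ →L[ℂ] T₁} {q : T₂ →L[ℂ] T₂} (hp : IsProj p) (hq : IsProj q) (X : T₁ →L[ℂ] T₂) :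
    ‖delt p q X‖ ≤ ‖X‖ := by
  have e1 : p * p = p := hp.1
  have e2 : q * q = q := hq.1
  have := block_norm (norm_nonneg X) (fun b : Bool => cond b p (1 - p)) (fun b : Bool => cond b q (1 - q))
    (fun _ => X) (by rintro (_ | _); exacts [one_sub_proj hp, hp]) (by rintro (_ | _); exacts [one_sub_proj hq, hq])
    (by rintro (_ | _) (_ | _) h <;> simp_all [mul_sub, sub_mul]) 
    (by rintro (_ | _) (_ | _) h <;> simp_all [mul_sub, sub_mul]) (by simp) (by simp)
  simpa [delt] using this

lemma delt_int {p : T₁ →L[ℂ] T₁} {q : T₂ →L[ℂ] T₂} (hp : IsProj p) (hq : IsProj q) (X : T₁ →L[ℂ] T₂) :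
    q ∘L delt p q X = delt p q X ∘L p := by
  ext x
  simp [delt, hp.idem, hq.idem]

lemma delt_int' {p p' : T₁ →L[ℂ] T₁} {q q' : T₂ →L[ℂ] T₂} (hp : p * p' = p' * p) (hq : q * q' = q' * q) 
    {X : T₁ →L[ℂ] T₂} (h : q' ∘L X = X ∘L p') :
    q' ∘L delt p q X = delt p q X ∘L p' := by
  have a1 : ∀ x, p (p' x) = p' (p x) := fun x => congrArg (fun f => f x) hp
  have a2 : ∀ x, q (q' x) = q' (q x) := fun x => congrArg (fun f => f x) hq
  have a3 : ∀ x, q' (X x) = X (p' x) := fun x => congrArg (fun f => f x) h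
  ext x
  simp [delt, a1, ← a2, ← a3]

lemma delt_sub (p : T₁ →L[ℂ] T₁) (q : T₂ →L[ℂ] T₂) (X : T₁ →L[ℂ] T₂) :
    X - delt p q X = q ∘L X ∘L (1 - p) + (1 - q) ∘L X ∘L p := by
  ext x
  simp [delt]; abel

lemma main_abs [TopologicalSpace.SeparableSpace H₁] [TopologicalSpace.SeparableSpace H₂]
    (ht₁ : IsTensorEmbedding t₁) (ht₂ : IsTensorEmbedding t₂)
    {C : Set ((H₁ →L[ℂ] H₁) × (H₂ →L[ℂ] H₂))}
    (hc : ∀ c ∈ C, ∀ c' ∈ C, c * c' = c' * c) (hp : ∀ c ∈ C, IsProj c.1 ∧ IsProj c.2)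
    (U : Submodule ℂ (K₁ →L[ℂ] K₂)) (hU : WkClosed (U : Set (K₁ →L[ℂ] K₂)))
    (MV F : Submodule ℂ (T₁ →L[ℂ] T₂)) (hMV : WkClosed (MV : Set (T₁ →L[ℂ] T₂)))
    (hF : ∀ X ∈ F, X ∈ wTensor t₁ t₂ univ (U : Set (K₁ →L[ℂ] K₂)))
    (hD : ∀ X ∈ wTensor t₁ t₂ (Dint C) (U : Set (K₁ →L[ℂ] K₂)), X ∈ MV)
    (h1 : ∀ X ∈ F, ∀ c ∈ C, delt (amp ht₁ c.1) (amp ht₂ c.2) X ∈ F)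
    (h2 : ∀ X ∈ F, ∀ c ∈ C, X - delt (amp ht₁ c.1) (amp ht₂ c.2) X ∈ MV)
    {T : T₁ →L[ℂ] T₂} (hT : T ∈ F) : T ∈ MV := by
  have step : ∀ s : Finset C, ∃ X ∈ F, T - X ∈ MV ∧ ‖X‖ ≤ ‖T‖ ∧ 
      ∀ c ∈ s, amp ht₂ c.1.2 ∘L X = X ∘L amp ht₁ c.1.1 := by
    classical
    intro s
    induction s using Finset.induction_on with
    | empty => exact ⟨T, hT, by simp, le_rfl, by simp⟩
    | insert c s hcs ih => 
      obtain ⟨X, hX, hX1, hX2, hX3⟩ := ih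
      have q1 := amp_proj ht₁ (hp c.1 c.2).1
      have q2 := amp_proj ht₂ (hp c.1 c.2).2
      refine ⟨delt (amp ht₁ c.1.1) (amp ht₂ c.1.2) X, h1 X hX c.1 c.2, ?_, (delt_norm q1 q2 X).trans hX2, ?_⟩
      · have := MV.add_mem hX1 (h2 X hX c.1 c.2)
        simpa using this
      · intro c' hc'
        rw [Finset.mem_insert] at hc'
        rcases hc' with rfl | hc'
        · exact delt_int q1 q2 X
        · have e := hc c.1 c.2 c'.1 c'.2
          apply delt_int' _ _ (hX3 c' hc')
          · rw [← amp_mul, ← amp_mul]; exact congrArg (amp ht₁) (congrArg Prod.fst e)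
          · rw [← amp_mul, ← amp_mul]; exact congrArg (amp ht₂) (congrArg Prod.snd e)
  choose X hXF hXM hXn hXi using step
  obtain ⟨Ti, -, hTi⟩ := exists_ultra_limit (Ultrafilter.of (atTop : Filter (Finset C))) (norm_nonneg T) hXn
  have hle : (Ultrafilter.of (atTop : Filter (Finset C)) : Filter (Finset C)) ≤ atTop := Ultrafilter.of_le _
  have hTU : Ti ∈ wTensor t₁ t₂ univ (U : Set (K₁ →L[ℂ] K₂)) := 
    (wTensor_closed _ _).mem_of_tendsto hTi (Eventually.of_forall fun s => hF _ (hXF s))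
  have hint : ∀ c ∈ C, amp ht₂ c.2 ∘L Ti = Ti ∘L amp ht₁ c.1 := by
    intro c hc
    have q2 := amp_proj ht₂ (hp c hc).2
    ext x
    apply ext_inner_left ℂ
    intro y
    have l1 := tendsto_sw_inner hTi x (amp ht₂ c.2 y)
    have l2 := tendsto_sw_inner hTi (amp ht₁ c.1 x) y
    have hev : ∀ᶠ s in (Ultrafilter.of (atTop : Filter (Finset C)) : Filter (Finset C)), 
      ⟪amp ht₂ c.2 y, X s x⟫ = ⟪y, X s (amp ht₁ c.1 x)⟫ := by
      apply hle
      filter_upwards [eventually_ge_atTop {(⟨c, hc⟩ : C)}] with s hs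
      have := hXi s ⟨c, hc⟩ (hs (Finset.mem_singleton_self _))
      rw [q2.inner_eq]
      exact congrArg (fun f => ⟪y, f x⟫) this
    have := tendsto_nhds_unique (l1.congr' hev) l2
    rw [q2.inner_eq] at this
    exact this
  have hTiM : Ti ∈ MV := hD _ (D_final ht₁ ht₂ hc hp hint U fun h h' => slice_mem ht₁ ht₂ h h' ⟨⟨U, rfl⟩, hU⟩ hTU)
  have hd : T - Ti ∈ MV := by
    have hcl : WkClosed {Y : T₁ →L[ℂ] T₂ | T - Y ∈ MV} := by
      have k1 : WkContinuous (fun Y : T₁ →L[ℂ] T₂ => T - Y) := by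
        have := @Continuous.comp _ _ _ (sigmaWeak T₁ T₂) (sigmaWeak T₁ T₂) (sigmaWeak T₁ T₂) _ _ 
          (wkc_add (H := T₁) (K := T₂) T) (wkc_smul (H := T₁) (K := T₂) (-1))
        convert this using 1
        unfold WkContinuous
        congr! 1
        ext Y x
        simp [Function.comp_def]; abel
      exact @IsClosed.preimage _ _ (sigmaWeak T₁ T₂) (sigmaWeak T₁ T₂) _ k1 _ hMV
    exact hcl.mem_of_tendsto hTi (Eventually.of_forall hXM)
  have := MV.add_mem hd hTiM
  simpa using this

/-- structure of nest bimodules needed. -/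
structure GoodB (D₁ : Set (H₁ →L[ℂ] H₁)) (D₂ : Set (H₂ →L[ℂ] H₂)) (B : Submodule ℂ (H₁ →L[ℂ] H₂)) 
    (C : Set ((H₁ →L[ℂ] H₁) × (H₂ →L[ℂ] H₂))) : Prop where
  closed : WkClosed (B : Set (H₁ →L[ℂ] H₂))
  bim : ∀ X ∈ B, ∀ A ∈ D₁, ∀ A' ∈ D₂, A' ∘L X ∘L A ∈ B
  mem1 : ∀ c ∈ C, c.1 ∈ D₁
  mem2 : ∀ c ∈ C, c.2 ∈ D₂
  proj : ∀ c ∈ C, IsProj c.1 ∧ IsProj c.2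
  a : ∀ X, (∀ c ∈ C, c.2 ∘L X = X ∘L c.1) → X ∈ B
  b : ∀ c ∈ C, ∀ X, c.2 ∘L X ∘L (1 - c.1) ∈ B
  c : ∀ c ∈ C, ∀ X ∈ B, (1 - c.2) ∘L X ∘L c.1 = 0

lemma sup_bim {D₁ : Set (H₁ →L[ℂ] H₁)} {D₂ : Set (H₂ →L[ℂ] H₂)} {M N : Submodule ℂ (H₁ →L[ℂ] H₂)}
    (hM : ∀ X ∈ M, ∀ A ∈ D₁, ∀ B ∈ D₂, B ∘L X ∘L A ∈ M) (hN : ∀ X ∈ N, ∀ A ∈ D₁, ∀ B ∈ D₂, B ∘L X ∘L A ∈ N) :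
    ∀ X ∈ wkSub (M ⊔ N), ∀ A ∈ D₁, ∀ B ∈ D₂, B ∘L X ∘L A ∈ wkSub (M ⊔ N) := by
  intro X hX A hA B hB
  refine wkClosure_map (wkc_comp A B) (wkClosed_wkClosure _) ?_ X hX
  intro Y hY
  apply subset_wkClosure
  obtain ⟨y, hy, z, hz, rfl⟩ := Submodule.mem_sup.1 hY
  have e : B ∘L (y + z) ∘L A = B ∘L y ∘L A + B ∘L z ∘L A := by ext; simp
  rw [e]
  exact Submodule.add_mem_sup (hM y hy A hA B hB) (hN z hz A hA B hB)

lemma sup_map {M N : Submodule ℂ (H₁ →L[ℂ] H₂)} {C : Submodule ℂ (H₁ →L[ℂ] H₂)} 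
    (hC : WkClosed (C : Set (H₁ →L[ℂ] H₂))) {A : H₁ →L[ℂ] H₁} {B : H₂ →L[ℂ] H₂} 
    (hM : ∀ X ∈ M, B ∘L X ∘L A ∈ C) (hN : ∀ X ∈ N, B ∘L X ∘L A ∈ C) :
    ∀ X ∈ wkSub (M ⊔ N), B ∘L X ∘L A ∈ C := by
  intro X hX 
  refine wkClosure_map (wkc_comp A B) hC ?_ X hX
  intro Y hY
  obtain ⟨y, hy, z, hz, rfl⟩ := Submodule.mem_sup.1 hY
  have e : B ∘L (y + z) ∘L A = B ∘L y ∘L A + B ∘L z ∘L A := by ext; simp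
  rw [e]
  exact C.add_mem (hM y hy) (hN z hz)

theorem main_step [TopologicalSpace.SeparableSpace H₁] [TopologicalSpace.SeparableSpace H₂]
    {D₁ : StarSubalgebra ℂ (H₁ →L[ℂ] H₁)} {D₂ : StarSubalgebra ℂ (H₂ →L[ℂ] H₂)}
    (hD₁ : ∀ a ∈ D₁, ∀ b ∈ D₁, a * b = b * a) (hD₂ : ∀ a ∈ D₂, ∀ b ∈ D₂, a * b = b * a)
    (W : Submodule ℂ (H₁ →L[ℂ] H₂)) (hW : WkClosed (W : Set (H₁ →L[ℂ] H₂)))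
    (hWb : ∀ X ∈ W, ∀ A ∈ D₁, ∀ B ∈ D₂, B ∘L X ∘L A ∈ W)
    (hWs : HasSsigma (W : Set (H₁ →L[ℂ] H₂)))
    {ι : Type*} [DecidableEq ι] (B : ι → Submodule ℂ (H₁ →L[ℂ] H₂)) (C : ι → Set ((H₁ →L[ℂ] H₁) × (H₂ →L[ℂ] H₂)))
    (hB : ∀ i, GoodB (D₁ : Set (H₁ →L[ℂ] H₁)) (D₂ : Set (H₂ →L[ℂ] H₂)) (B i) (C i)) (s : Finset ι) :
    HasSsigma (wkSub (W ⊔ ⨅ i ∈ s, B i) : Set (H₁ →L[ℂ] H₂)) := by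
  induction s using Finset.strongInduction with
  | H s ih =>
  intro K₁ K₂ T₁ T₂ _ _ _ _ _ _ _ _ _ _ _ _ t₁ t₂ ht₁ ht₂ U hU
  apply Subset.antisymm
  swap
  · exact fun X hX => ⟨wTensor_mono (le_refl _) (subset_univ _) hX, wTensor_mono (subset_univ _) (le_refl _) hX⟩
  obtain ⟨⟨U, rfl⟩, hUc⟩ := hU
  set V := wkSub (W ⊔ ⨅ i ∈ s, B i) with hV
  have hVc : WkClosed (V : Set (H₁ →L[ℂ] H₂)) := wkClosed_wkClosure _
  have hWV : W ≤ V := le_sup_left.trans (fun X hX => subset_wkClosure _ hX)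
  have hBV : (⨅ i ∈ s, B i) ≤ V := le_sup_right.trans (fun X hX => subset_wkClosure _ hX)
  have hVb : ∀ X ∈ V, ∀ A ∈ D₁, ∀ B ∈ D₂, B ∘L X ∘L A ∈ V := by
    apply sup_bim (D₁ := (D₁ : Set (H₁ →L[ℂ] H₁))) (D₂ := (D₂ : Set (H₂ →L[ℂ] H₂))) hWb
    intro X hX A hA A' hA'
    simp only [Submodule.mem_iInf] at hX ⊢
    exact fun i hi => (hB i).bim X (hX i hi) A hA A' hA'
  intro T hT
  have mC : ∀ c ∈ ⋃ i ∈ s, C i, ∃ i ∈ s, c ∈ C i := by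
    intro c hc; simpa using hc
  refine main_abs (C := ⋃ i ∈ s, C i) ht₁ ht₂ ?_ ?_ U hUc (wTS t₁ t₂ V U) (wTS t₁ t₂ V univ ⊓ wTS t₁ t₂ univ U) 
    (wTensor_closed _ _) (fun X hX => hX.2) ?_ ?_ ?_ (T := T) hT
  · intro c hc c' hc'
    obtain ⟨i, -, hi⟩ := mC c hc
    obtain ⟨i', -, hi'⟩ := mC c' hc'
    exact Prod.ext (hD₁ _ ((hB i).mem1 c hi) _ ((hB i').mem1 c' hi')) (hD₂ _ ((hB i).mem2 c hi) _ ((hB i').mem2 c' hi'))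
  · intro c hc
    obtain ⟨i, -, hi⟩ := mC c hc
    exact (hB i).proj c hi
  · refine fun X hX => wTensor_mono ?_ (le_refl _) hX
    intro Y hY
    apply hBV
    simp only [Submodule.mem_iInf]
    exact fun i hi => (hB i).a Y fun c hc => hY c (by simp only [mem_iUnion]; exact ⟨i, hi, hc⟩)
  · intro X hX c hc
    obtain ⟨i, -, hi⟩ := mC c hc
    have m1 : c.1 ∈ D₁ := (hB i).mem1 c hi
    have m2 : c.2 ∈ D₂ := (hB i).mem2 c hi
    have n1 : 1 - c.1 ∈ D₁ := D₁.sub_mem D₁.one_mem m1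
    have n2 : 1 - c.2 ∈ D₂ := D₂.sub_mem D₂.one_mem m2
    rw [delt, ← amp_one ht₁, ← amp_one ht₂, ← amp_sub, ← amp_sub]
    refine Submodule.add_mem _ ⟨?_, ?_⟩ ⟨?_, ?_⟩
    · exact wTensor_sandwich ht₁ ht₂ (fun S hS => hVb S hS _ m1 _ m2) hX.1
    · exact wTensor_sandwich ht₁ ht₂ (V' := univ) (fun S hS => mem_univ _) hX.2
    · exact wTensor_sandwich ht₁ ht₂ (fun S hS => hVb S hS _ n1 _ n2) hX.1
    · exact wTensor_sandwich ht₁ ht₂ (V' := univ) (fun S hS => mem_univ _) hX.2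
  · intro X hX c hc
    obtain ⟨j, hj, hcj⟩ := mC c hc
    have m1 : c.1 ∈ D₁ := (hB j).mem1 c hcj
    have m2 : c.2 ∈ D₂ := (hB j).mem2 c hcj
    have n1 : 1 - c.1 ∈ D₁ := D₁.sub_mem D₁.one_mem m1
    have n2 : 1 - c.2 ∈ D₂ := D₂.sub_mem D₂.one_mem m2
    rw [delt_sub, ← amp_one ht₁, ← amp_one ht₂, ← amp_sub, ← amp_sub]
    refine Submodule.add_mem _ ?_ ?_
    · have hle : V ≤ wkSub (W ⊔ ⨅ i ∈ s.erase j, B i) := by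
        apply wkClosure_mono
        refine SetLike.coe_subset_coe.2 (sup_le_sup_left ?_ W)
        apply le_iInf₂
        intro i hi
        exact iInf₂_le i (Finset.mem_of_mem_erase hi)
      have hX' : X ∈ wTensor t₁ t₂ (wkSub (W ⊔ ⨅ i ∈ s.erase j, B i) : Set (H₁ →L[ℂ] H₂)) U := by
        rw [← ih _ (Finset.erase_ssubset hj) K₁ K₂ T₁ T₂ t₁ t₂ ht₁ ht₂ U ⟨⟨U, rfl⟩, hUc⟩]
        exact ⟨wTensor_mono hle (le_refl _) hX.1, hX.2⟩
      refine wTensor_sandwich ht₁ ht₂ ?_ hX'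
      apply sup_map hVc
      · exact fun Y hY => hWV (hWb Y hY _ n1 _ m2)
      · intro Y hY
        apply hBV
        simp only [Submodule.mem_iInf] at hY ⊢
        intro i hi
        by_cases hij : i = j
        · subst hij; exact (hB i).b c hcj Y
        · exact (hB i).bim Y (hY i (Finset.mem_erase.2 ⟨hij, hi⟩)) _ n1 _ m2
    · refine wTensor_mono hWV (le_refl _) ?_
      rw [← hWs K₁ K₂ T₁ T₂ t₁ t₂ ht₁ ht₂ U ⟨⟨U, rfl⟩, hUc⟩]
      refine ⟨wTensor_sandwich ht₁ ht₂ ?_ hX.1, wTensor_sandwich ht₁ ht₂ (V' := univ) (fun S hS => mem_univ _) hX.2⟩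
      apply sup_map hW
      · exact fun Y hY => hWb Y hY _ m1 _ n2
      · intro Y hY
        simp only [Submodule.mem_iInf] at hY
        rw [(hB j).c c hcj Y (hY j hj)]
        exact W.zero_mem

end MainStep
end OpSynth

namespace OpSynth
set_option linter.all false
section Brown
open Filter Topology ContinuousLinearMap

def chi (s : ℝ) : MeasureTheory.Lp ℂ 2 (MeasureTheory.volume : MeasureTheory.Measure ℝ) :=
  MeasureTheory.indicatorConstLp 2 (s := Ioc 0 s) measurableSet_Ioc (by simp) 1

lemma chi_inner {s t : ℝ} (hs : 0 ≤ s) (ht : 0 ≤ t) : ⟪chi s, chi t⟫ = ((min s t : ℝ) : ℂ) := by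
  unfold chi
  rw [MeasureTheory.L2.inner_indicatorConstLp_one_indicatorConstLp_one _ _ (by simp) (by simp)]
  simp [Ioc_inter_Ioc, MeasureTheory.Measure.real]
  rw [← ENNReal.ofReal_min, ENNReal.toReal_ofReal (le_min hs ht)]

lemma riem (u t : ℝ) (hu : 0 ≤ u) (ht : 0 ≤ t) : 
    Tendsto (fun k : ℕ => (k : ℝ) * ∑ j ∈ Finset.range (k ^ 2), 
      (min (((j + 1 : ℕ) : ℝ) / k) u - min ((j : ℝ) / k) u) * (min (((j + 2 : ℕ) : ℝ) / k) t - min (((j + 1 : ℕ) : ℝ) / k) t)) 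
      atTop (𝓝 (min u t)) := by
  set m := min u t with hm
  have hm0 : 0 ≤ m := le_min hu ht
  have low : Tendsto (fun k : ℕ => m - 1 / (k : ℝ)) atTop (𝓝 m) := by
    simpa using (tendsto_one_div_atTop_nhds_zero_nat (𝕜 := ℝ)).const_sub m
  refine tendsto_of_tendsto_of_tendsto_of_le_of_le' low tendsto_const_nhds ?_ ?_
  · filter_upwards [eventually_ge_atTop 1, eventually_ge_atTop ⌈m⌉₊] with k hk hkm
    have hk0 : (0 : ℝ) < k := by exact_mod_cast hk
    have hkm' : m ≤ k := (Nat.le_ceil m).trans (by exact_mod_cast hkm)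
    have tele := Finset.sum_range_sub (fun j : ℕ => min (((j + 1 : ℕ) : ℝ) / k) m) (k ^ 2)
    have e1 : min (((k ^ 2 + 1 : ℕ) : ℝ) / k) m = m := by
      apply min_eq_right
      rw [le_div_iff₀ hk0]; push_cast; nlinarith
    have e2 : min (((0 + 1 : ℕ) : ℝ) / k) m ≤ 1 / k := by simpa using min_le_left _ _
    calc m - 1 / k ≤ ∑ j ∈ Finset.range (k ^ 2), (min (((j + 1 + 1 : ℕ) : ℝ) / k) m - min (((j + 1 : ℕ) : ℝ) / k) m) := by
          rw [tele, e1]; linarith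
      _ ≤ _ := by
        rw [Finset.mul_sum]
        apply Finset.sum_le_sum
        intro j _
        have i1 : ((j + 1 : ℕ) : ℝ) / k = (j : ℝ) / k + 1 / k := by push_cast; ring
        have i2 : ((j + 2 : ℕ) : ℝ) / k = (j : ℝ) / k + 1 / k + 1 / k := by push_cast; ring
        have i3 : ((j + 1 + 1 : ℕ) : ℝ) / k = (j : ℝ) / k + 1 / k + 1 / k := by push_cast; ring
        have i0 : 0 < 1 / (k : ℝ) := by positivity
        have i4 : (k : ℝ) * (1 / k) = 1 := by field_simp
        rw [i1, i2]
        generalize (j : ℝ) / k = x at *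
        generalize 1 / (k : ℝ) = d at *
        have mu : m ≤ u := min_le_left _ _
        have mt : m ≤ t := min_le_right _ _
        by_cases hc : x + d ≤ m
        · have : min (x + d) u - min x u = d := by
            rw [min_eq_left (by linarith), min_eq_left (by linarith)]; ring
          rw [this, ← mul_assoc, i4, one_mul]
          rw [min_eq_left hc, min_eq_left (hc.trans mt)]
          gcongr
        · rw [min_eq_right (by linarith), min_eq_right (by linarith : m ≤ x + d), sub_self]
          have q1 : 0 ≤ min (x + d) u - min x u := sub_nonneg.2 (min_le_min_right _ (by linarith))
          have q2 : 0 ≤ min (x + d + d) t - min (x + d) t := sub_nonneg.2 (min_le_min_right _ (by linarith))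
          positivity
  · filter_upwards [eventually_ge_atTop 1] with k hk 
    have hk0 : (0 : ℝ) < k := by exact_mod_cast hk
    have tel1 := Finset.sum_range_sub (fun j : ℕ => min (((j : ℕ) : ℝ) / k) u) (k ^ 2)
    have tel2 := Finset.sum_range_sub (fun j : ℕ => min (((j + 1 : ℕ) : ℝ) / k) t) (k ^ 2)
    have key : ∀ x v : ℝ, 0 ≤ min (x + 1 / k) v - min x v ∧ k * (min (x + 1 / k) v - min x v) ≤ 1 := by
      intro x v
      have i0 : 0 < 1 / (k : ℝ) := by positivity
      have i4 : (k : ℝ) * (1 / k) = 1 := by field_simp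
      refine ⟨sub_nonneg.2 (min_le_min_right _ (by linarith)), ?_⟩
      refine le_trans (mul_le_mul_of_nonneg_left ?_ hk0.le) i4.le
      have : min (x + 1 / k) v ≤ min x v + 1 / k := by
        rcases min_cases x v with h | h <;> rw [h.1]
        · exact min_le_left _ _
        · exact (min_le_right _ _).trans (by linarith)
      linarith
    have i1 : ∀ j : ℕ, ((j + 1 : ℕ) : ℝ) / k = (j : ℝ) / k + 1 / k := by intro j; push_cast; ring
    have i2 : ∀ j : ℕ, ((j + 2 : ℕ) : ℝ) / k = ((j + 1 : ℕ) : ℝ) / k + 1 / k := by intro j; push_cast; ring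
    refine le_min ?_ ?_
    · calc _ ≤ ∑ j ∈ Finset.range (k ^ 2), (min (((j + 1 : ℕ) : ℝ) / k) u - min (((j : ℕ) : ℝ) / k) u) := by
            rw [Finset.mul_sum]
            apply Finset.sum_le_sum
            intro j _
            obtain ⟨a1, a2⟩ := key (j / k) u
            obtain ⟨b1, b2⟩ := key ((j + 1 : ℕ) / k) t
            rw [i2, i1] at *
            nlinarith
        _ ≤ u := by
          rw [tel1]
          have : 0 ≤ min (((0 : ℕ) : ℝ) / k) u := by simp [hu]
          have := min_le_right (((k ^ 2 : ℕ) : ℝ) / k) u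
          linarith
    · calc _ ≤ ∑ j ∈ Finset.range (k ^ 2), (min (((j + 1 + 1 : ℕ) : ℝ) / k) t - min (((j + 1 : ℕ) : ℝ) / k) t) := by
            rw [Finset.mul_sum]
            apply Finset.sum_le_sum
            intro j _
            obtain ⟨a1, a2⟩ := key (j / k) u
            obtain ⟨b1, b2⟩ := key ((j + 1 : ℕ) / k) t
            have i3 : ((j + 1 + 1 : ℕ) : ℝ) / k = ((j + 1 : ℕ) : ℝ) / k + 1 / k := i2 j
            rw [i2, i1] at *
            nlinarith
        _ ≤ t := by
          rw [tel2]
          have : 0 ≤ min (((0 + 1 : ℕ) : ℝ) / k) t := le_min (by positivity) ht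
          have := min_le_right (((k ^ 2 + 1 : ℕ) : ℝ) / k) t
          linarith

end Brown
end OpSynth

namespace OpSynth
set_option linter.all false
section Erdos
open Filter Topology ContinuousLinearMap
variable {H F : Type*} [NormedAddCommGroup H] [InnerProductSpace ℂ H] [CompleteSpace H]
  [NormedAddCommGroup F] [InnerProductSpace ℂ F] [CompleteSpace F]

lemma sup_orth_dense (L : Submodule ℂ H) : (L ⊔ Lᗮ).topologicalClosure = ⊤ := by
  rw [Submodule.topologicalClosure_eq_top_iff, ← Submodule.inf_orthogonal, Submodule.inf_orthogonal_eq_bot]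

lemma total_orth (S : Set H) : (Submodule.span ℂ (S ∪ ((Submodule.span ℂ S)ᗮ : Set H))).topologicalClosure = ⊤ := by
  rw [Submodule.span_union, Submodule.span_eq]
  exact sup_orth_dense _

lemma exists_gram_map {ι : Type*} (x : ι → H) (y : ι → F) (h : ∀ i j, ⟪x i, x j⟫ = ⟪y i, y j⟫) :
    ∃ W : H →L[ℂ] F, ‖W‖ ≤ 1 ∧ (∀ i, W (x i) = y i) ∧ ∀ v ∈ (Submodule.span ℂ (range x))ᗮ, W v = 0 := by
  set L := Submodule.span ℂ (range x) with hL
  let f : ((ι →₀ ℂ) × Lᗮ) →ₗ[ℂ] F := (Finsupp.linearCombination ℂ y) ∘ₗ LinearMap.fst ℂ _ _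
  let e : ((ι →₀ ℂ) × Lᗮ) →ₗ[ℂ] H := (Finsupp.linearCombination ℂ x).coprod Lᗮ.subtype
  have hd : DenseRange e := by
    have h1 : LinearMap.range e = L ⊔ Lᗮ := by
      rw [LinearMap.range_coprod, Finsupp.range_linearCombination, Submodule.range_subtype]
    have := sup_orth_dense L
    rw [← h1, ← Submodule.dense_iff_topologicalClosure_eq_top] at this
    exact this
  have hn : ∀ c, ‖Finsupp.linearCombination ℂ y c‖ = ‖Finsupp.linearCombination ℂ x c‖ := by
    intro c
    have : ⟪Finsupp.linearCombination ℂ y c, Finsupp.linearCombination ℂ y c⟫ = 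
      ⟪Finsupp.linearCombination ℂ x c, Finsupp.linearCombination ℂ x c⟫ := by
      simp only [Finsupp.linearCombination_apply, Finsupp.sum, sum_inner, inner_sum, h, inner_smul_left, inner_smul_right]
    rw [@norm_eq_sqrt_re_inner ℂ, @norm_eq_sqrt_re_inner ℂ, this]
  have hb : ∀ z, ‖f z‖ ≤ 1 * ‖e z‖ := by
    rintro ⟨c, v⟩
    have h1 : ⟪Finsupp.linearCombination ℂ x c, (v : H)⟫ = 0 := by
      apply (Submodule.mem_orthogonal _ _).1 v.2
      rw [hL, ← Finsupp.range_linearCombination]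
      exact ⟨c, rfl⟩
    have h2 := norm_add_sq_eq_norm_sq_add_norm_sq_of_inner_eq_zero _ _ h1
    rw [one_mul]
    apply le_of_sq_le_sq _ (norm_nonneg _)
    simp only [f, e, LinearMap.comp_apply, LinearMap.fst_apply, LinearMap.coprod_apply, hn, Submodule.subtype_apply]
    nlinarith [norm_nonneg (v : H)]
  refine ⟨f.extendOfNorm e, LinearMap.opNorm_extendOfNorm_le hd zero_le_one hb, ?_, ?_⟩
  · intro i
    have := LinearMap.extendOfNorm_eq hd ⟨_, hb⟩ (Finsupp.single i 1, 0)
    simpa [f, e] using this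
  · intro v hv
    have := LinearMap.extendOfNorm_eq hd ⟨_, hb⟩ (0, ⟨v, hv⟩)
    simpa [f, e] using this

/-- projection onto the closure -/
def pr (L : Submodule ℂ H) : H →L[ℂ] H := L.topologicalClosure.starProjection

lemma pr_proj (L : Submodule ℂ H) : IsProj (pr L) := starProj_isProj _

lemma pr_mem {L : Submodule ℂ H} (hL : IsClosed (L : Set H)) (x : H) : pr L x ∈ L := by
  have := L.topologicalClosure.starProjection_apply_mem x
  exact hL.submodule_topologicalClosure_eq.le this

lemma pr_self {L : Submodule ℂ H} {x : H} (hx : x ∈ L) : pr L x = x :=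
  Submodule.starProjection_eq_self_iff.2 (L.le_topologicalClosure hx)

lemma mem_of_pr {L : Submodule ℂ H} (hL : IsClosed (L : Set H)) {x : H} (h : pr L x = x) : x ∈ L := h ▸ pr_mem hL x

lemma pr_zero {L : Submodule ℂ H} {x : H} (h : pr L x = 0) {m : H} (hm : m ∈ L) : ⟪m, x⟫ = 0 := by
  rw [← pr_self hm, (pr_proj L).inner_eq, h, inner_zero_right]

lemma pr_le {L M : Submodule ℂ H} (hL : IsClosed (L : Set H)) (h : L ≤ M) (x : H) : pr M (pr L x) = pr L x :=
  pr_self (h (pr_mem hL x))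

lemma pr_le' {L M : Submodule ℂ H} (hL : IsClosed (L : Set H)) (h : L ≤ M) (x : H) : pr L (pr M x) = pr L x := by
  apply ext_inner_left ℂ
  intro y
  rw [← (pr_proj L).inner_eq, ← (pr_proj M).inner_eq, pr_le hL h, (pr_proj L).inner_eq]

lemma pr_gram_aux {L M : Submodule ℂ H} (hL : IsClosed (L : Set H)) (h : L ≤ M) (ξ : H) :
    ‖pr L ξ‖ ^ 2 ≤ ‖pr M ξ‖ ^ 2 ∧ ⟪pr L ξ, pr M ξ⟫ = ((‖pr L ξ‖ ^ 2 : ℝ) : ℂ) := by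
  constructor
  · gcongr
    rw [← pr_le' hL h]
    simpa using le_of_opNorm_le _ (pr_proj L).norm_le (pr M ξ)
  · conv_lhs => rw [← (pr_proj L).idem ξ]
    rw [(pr_proj L).inner_eq, pr_le' hL h, inner_self_eq_norm_sq_to_K]
    push_cast; rfl

/-- rank one operators -/
def rk (b a : H) : H →L[ℂ] H := (innerSL ℂ a).smulRight b
lemma rk_apply (b a x : H) : rk b a x = ⟪a, x⟫ • b := rfl

/-- elementary rank ones associated with a nest -/
def nestG (N : Set (Submodule ℂ H)) : Set (H →L[ℂ] H) :=
  {X | ∃ L ∈ N, ∃ b ∈ L, ∃ a, (∀ M ∈ N, L ≤ M ∨ ∀ m ∈ M, ⟪m, a⟫ = 0) ∧ X = rk b a}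

lemma nest_gram {N : Set (Submodule ℂ H)} (hN : IsNest N) (ξ : H) {L M : Submodule ℂ H} (hL : L ∈ N) (hM : M ∈ N) :
    ⟪pr L ξ, pr M ξ⟫ = ((min (‖pr L ξ‖ ^ 2) (‖pr M ξ‖ ^ 2) : ℝ) : ℂ) := by
  rcases hN.2.1.total hL hM with h | h
  · obtain ⟨h1, h2⟩ := pr_gram_aux (hN.1 L hL) h ξ
    rw [min_eq_left h1, h2]
  · obtain ⟨h1, h2⟩ := pr_gram_aux (hN.1 M hM) h ξ
    rw [min_eq_right h1, ← inner_conj_symm, h2, Complex.conj_ofReal]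

lemma nest_comp {N : Set (Submodule ℂ H)} (hN : IsNest N) (ξ : H) {L M : Submodule ℂ H} (hL : L ∈ N) (hM : M ∈ N) :
    ∃ R ∈ N, ‖pr R ξ‖ ^ 2 = min (‖pr L ξ‖ ^ 2) (‖pr M ξ‖ ^ 2) ∧ pr L (pr M ξ) = pr R ξ := by
  rcases hN.2.1.total hL hM with h | h
  · obtain ⟨h1, h2⟩ := pr_gram_aux (hN.1 L hL) h ξ
    exact ⟨L, hL, by rw [min_eq_left h1], pr_le' (hN.1 L hL) h ξ⟩
  · obtain ⟨h1, h2⟩ := pr_gram_aux (hN.1 M hM) h ξ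
    exact ⟨M, hM, by rw [min_eq_right h1], pr_le (hN.1 M hM) h ξ⟩

lemma chi_orth {k : ℕ} (hk : 1 ≤ k) : Orthonormal ℂ (fun j : ℕ => ((Real.sqrt k : ℝ) : ℂ) • (chi (((j + 1 : ℕ) : ℝ) / k) - chi ((j : ℝ) / k))) := by
  have hk0 : (0 : ℝ) < k := by exact_mod_cast hk
  have p : ∀ j : ℕ, 0 ≤ (j : ℝ) / k := fun j => by positivity
  have key : ∀ i j : ℕ, ⟪chi (((i + 1 : ℕ) : ℝ) / k) - chi ((i : ℝ) / k), chi (((j + 1 : ℕ) : ℝ) / k) - chi ((j : ℝ) / k)⟫ 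
      = (((if i = j then 1 / k else 0) : ℝ) : ℂ) := by
    intro i j
    rw [inner_sub_left, inner_sub_right, inner_sub_right, chi_inner (p _) (p _), chi_inner (p _) (p _), chi_inner (p _) (p _), chi_inner (p _) (p _)]
    norm_cast
    have hd : ∀ {a b : ℕ}, a ≤ b → (a : ℝ) / k ≤ (b : ℝ) / k := fun {a b} h => by gcongr
    rcases lt_trichotomy i j with h | h | h
    · rw [min_eq_left (hd (by omega)), min_eq_left (hd (by omega)), min_eq_left (hd (by omega)), min_eq_left (hd (by omega)), if_neg (by omega)]
      ring
    · subst h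
      rw [min_eq_left (hd (by omega)), min_eq_right (hd (by omega)), min_eq_left (hd (by omega)), min_eq_left (hd (by omega)), if_pos rfl]
      push_cast; ring
    · rw [min_eq_right (hd (by omega)), min_eq_right (hd (by omega)), min_eq_right (hd (by omega)), min_eq_right (hd (by omega)), if_neg (by omega)]
      ring
  rw [orthonormal_iff_ite]
  intro i j
  rw [inner_smul_left, inner_smul_right, key]
  split_ifs with h
  · rw [Complex.conj_ofReal, ← mul_assoc, ← Complex.ofReal_mul, Real.mul_self_sqrt hk0.le]
    have hkc : (k : ℂ) ≠ 0 := by exact_mod_cast hk0.ne.symm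
    push_cast
    field_simp
  · simp

end Erdos
end OpSynth

namespace OpSynth
set_option linter.all false
section Erdos
open Filter Topology ContinuousLinearMap
variable {H F : Type*} [NormedAddCommGroup H] [InnerProductSpace ℂ H] [CompleteSpace H]
  [NormedAddCommGroup F] [InnerProductSpace ℂ F] [CompleteSpace F]

lemma shift_norm {v : ℕ → F} (hv : Orthonormal ℂ v) (W : H →L[ℂ] F) (hW : ‖W‖ ≤ 1) (n : ℕ) (x : H) :
    ‖∑ j ∈ Finset.range n, ⟪v (j + 1), W x⟫ • adjoint W (v j)‖ ≤ ‖x‖ := by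
  have h1 : ∑ j ∈ Finset.range n, ⟪v (j + 1), W x⟫ • adjoint W (v j) = adjoint W (∑ j ∈ Finset.range n, ⟪v (j + 1), W x⟫ • v j) := by
    simp
  have h2 : ‖∑ j ∈ Finset.range n, ⟪v (j + 1), W x⟫ • v j‖ ^ 2 ≤ ‖W x‖ ^ 2 := by
    have := hv.inner_sum (fun j => ⟪v (j + 1), W x⟫) (fun j => ⟪v (j + 1), W x⟫) (Finset.range n)
    rw [inner_self_eq_norm_sq_to_K] at this
    have e : ‖∑ j ∈ Finset.range n, ⟪v (j + 1), W x⟫ • v j‖ ^ 2 = ∑ j ∈ Finset.range n, ‖⟪v (j + 1), W x⟫‖ ^ 2 := by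
      have h3 : ∀ z : ℂ, (starRingEnd ℂ) z * z = ((‖z‖ ^ 2 : ℝ) : ℂ) := fun z => by
        rw [mul_comm, Complex.mul_conj, Complex.normSq_eq_norm_sq]
      simp only [h3] at this
      refine Complex.ofReal_injective ?_
      rw [Complex.ofReal_sum, ← this]
      push_cast; rfl
    rw [e]
    exact (hv.comp (fun j => j + 1) (fun a b h => by simpa using h)).sum_inner_products_le (W x)
  have h3 : ‖∑ j ∈ Finset.range n, ⟪v (j + 1), W x⟫ • v j‖ ≤ ‖W x‖ := le_of_sq_le_sq h2 (norm_nonneg _)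
  have h4 : ‖W x‖ ≤ ‖x‖ := by simpa using le_of_opNorm_le _ hW x
  have h5 : ‖adjoint W‖ ≤ 1 := by rwa [LinearIsometryEquiv.norm_map]
  rw [h1]
  have h6 := le_of_opNorm_le _ h5 (∑ j ∈ Finset.range n, ⟪v (j + 1), W x⟫ • v j)
  rw [one_mul] at h6
  exact h6.trans (h3.trans h4)

def nAlg (N : Set (Submodule ℂ H)) : Subalgebra ℂ (H →L[ℂ] H) := Algebra.adjoin ℂ (pr '' N)

lemma nAlg_star (N : Set (Submodule ℂ H)) (hN : IsNest N) : ∀ a ∈ nAlg N, adjoint a ∈ nAlg N := by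
  apply adjoin_star
  rintro _ ⟨L, -, rfl⟩
  exact (pr_proj L).2

lemma nest_top {N : Set (Submodule ℂ H)} (hN : IsNest N) : ⊤ ∈ N := by
  simpa using (hN.2.2 ∅ (empty_subset _)).1

lemma nAlg_apply {N : Set (Submodule ℂ H)} (hN : IsNest N) (ξ : H) {a : H →L[ℂ] H} (ha : a ∈ nAlg N) :
    a ξ ∈ Submodule.span ℂ (range fun L : N => pr L.1 ξ) := by
  have hmul : ∀ η, ∀ a ∈ nAlg N, η ∈ Submodule.span ℂ (range fun L : N => pr L.1 ξ) → a η ∈ Submodule.span ℂ (range fun L : N => pr L.1 ξ) := by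
    intro η a ha
    induction ha using Algebra.adjoin_induction generalizing η with
    | mem x hx => 
      obtain ⟨M, hM, rfl⟩ := hx
      intro h
      induction h using Submodule.span_induction with
      | mem x hx => 
        obtain ⟨L, rfl⟩ := hx
        obtain ⟨R, hR, -, e⟩ := nest_comp hN ξ hM L.2
        simp only
        rw [e]
        exact Submodule.subset_span ⟨⟨R, hR⟩, rfl⟩
      | zero => rw [map_zero]; exact Submodule.zero_mem _
      | add x y _ _ h1 h2 => rw [map_add]; exact Submodule.add_mem _ h1 h2
      | smul c x _ h1 => rw [map_smul]; exact Submodule.smul_mem _ _ h1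
    | algebraMap r => 
      intro h
      rw [Algebra.algebraMap_eq_smul_one]
      exact Submodule.smul_mem _ _ h
    | add x y _ _ h1 h2 => exact fun h => Submodule.add_mem _ (h1 η h) (h2 η h)
    | mul x y _ _ h1 h2 => exact fun h => h1 _ (h2 η h)
  apply hmul ξ a ha
  exact Submodule.subset_span ⟨⟨⊤, nest_top hN⟩, pr_self trivial⟩

lemma cycP_mem {N : Set (Submodule ℂ H)} (hN : IsNest N) (ξ : H) : 
    cycP (nAlg N) ξ ∈ wkClosure (Submodule.span ℂ (nestG N) : Set (H →L[ℂ] H)) := by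
  set x : N → H := fun L => pr L.1 ξ with hx
  set g : N → ℝ := fun L => ‖pr L.1 ξ‖ ^ 2 with hg
  have g0 : ∀ L, 0 ≤ g L := fun L => by positivity
  obtain ⟨W, hW1, hWx, hW0⟩ := exists_gram_map x (fun L => chi (g L)) (by
    intro L M
    rw [chi_inner (g0 _) (g0 _)]
    exact nest_gram hN ξ L.2 M.2)
  set S := range x with hS
  have tot := total_orth S
  have prS : ∀ M ∈ N, ∀ v ∈ (Submodule.span ℂ S)ᗮ, pr M v ∈ (Submodule.span ℂ S)ᗮ := by
    intro M hM v hv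
    rw [Submodule.mem_orthogonal]
    intro u hu
    rw [← (pr_proj M).inner_eq]
    apply (Submodule.mem_orthogonal _ _).1 hv
    induction hu using Submodule.span_induction with
    | mem x hx => 
      obtain ⟨L, rfl⟩ := hx
      obtain ⟨R, hR, -, e⟩ := nest_comp hN ξ hM L.2
      simp only [hx]
      rw [e]
      exact Submodule.subset_span ⟨⟨R, hR⟩, rfl⟩
    | zero => rw [map_zero]; exact Submodule.zero_mem _
    | add x y _ _ h1 h2 => rw [map_add]; exact Submodule.add_mem _ h1 h2
    | smul c x _ h1 => rw [map_smul]; exact Submodule.smul_mem _ _ h1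
  set b : ℝ → H := fun s => adjoint W (chi s) with hb
  have bx : ∀ s, 0 ≤ s → ∀ L, ⟪b s, x L⟫ = ((min s (g L) : ℝ) : ℂ) := by
    intro s hs L
    rw [hb, adjoint_inner_left, hWx, chi_inner hs (g0 L)]
  have b0 : ∀ s, ∀ v ∈ (Submodule.span ℂ S)ᗮ, ⟪b s, v⟫ = 0 := by
    intro s v hv
    rw [hb, adjoint_inner_left, hW0 v hv, inner_zero_right]
  have bext : ∀ {y z : H}, (∀ v ∈ S ∪ ((Submodule.span ℂ S)ᗮ : Set H), ⟪y, v⟫ = ⟪z, v⟫) → y = z := by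
    intro y z h
    have : innerSL ℂ y = innerSL ℂ z := by
      apply ContinuousLinearMap.ext_on (s := S ∪ ((Submodule.span ℂ S)ᗮ : Set H))
      · exact Submodule.dense_iff_topologicalClosure_eq_top.2 tot
      · intro v hv; exact h v hv
    apply ext_inner_right ℂ
    intro v
    exact congrArg (fun f => f v) this
  have bM : ∀ M : N, ∀ s, 0 ≤ s → s ≤ g M → b s ∈ M.1 := by
    intro M s hs hsM
    apply mem_of_pr (hN.1 M.1 M.2)
    apply bext
    rintro v (⟨L, rfl⟩ | hv)
    · obtain ⟨R, hR, e1, e⟩ := nest_comp hN ξ M.2 L.2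
      rw [(pr_proj M.1).inner_eq, bx s hs]
      simp only [hx]
      rw [e, bx s hs ⟨R, hR⟩]
      congr 1
      change min s (‖pr R ξ‖ ^ 2) = _
      rw [e1]
      change min s (min (g M) (g L)) = _
      rw [← min_assoc, min_eq_left hsM]
    · rw [(pr_proj M.1).inner_eq, b0 _ _ hv, b0 _ _ (prS M.1 M.2 v hv)]
  have bO : ∀ M : N, ∀ s s', 0 ≤ s → s ≤ s' → g M ≤ s → ∀ m ∈ M.1, ⟪m, b s' - b s⟫ = 0 := by
    intro M s s' hs hss hM m hm
    apply pr_zero _ hm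
    rw [map_sub, sub_eq_zero]
    apply bext
    rintro v (⟨L, rfl⟩ | hv)
    · obtain ⟨R, hR, e1, e⟩ := nest_comp hN ξ M.2 L.2
      rw [(pr_proj M.1).inner_eq, (pr_proj M.1).inner_eq]
      simp only [hx]
      rw [e, bx s hs ⟨R, hR⟩, bx s' (hs.trans hss) ⟨R, hR⟩]
      have : g ⟨R, hR⟩ ≤ g M := by change ‖pr R ξ‖ ^ 2 ≤ _; rw [e1]; exact min_le_left _ _
      rw [min_eq_right (by linarith), min_eq_right (by linarith)]
    · rw [(pr_proj M.1).inner_eq, (pr_proj M.1).inner_eq, b0 _ _ (prS M.1 M.2 v hv), b0 _ _ (prS M.1 M.2 v hv)]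
  let Fk : ℕ → H →L[ℂ] H := fun k => ((k : ℝ) : ℂ) • ∑ j ∈ Finset.range (k ^ 2), 
    rk (b (((j + 1 : ℕ) : ℝ) / k) - b ((j : ℝ) / k)) (b (((j + 2 : ℕ) : ℝ) / k) - b (((j + 1 : ℕ) : ℝ) / k))
  have Fmem : ∀ k, Fk k ∈ Submodule.span ℂ (nestG N) := by
    intro k
    refine Submodule.smul_mem _ _ (Submodule.sum_mem _ fun j _ => Submodule.subset_span ?_)
    set s : ℝ := ((j + 1 : ℕ) : ℝ) / k with hs
    have s0 : 0 ≤ s := by positivity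
    have i1 : (j : ℝ) / k ≤ s := by rw [hs]; gcongr; simp
    have i2 : s ≤ ((j + 2 : ℕ) : ℝ) / k := by rw [hs]; gcongr; simp
    refine ⟨sInf {L | ∃ h : L ∈ N, s ≤ g ⟨L, h⟩}, (hN.2.2 _ (fun L hL => hL.1)).1, _, ?_, _, ?_, rfl⟩
    · rw [Submodule.mem_sInf]
      rintro L ⟨hL, hL'⟩
      exact L.sub_mem (bM ⟨L, hL⟩ _ s0 hL') (bM ⟨L, hL⟩ _ (by positivity) (i1.trans hL'))
    · intro M hM
      by_cases hc : s ≤ g ⟨M, hM⟩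
      · exact Or.inl (sInf_le ⟨hM, hc⟩)
      · exact Or.inr (bO ⟨M, hM⟩ s _ s0 i2 (not_le.1 hc).le)
  have Fapp : ∀ k y, Fk k y = ((k : ℝ) : ℂ) • ∑ j ∈ Finset.range (k ^ 2), 
    ⟪b (((j + 2 : ℕ) : ℝ) / k) - b (((j + 1 : ℕ) : ℝ) / k), y⟫ • (b (((j + 1 : ℕ) : ℝ) / k) - b ((j : ℝ) / k)) := by
    intro k y
    simp [Fk, sum_apply, rk_apply]
  have Fnorm : ∀ k, ‖Fk k‖ ≤ 1 := by
    intro k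
    refine opNorm_le_bound _ zero_le_one fun y => ?_
    rcases Nat.eq_zero_or_pos k with h | h
    · subst h; simp [Fk]
    · have := shift_norm (chi_orth h) W hW1 (k ^ 2) y
      rw [one_mul]
      refine le_of_eq_of_le ?_ this
      rw [Fapp, Finset.smul_sum]
      congr 1
      refine Finset.sum_congr rfl fun j _ => ?_
      have hk0 : (0 : ℝ) ≤ k := by positivity
      have e : ((k : ℝ) : ℂ) = ((Real.sqrt k : ℝ) : ℂ) * ((Real.sqrt k : ℝ) : ℂ) := by
        rw [← Complex.ofReal_mul, Real.mul_self_sqrt hk0]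
      rw [map_smul, map_sub, inner_smul_left, Complex.conj_ofReal, inner_sub_left, inner_sub_left, ← adjoint_inner_left, ← adjoint_inner_left, smul_smul, smul_smul, e]
      congr 1
      rw [mul_assoc, mul_assoc]
      congr 1
      rw [mul_comm]
  have clim : Tendsto Fk atTop (@nhds _ (sigmaWeak H H) (cycP (nAlg N) ξ)) := by
    have c1 : ∀ L, cycP (nAlg N) ξ (x L) = x L := fun L => 
      Submodule.starProjection_eq_self_iff.2 (mem_cyc (show pr L.1 ∈ nAlg N from Algebra.subset_adjoin ⟨L.1, L.2, rfl⟩) ξ)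
    have c0 : ∀ v ∈ (Submodule.span ℂ S)ᗮ, cycP (nAlg N) ξ v = 0 := by
      intro v hv
      apply (Submodule.starProjection_apply_eq_zero_iff _).2
      rw [mem_orth_cyc]
      intro a ha
      exact (Submodule.mem_orthogonal _ _).1 hv _ (nAlg_apply hN ξ ha)
    refine tendsto_sw_of_bdd Fnorm tot tot ?_
    rintro y (⟨L, rfl⟩ | hy) z hz
    · rcases hz with ⟨M, rfl⟩ | hz
      · rw [c1]
        have l1 := riem (g M) (g L) (g0 _) (g0 _)
        have e1 : ⟪x M, x L⟫ = ((min (g M) (g L) : ℝ) : ℂ) := nest_gram hN ξ M.2 L.2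
        rw [e1]
        refine ((Complex.continuous_ofReal.tendsto _).comp l1).congr fun k => ?_
        have hp : ∀ j : ℕ, 0 ≤ (j : ℝ) / k := fun j => by positivity
        have bx' : ∀ s, 0 ≤ s → ∀ L, ⟪x L, b s⟫ = ((min s (g L) : ℝ) : ℂ) := by
          intro s hs L
          rw [← inner_conj_symm, bx s hs, Complex.conj_ofReal]
        rw [Fapp, inner_smul_right, inner_sum]
        simp only [inner_smul_right, inner_sub_left, inner_sub_right, bx _ (hp _), bx' _ (hp _), Function.comp]
        push_cast
        congr 1
        refine Finset.sum_congr rfl fun j _ => ?_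
        ring
      · have : ∀ s, ⟪z, b s⟫ = 0 := fun s => by rw [← inner_conj_symm, b0 s z hz, map_zero]
        have e : ⟪z, x L⟫ = 0 := by
          rw [← inner_conj_symm, (Submodule.mem_orthogonal _ _).1 hz _ (Submodule.subset_span ⟨L, rfl⟩), map_zero]
        rw [c1, e]
        refine tendsto_const_nhds.congr fun k => ?_
        rw [Fapp, inner_smul_right, inner_sum]
        simp [inner_smul_right, inner_sub_right, this]
    · rw [c0 y hy]
      refine tendsto_const_nhds.congr fun k => ?_
      rw [Fapp]
      simp [inner_sub_left, b0 _ _ hy]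
  exact (wkClosed_wkClosure _).mem_of_tendsto clim (Eventually.of_forall fun k => subset_wkClosure _ (Fmem k))

theorem erdos [TopologicalSpace.SeparableSpace H] {N : Set (Submodule ℂ H)} (hN : IsNest N) : 
    (1 : H →L[ℂ] H) ∈ wkClosure (Submodule.span ℂ (nestG N) : Set (H →L[ℂ] H)) := by
  obtain ⟨P, hP, hP1, hP2⟩ := cyc_exhaust (nAlg N) (nAlg_star N hN)
  refine (wkClosed_wkClosure _).mem_of_tendsto (f := P) (l := atTop) ?_ (Eventually.of_forall fun n => ?_)
  · refine tendsto_sw_of_bdd' hP1 fun x y => ?_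
    exact Filter.Tendsto.inner tendsto_const_nhds (hP2 x)
  · have : Submodule.span ℂ (range (cycP (nAlg N))) ≤ wkSub (Submodule.span ℂ (nestG N)) := by
      rw [Submodule.span_le]
      rintro _ ⟨ξ, rfl⟩
      exact cycP_mem hN ξ
    exact this (hP n)

end Erdos
end OpSynth

namespace OpSynth
set_option linter.all false
section NestBim
open Filter Topology ContinuousLinearMap
variable {H H₁ H₂ : Type*} [NormedAddCommGroup H] [InnerProductSpace ℂ H] [CompleteSpace H]
  [NormedAddCommGroup H₁] [InnerProductSpace ℂ H₁] [CompleteSpace H₁]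
  [NormedAddCommGroup H₂] [InnerProductSpace ℂ H₂] [CompleteSpace H₂]

lemma masa_proj {D : StarSubalgebra ℂ (H →L[ℂ] H)} (hD : IsMasa D) {L : Submodule ℂ H} (hL : IsClosed (L : Set H))
    (h : ∀ d ∈ D, ∀ x ∈ L, d x ∈ L) : pr L ∈ D := by
  have hL' := hL.submodule_topologicalClosure_eq
  have hc : ∀ d ∈ D, pr L * d = d * pr L := by
    intro d hd
    apply starProj_commute
    · rw [hL']; exact h d hd
    · rw [hL']; exact h _ (D.star_mem' hd)
  have hs : star (pr L) = pr L := (pr_proj L).2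
  have hcom : ∀ a ∈ insert (pr L) (D : Set (H →L[ℂ] H)), ∀ b ∈ insert (pr L) (D : Set (H →L[ℂ] H)), a * b = b * a := by
    rintro a (rfl | ha) b (rfl | hb)
    · rfl
    · exact hc b hb
    · exact (hc a ha).symm
    · exact hD.1 a ha b hb
  have hst : ∀ b ∈ insert (pr L) (D : Set (H →L[ℂ] H)), star b ∈ insert (pr L) (D : Set (H →L[ℂ] H)) := by
    rintro b (rfl | hb)
    · rw [hs]; exact mem_insert _ _
    · exact Or.inr (D.star_mem' hb)
  have hE := StarAlgebra.isMulCommutative_adjoin ℂ hcom (fun a ha b hb => hcom a ha _ (hst b hb))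
  have := hD.2 (StarAlgebra.adjoin ℂ (insert (pr L) (D : Set (H →L[ℂ] H)))) (fun a ha b hb => setLike_mul_comm ha hb)
    (fun d hd => StarAlgebra.subset_adjoin ℂ _ (Or.inr hd))
  rw [← this]
  exact StarAlgebra.subset_adjoin ℂ _ (mem_insert _ _)

def phiN (V : Submodule ℂ (H₁ →L[ℂ] H₂)) (L : Submodule ℂ H₁) : Submodule ℂ H₂ :=
  (Submodule.span ℂ {y | ∃ v ∈ V, ∃ x ∈ L, y = v x}).topologicalClosure

lemma phiN_closed (V : Submodule ℂ (H₁ →L[ℂ] H₂)) (L : Submodule ℂ H₁) : IsClosed (phiN V L : Set H₂) :=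
  Submodule.isClosed_topologicalClosure _

lemma mem_phiN {V : Submodule ℂ (H₁ →L[ℂ] H₂)} {L : Submodule ℂ H₁} {v : H₁ →L[ℂ] H₂} (hv : v ∈ V) {x : H₁} (hx : x ∈ L) :
    v x ∈ phiN V L := Submodule.le_topologicalClosure _ (Submodule.subset_span ⟨v, hv, x, hx, rfl⟩)

lemma phiN_le {V : Submodule ℂ (H₁ →L[ℂ] H₂)} {L : Submodule ℂ H₁} {M : Submodule ℂ H₂} (hM : IsClosed (M : Set H₂)) 
    (h : ∀ v ∈ V, ∀ x ∈ L, v x ∈ M) : phiN V L ≤ M := by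
  apply Submodule.topologicalClosure_minimal _ _ hM
  rw [Submodule.span_le]
  rintro _ ⟨v, hv, x, hx, rfl⟩
  exact h v hv x hx

lemma phiN_mono (V : Submodule ℂ (H₁ →L[ℂ] H₂)) {L M : Submodule ℂ H₁} (h : L ≤ M) : phiN V L ≤ phiN V M :=
  phiN_le (phiN_closed _ _) fun v hv x hx => mem_phiN hv (h hx)

def psiN (V : Submodule ℂ (H₁ →L[ℂ] H₂)) (L : Submodule ℂ H₁) : Submodule ℂ H₁ :=
  ⨅ v ∈ V, (phiN V L).comap (v : H₁ →L[ℂ] H₂).toLinearMap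

lemma mem_psiN {V : Submodule ℂ (H₁ →L[ℂ] H₂)} {L : Submodule ℂ H₁} {x : H₁} : x ∈ psiN V L ↔ ∀ v ∈ V, v x ∈ phiN V L := by
  simp [psiN, Submodule.mem_iInf]

lemma psiN_closed (V : Submodule ℂ (H₁ →L[ℂ] H₂)) (L : Submodule ℂ H₁) : IsClosed (psiN V L : Set H₁) := by
  have : (psiN V L : Set H₁) = ⋂ v ∈ V, (v : H₁ →L[ℂ] H₂) ⁻¹' (phiN V L) := by
    ext x; simp [mem_psiN]
  rw [this]
  exact isClosed_biInter fun v _ => (phiN_closed V L).preimage v.continuous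

lemma le_psiN (V : Submodule ℂ (H₁ →L[ℂ] H₂)) (L : Submodule ℂ H₁) : L ≤ psiN V L :=
  fun x hx => mem_psiN.2 fun v hv => mem_phiN hv hx

lemma nest_reflexive [TopologicalSpace.SeparableSpace H₁] {V : Submodule ℂ (H₁ →L[ℂ] H₂)} (hV : WkClosed (V : Set (H₁ →L[ℂ] H₂))) 
    {N : Set (Submodule ℂ H₁)} (hN : IsNest N)
    (hVN : ∀ X ∈ V, ∀ A ∈ nestAlg N, X ∘L A ∈ V) {X : H₁ →L[ℂ] H₂} (hX : ∀ L ∈ N, ∀ x ∈ L, X x ∈ phiN V L) : X ∈ V := by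
  have h1 := wkClosure_map (S := (Submodule.span ℂ (nestG N) : Set (H₁ →L[ℂ] H₁))) (wkc_comp (1 : H₁ →L[ℂ] H₁) X) hV (by
    intro G hG
    have : Submodule.span ℂ (nestG N) ≤ V.comap (sandwich (1 : H₁ →L[ℂ] H₁) X) := by
      rw [Submodule.span_le]
      rintro _ ⟨L, hL, b, hb, a, ha, rfl⟩
      have h2 : phiN V L ≤ V.comap (smulRightL ℂ H₁ H₂ (innerSL ℂ a)).toLinearMap := by
        apply phiN_le
        · exact hV.isClosed.preimage (smulRightL ℂ H₁ H₂ (innerSL ℂ a)).continuous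
        · intro v hv x hx
          have h3 : rk x a ∈ nestAlg N := by
            intro M hM m hm
            rw [rk_apply]
            rcases ha M hM with h | h
            · exact M.smul_mem _ (h hx)
            · rw [← inner_conj_symm, h m hm, map_zero, zero_smul]; exact M.zero_mem
          have h4 := hVN v hv _ h3
          have e : v ∘L rk x a = smulRightL ℂ H₁ H₂ (innerSL ℂ a) (v x) := by
            ext z; simp [rk_apply]
          rw [e] at h4
          exact h4
      have h5 := h2 (hX L hL b hb)
      have e : sandwich (1 : H₁ →L[ℂ] H₁) X (rk b a) = smulRightL ℂ H₁ H₂ (innerSL ℂ a) (X b) := by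
        ext z; simp [sandwich, rk_apply]
      change sandwich (1 : H₁ →L[ℂ] H₁) X (rk b a) ∈ V
      rw [e]; exact h5
    exact this hG) 1 (erdos hN)
  exact h1

lemma goodB_of [TopologicalSpace.SeparableSpace H₁] {D₁ : StarSubalgebra ℂ (H₁ →L[ℂ] H₁)} {D₂ : StarSubalgebra ℂ (H₂ →L[ℂ] H₂)} 
    (hD₁ : IsMasa D₁) (hD₂ : IsMasa D₂) {B : Set (H₁ →L[ℂ] H₂)} (h1 : IsMasaBimodule D₁ D₂ B) (h2 : IsNestBimodule B) :
    ∃ (V : Submodule ℂ (H₁ →L[ℂ] H₂)) (C : Set ((H₁ →L[ℂ] H₁) × (H₂ →L[ℂ] H₂))), (V : Set (H₁ →L[ℂ] H₂)) = B ∧ 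
      GoodB (D₁ : Set (H₁ →L[ℂ] H₁)) (D₂ : Set (H₂ →L[ℂ] H₂)) V C := by
  obtain ⟨⟨⟨V, rfl⟩, hV⟩, hb⟩ := h1
  obtain ⟨-, N, N₂, hN, hN₂, hbi⟩ := h2
  have hVN : ∀ X ∈ V, ∀ A ∈ nestAlg N, X ∘L A ∈ V := fun X hX A hA => hbi X hX A hA 1 (fun p _ x hx => hx)
  have refl : ∀ {X : H₁ →L[ℂ] H₂}, (∀ L ∈ N, ∀ x ∈ L, X x ∈ phiN V L) → X ∈ V := fun hX => nest_reflexive hV hN hVN hX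
  refine ⟨V, (fun L => (pr (psiN V L), pr (phiN V L))) '' N, rfl, hV, hb, ?_, ?_, ?_, ?_, ?_, ?_⟩
  · rintro _ ⟨L, hL, rfl⟩
    apply masa_proj hD₁ (psiN_closed _ _)
    intro d hd x hx
    rw [mem_psiN] at hx ⊢
    intro v hv
    exact hx _ (hb v hv d hd 1 D₂.one_mem)
  · rintro _ ⟨L, hL, rfl⟩
    apply masa_proj hD₂ (phiN_closed _ _)
    intro d hd x hx
    have : phiN V L ≤ (phiN V L).comap d.toLinearMap := by
      apply phiN_le
      · exact (phiN_closed V L).preimage d.continuous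
      · intro v hv x hx
        exact mem_phiN (hb v hv 1 D₁.one_mem d hd) hx
    exact this hx
  · rintro _ ⟨L, hL, rfl⟩
    exact ⟨pr_proj _, pr_proj _⟩
  · intro X hX
    apply refl
    intro L hL x hx
    have h := congrArg (fun f => f x) (hX _ ⟨L, hL, rfl⟩)
    simp only [comp_apply] at h
    rw [pr_self (le_psiN V L hx)] at h
    exact mem_of_pr (phiN_closed _ _) h
  · rintro _ ⟨L, hL, rfl⟩ X
    apply refl
    intro M hM x hx
    rcases hN.2.1.total hM hL with h | h
    · have : (1 - pr (psiN V L)) x = 0 := by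
        simp [pr_self (le_psiN V L (h hx))]
      simp only [comp_apply]
      rw [this, map_zero, map_zero]; exact Submodule.zero_mem _
    · exact phiN_mono V h (pr_mem (phiN_closed _ _) _)
  · rintro _ ⟨L, hL, rfl⟩ X hX
    ext x
    have : X (pr (psiN V L) x) ∈ phiN V L := mem_psiN.1 (pr_mem (psiN_closed _ _) x) X hX
    simp [pr_self this]

lemma wkClosure_zero : wkClosure ({0} : Set (H₁ →L[ℂ] H₂)) = {0} := by
  apply Subset.antisymm _ (subset_wkClosure _)
  intro X hX
  obtain ⟨u, hu, hu'⟩ := (@mem_closure_iff_ultrafilter _ _ _ (sigmaWeak H₁ H₂)).1 hX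
  have ht : Tendsto (fun Y : H₁ →L[ℂ] H₂ => Y) u (@nhds _ (sigmaWeak H₁ H₂) X) := hu'
  rw [mem_singleton_iff]
  ext x
  apply ext_inner_left ℂ
  intro y
  have h1 := tendsto_sw_inner ht x y
  have h2 : Tendsto (fun Y : H₁ →L[ℂ] H₂ => ⟪y, Y x⟫) u (𝓝 0) := by
    refine tendsto_const_nhds.congr' ?_
    filter_upwards [hu] with Y hY
    rw [mem_singleton_iff.1 hY]; simp
  rw [tendsto_nhds_unique h1 h2]; simp

lemma ssigma_zero : HasSsigma ({0} : Set (H₁ →L[ℂ] H₂)) := by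
  intro K₁ K₂ T₁ T₂ _ _ _ _ _ _ _ _ _ _ _ _ t₁ t₂ ht₁ ht₂ U hU
  apply Subset.antisymm
  · intro X hX
    refine wTensor_induct LinearMap.id (@continuous_id _ (sigmaWeak T₁ T₂)) (wTS t₁ t₂ {0} U) (wTensor_closed _ _) ?_ X hX.1
    intro S hS R _ W hW
    rw [mem_singleton_iff] at hS
    subst hS
    have : W = 0 := by
      apply tensor_ext ht₁
      intro x y
      rw [hW x y]
      have := ht₂.2.2.1 0 0 (R y)
      simpa using this
    rw [this]
    exact Submodule.zero_mem _
  · exact fun X hX => ⟨wTensor_mono (le_refl _) (subset_univ _) hX, wTensor_mono (subset_univ _) (le_refl _) hX⟩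

theorem final_aux [TopologicalSpace.SeparableSpace H₁] [TopologicalSpace.SeparableSpace H₂]
    {D₁ : StarSubalgebra ℂ (H₁ →L[ℂ] H₁)} {D₂ : StarSubalgebra ℂ (H₂ →L[ℂ] H₂)} 
    (hD₁ : IsMasa D₁) (hD₂ : IsMasa D₂) {n : ℕ} (Bs : Fin n → Set (H₁ →L[ℂ] H₂))
    (hBs : ∀ i, HasFiniteWidth D₁ D₂ (Bs i)) : 
    ∃ W : Submodule ℂ (H₁ →L[ℂ] H₂), (W : Set (H₁ →L[ℂ] H₂)) = wkClosure (setSum Bs) ∧ 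
      (∀ X ∈ W, ∀ A ∈ D₁, ∀ B ∈ D₂, B ∘L X ∘L A ∈ W) ∧ HasSsigma (W : Set (H₁ →L[ℂ] H₂)) := by
  induction n with
  | zero => 
    refine ⟨⊥, ?_, ?_, ssigma_zero⟩
    · have : setSum Bs = {0} := by
        ext x; simp [setSum]
      rw [this, wkClosure_zero]; rfl
    · intro X hX A _ B _
      rw [Submodule.mem_bot] at hX
      subst hX; simp
  | succ n ih => 
    obtain ⟨W, hW, hWb, hWs⟩ := ih (fun i => Bs i.castSucc) (fun i => hBs _)
    have hWc : WkClosed (W : Set (H₁ →L[ℂ] H₂)) := by rw [hW]; exact wkClosed_wkClosure _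
    obtain ⟨k, Vs, hVs, hV⟩ := hBs (Fin.last n)
    choose V C hVe hG using fun j => goodB_of hD₁ hD₂ (hVs j).1 (hVs j).2
    have hBl : Bs (Fin.last n) = ((⨅ i ∈ (Finset.univ : Finset (Fin k)), V i : Submodule ℂ (H₁ →L[ℂ] H₂)) : Set (H₁ →L[ℂ] H₂)) := by
      rw [hV]; ext X; simp [Submodule.mem_iInf, ← hVe]
    refine ⟨wkSub (W ⊔ ⨅ i ∈ (Finset.univ : Finset (Fin k)), V i), ?_, ?_, ?_⟩
    · apply Subset.antisymm
      · apply wkClosure_min _ (wkClosed_wkClosure _)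
        intro X hX
        obtain ⟨w, hw, b, hb, rfl⟩ := Submodule.mem_sup.1 hX
        have hb' : b ∈ Bs (Fin.last n) := by rw [hBl]; exact hb
        have hw' : w ∈ wkClosure (setSum fun i : Fin n => Bs i.castSucc) := by rw [← hW]; exact hw
        refine wkClosure_map (wkc_add b) (wkClosed_wkClosure _) ?_ w hw'
        rintro _ ⟨f, hf, rfl⟩
        apply subset_wkClosure
        refine ⟨Fin.snoc (α := fun _ => H₁ →L[ℂ] H₂) f b, ?_, ?_⟩
        · intro i
          refine Fin.lastCases ?_ (fun i => ?_) i
          · simpa using hb'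
          · simpa using hf i
        · rw [Fin.sum_univ_castSucc]; simp
      · apply wkClosure_mono
        rintro _ ⟨f, hf, rfl⟩
        rw [Fin.sum_univ_castSucc]
        apply Submodule.add_mem_sup
        · have : ∑ i : Fin n, f i.castSucc ∈ (W : Set (H₁ →L[ℂ] H₂)) := by
            rw [hW]
            exact subset_wkClosure _ ⟨fun i => f i.castSucc, fun i => hf _, rfl⟩
          exact this
        · have := hf (Fin.last n)
          rw [hBl] at this
          exact this
    · apply sup_bim (D₁ := (D₁ : Set (H₁ →L[ℂ] H₁))) (D₂ := (D₂ : Set (H₂ →L[ℂ] H₂))) hWb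
      intro X hX A hA A' hA'
      simp only [Submodule.mem_iInf] at hX ⊢
      exact fun i hi => (hG i).bim X (hX i hi) A hA A' hA'
    · exact main_step hD₁.1 hD₂.1 W hWc hWb hWs V C hG Finset.univ

end NestBim
end OpSynth

/-- Corollary `c_tm`. -/
theorem statement6
    {H₁ H₂ : Type*}
    [NormedAddCommGroup H₁] [InnerProductSpace ℂ H₁] [CompleteSpace H₁]
    [NormedAddCommGroup H₂] [InnerProductSpace ℂ H₂] [CompleteSpace H₂]
    [TopologicalSpace.SeparableSpace H₁] [TopologicalSpace.SeparableSpace H₂]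
    (D₁ : StarSubalgebra ℂ (H₁ →L[ℂ] H₁)) (D₂ : StarSubalgebra ℂ (H₂ →L[ℂ] H₂))
    (hD₁ : IsMasa D₁) (hD₂ : IsMasa D₂)
    {n : ℕ} (Bs : Fin n → Set (H₁ →L[ℂ] H₂))
    (hBs : ∀ i, HasFiniteWidth D₁ D₂ (Bs i)) :
    HasSsigma (wkClosure (setSum Bs)) := by
  obtain ⟨W, hW, -, hWs⟩ := final_aux hD₁ hD₂ Bs hBs
  rw [← hW]; exact hWs
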